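/- Let g be a Riemannian metric on T² and let c: ℝ → ℝ² be a lift of a geodesic to the universal covering which has two self-intersections in the following configuration: there exist t₁ < t₂ < t₃ < t₄ with c(t₁) = c(t₂) and c(t₃) = c(t₄). Then the geodesic flow of g has positive topological entropy. -/

import Mathlib

open Filter Topology Set
open scoped ENNReal

noncomputable section

/-- The Euclidean norm of a point of `ℝ × ℝ` (the universal covering of `T²`). -/
def norm2 (p : ℝ × ℝ) : ℝ := Real.sqrt (p.1 ^ 2 + p.2 ^ 2)

/-- The translation vector of the covering transformation `τ_{(m,n)}` of `T² = ℝ²/ℤ²`. -/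
def lat (k : ℤ × ℤ) : ℝ × ℝ := ((k.1 : ℝ), (k.2 : ℝ))

/-- The transl of a curve in `ℝ²` by the covering transformation `τ_k`. -/
def transl (k : ℤ × ℤ) (c : ℝ → ℝ × ℝ) : ℝ → ℝ × ℝ := fun t => c t + lat k

/-- The asymptotic direction `δ(τ_k)` of the axes of the translation element `τ_k`. -/
def latDir (k : ℤ × ℤ) : ℝ × ℝ := (norm2 (lat k))⁻¹ • lat k

/-- A smooth Riemannian metric on the torus `T² = ℝ²/ℤ²`, described through its lift to the
universal covering `ℝ²`: a smooth family of positive definite symmetric bilinear forms on the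
tangent spaces of `ℝ²`, invariant under the deck transformation group `ℤ²`. -/
structure TorusMetric where
  g : (ℝ × ℝ) → (ℝ × ℝ) → (ℝ × ℝ) → ℝ
  smooth : ContDiff ℝ (⊤ : ℕ∞) fun p : (ℝ × ℝ) × (ℝ × ℝ) × (ℝ × ℝ) => g p.1 p.2.1 p.2.2
  symm : ∀ x v w, g x v w = g x w v
  linear : ∀ x w, IsLinearMap ℝ fun v => g x v w
  posdef : ∀ x v, v ≠ 0 → 0 < g x v v
  periodic : ∀ (k : ℤ × ℤ) (x v w : ℝ × ℝ), g (x + lat k) v w = g x v w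

namespace TorusMetric

/-- The Riemannian length of the curve `c` between the parameters `a` and `b`. -/
def length (M : TorusMetric) (c : ℝ → ℝ × ℝ) (a b : ℝ) : ℝ :=
  ∫ t in a..b, Real.sqrt (M.g (c t) (deriv c t) (deriv c t))

/-- The Riemannian distance on the universal covering `ℝ²` (hence also on `T²`). -/
def dist (M : TorusMetric) (x y : ℝ × ℝ) : ℝ :=
  sInf {L | ∃ c : ℝ → ℝ × ℝ, ContDiff ℝ 1 c ∧ c 0 = x ∧ c 1 = y ∧ L = M.length c 0 1}

/-- A (complete, unit speed) geodesic of the lifted metric on the universal covering `ℝ²`: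
a smooth curve with constant unit speed which is locally length minimizing. -/
def IsGeodesic (M : TorusMetric) (c : ℝ → ℝ × ℝ) : Prop :=
  ContDiff ℝ (⊤ : ℕ∞) c ∧ (∀ t, M.g (c t) (deriv c t) (deriv c t) = 1) ∧
    ∀ t : ℝ, ∃ ε > 0, ∀ s₁ s₂, t - ε ≤ s₁ → s₁ ≤ s₂ → s₂ ≤ t + ε →
      M.dist (c s₁) (c s₂) = M.length c s₁ s₂

end TorusMetric

/-- The distance between two points of the unit tangent bundle `ST²` of the torus; points of
`ST²` are represented by points of the tangent bundle `ℝ² × ℝ²` of the universal covering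
(the deck transformations act trivially on the vector component). -/
def phaseDist (p q : (ℝ × ℝ) × (ℝ × ℝ)) : ℝ :=
  sInf {r : ℝ | ∃ k : ℤ × ℤ, r = norm2 (p.1 - (q.1 + lat k)) + norm2 (p.2 - q.2)}

/-- A `(φ,ε)`-separated set with respect to time `T` for the geodesic flow `φ` of `M` on
`ST²`: a finite family of geodesics (each geodesic `c` representing the phase point
`(c 0, ċ 0) ∈ ST²`, of which `t ↦ (c t, ċ t)` is the flow orbit) such that any two distinct
members satisfy `max_{0 ≤ t ≤ T} d(φᵗ v, φᵗ w) > ε`. -/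
def IsSeparated (M : TorusMetric) (ε T : ℝ) (F : Finset (ℝ → ℝ × ℝ)) : Prop :=
  (∀ c ∈ F, M.IsGeodesic c) ∧
    ∀ c₁ ∈ F, ∀ c₂ ∈ F, c₁ ≠ c₂ →
      ∃ t ∈ Set.Icc (0 : ℝ) T, ε < phaseDist (c₁ t, deriv c₁ t) (c₂ t, deriv c₂ t)

/-- `r_T(φ, ε)`: the maximal cardinality of `(φ,ε)`-separated sets with respect to `T`. -/
def sepCount (M : TorusMetric) (ε T : ℝ) : ℝ≥0∞ :=
  ⨆ (F : Finset (ℝ → ℝ × ℝ)) (_ : IsSeparated M ε T F), (F.card : ℝ≥0∞)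

/-- Extended real logarithm of an extended nonnegative real. -/
def elog (x : ℝ≥0∞) : EReal :=
  if x = 0 then ⊥ else if x = ⊤ then ⊤ else ((Real.log x.toReal : ℝ) : EReal)

/-- Bowen's topological entropy `h_top(g)` of the geodesic flow of `g` on `ST²`:
`lim_{ε → 0} limsup_{T → ∞} (1/T) log r_T(φ,ε)`; since `r_T(φ,ε)` is monotone in `ε`,
the limit `ε → 0` is realized as the supremum over `ε > 0`. -/
def topEnt (M : TorusMetric) : EReal :=
  ⨆ (ε : ℝ) (_ : 0 < ε),
    Filter.limsup (fun T : ℝ => ((T⁻¹ : ℝ) : EReal) * elog (sepCount M ε T)) Filter.atTop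

/-- The forward ray `c⁺` of `c` is escaping: `‖c(t)‖ → ∞` as `t → ∞`. -/
def EscapesForward (c : ℝ → ℝ × ℝ) : Prop :=
  Filter.Tendsto (fun t => norm2 (c t)) Filter.atTop Filter.atTop

/-- The backward ray `c⁻` of `c` is escaping: `‖c(-t)‖ → ∞` as `t → ∞`. -/
def EscapesBackward (c : ℝ → ℝ × ℝ) : Prop :=
  Filter.Tendsto (fun t => norm2 (c (-t))) Filter.atTop Filter.atTop

/-- `z ∈ S¹` is the asymptotic direction `δ(c⁺) = lim_{t → ∞} c(t)/‖c(t)‖` of the forward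
ray of `c`. -/
def HasDirection (c : ℝ → ℝ × ℝ) (z : ℝ × ℝ) : Prop :=
  norm2 z = 1 ∧ Filter.Tendsto (fun t => (norm2 (c t))⁻¹ • c t) Filter.atTop (nhds z)

/-- The canonical projection `π : S¹ → P¹(ℝ) ≅ ℝ ∪ {∞}`, sending `(x, y)` to `y/x` if
`x ≠ 0` and to `∞` otherwise; `ℝ ∪ {∞}` is the one-point compactification of `ℝ`. -/
def projPt (z : ℝ × ℝ) : OnePoint ℝ :=
  if z.1 = 0 then OnePoint.infty else ((z.2 / z.1 : ℝ) : OnePoint ℝ)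

/-- `crossDet v w ≠ 0` expresses transversality of two directions in `ℝ²`. -/
def crossDet (v w : ℝ × ℝ) : ℝ := v.1 * w.2 - v.2 * w.1

/-- The set of points at which the curve `c₁` (restricted to parameters in `D₁`) and the
curve `c₂` (restricted to parameters in `D₂`) intersect transversally. -/
def transInter (c₁ c₂ : ℝ → ℝ × ℝ) (D₁ D₂ : Set ℝ) : Set (ℝ × ℝ) :=
  {x | ∃ s ∈ D₁, ∃ t ∈ D₂, c₁ s = x ∧ c₂ t = x ∧ crossDet (deriv c₁ s) (deriv c₂ t) ≠ 0}

/-- The geodesic `c` is an axis of the (nontrivial) translation element `τ_k`: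
`τ_k c(t) = c(t + ℓ)` for some `ℓ` and all `t`. -/
def IsAxisOf (M : TorusMetric) (c : ℝ → ℝ × ℝ) (k : ℤ × ℤ) : Prop :=
  M.IsGeodesic c ∧ k ≠ 0 ∧ ∃ ℓ : ℝ, ∀ t, c (t + ℓ) = c t + lat k

/-- The geodesic `c` is an axis of some nontrivial translation element. -/
def IsAxis (M : TorusMetric) (c : ℝ → ℝ × ℝ) : Prop := ∃ k : ℤ × ℤ, IsAxisOf M c k

/-- The curve `c` is minimal: each of its segments minimizes the Riemannian length between
its endpoints. -/
def IsMinimal (M : TorusMetric) (c : ℝ → ℝ × ℝ) : Prop :=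
  ∀ s t : ℝ, s ≤ t → M.dist (c s) (c t) = M.length c s t

/-- Equivalence of translation elements: `τ₁^a = τ₂^b` for some nonzero integers `a, b`. -/
def TransEquiv (k₁ k₂ : ℤ × ℤ) : Prop := ∃ a b : ℤ, a ≠ 0 ∧ b ≠ 0 ∧ a • k₁ = b • k₂

/-- A translation element is primitive if it is not a nontrivial power of another
translation element. -/
def IsPrimitive (k : ℤ × ℤ) : Prop := k ≠ 0 ∧ ∀ (j : ℤ × ℤ) (n : ℤ), k = n • j → IsUnit n

/-- The metric `g` on `T²` is flat, i.e. its Gaussian curvature vanishes identically;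
equivalently (by the theorems of Myers–Steenrod and Cartan–Hadamard), the universal covering
`ℝ²` with the induced Riemannian distance is isometric to the Euclidean plane. -/
def IsFlat (M : TorusMetric) : Prop :=
  ∃ F : (ℝ × ℝ) ≃ (ℝ × ℝ), ∀ x y, M.dist x y = norm2 (F x - F y)

/-- Every point of the plane is a lattice translate of a point of the unit square. -/
lemma exists_eq_add_lat (x : ℝ × ℝ) : ∃ y ∈ Icc (0 : ℝ × ℝ) 1, ∃ k : ℤ × ℤ, x = y + lat k := by
  refine ⟨(Int.fract x.1, Int.fract x.2), ⟨⟨?_, ?_⟩, ⟨?_, ?_⟩⟩, (⌊x.1⌋, ⌊x.2⌋), ?_⟩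
  · exact Int.fract_nonneg _
  · exact Int.fract_nonneg _
  · exact (Int.fract_lt_one _).le
  · exact (Int.fract_lt_one _).le
  · ext <;> simp [lat]

lemma periodic_bounded {F : Type*} [NormedAddCommGroup F] {f : ℝ × ℝ → F} (hf : Continuous f)
    (hp : ∀ (k : ℤ × ℤ) x, f (x + lat k) = f x) : ∃ C > 0, ∀ x, ‖f x‖ ≤ C := by
  obtain ⟨C, hC⟩ := (isCompact_Icc (a := (0 : ℝ × ℝ)) (b := 1)).exists_bound_of_continuousOn
    hf.continuousOn
  refine ⟨max C 1, by positivity, fun x => ?_⟩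
  obtain ⟨y, hy, k, rfl⟩ := exists_eq_add_lat x
  rw [hp]
  exact (hC y hy).trans (le_max_left _ _)

lemma norm_prod_eq (v : ℝ × ℝ) : ‖v‖ = max |v.1| |v.2| := rfl

lemma abs_fst_le (v : ℝ × ℝ) : |v.1| ≤ ‖v‖ := le_max_left _ _

lemma abs_snd_le (v : ℝ × ℝ) : |v.2| ≤ ‖v‖ := le_max_right _ _

namespace TorusMetric

/-- The `dx²` coefficient of the metric. -/
def ca (M : TorusMetric) (x : ℝ × ℝ) : ℝ := M.g x (1, 0) (1, 0)
/-- The `dx dy` coefficient of the metric. -/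
def cb (M : TorusMetric) (x : ℝ × ℝ) : ℝ := M.g x (1, 0) (0, 1)
/-- The `dy²` coefficient of the metric. -/
def cd (M : TorusMetric) (x : ℝ × ℝ) : ℝ := M.g x (0, 1) (0, 1)

lemma g_add_left (M : TorusMetric) (x v v' w : ℝ × ℝ) : M.g x (v + v') w = M.g x v w + M.g x v' w :=
  (M.linear x w).map_add v v'

lemma g_smul_left (M : TorusMetric) (x : ℝ × ℝ) (r : ℝ) (v w : ℝ × ℝ) :
    M.g x (r • v) w = r * M.g x v w := (M.linear x w).map_smul r v

lemma g_smul_right (M : TorusMetric) (x : ℝ × ℝ) (r : ℝ) (v w : ℝ × ℝ) :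
    M.g x v (r • w) = r * M.g x v w := by rw [M.symm, g_smul_left, M.symm]

lemma g_add_right (M : TorusMetric) (x v w w' : ℝ × ℝ) : M.g x v (w + w') = M.g x v w + M.g x v w' := by
  rw [M.symm, g_add_left, M.symm x w, M.symm x w']

lemma g_eq (M : TorusMetric) (x v w : ℝ × ℝ) : M.g x v w =
    v.1 * w.1 * M.ca x + (v.1 * w.2 + v.2 * w.1) * M.cb x + v.2 * w.2 * M.cd x := by
  have e : ∀ u : ℝ × ℝ, u = u.1 • ((1 : ℝ), (0 : ℝ)) + u.2 • ((0 : ℝ), (1 : ℝ)) := by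
    intro u; ext <;> simp
  rw [e v, e w, g_add_left, g_add_right, g_add_right]
  simp only [g_smul_left, g_smul_right]
  rw [M.symm x (0, 1) (1, 0)]
  simp [ca, cb, cd]
  ring

lemma contDiff_ca (M : TorusMetric) : ContDiff ℝ (⊤ : ℕ∞) M.ca :=
  M.smooth.comp (contDiff_id.prodMk
    (contDiff_const (c := (((1, 0) : ℝ × ℝ), ((1, 0) : ℝ × ℝ)))))

lemma contDiff_cb (M : TorusMetric) : ContDiff ℝ (⊤ : ℕ∞) M.cb :=
  M.smooth.comp (contDiff_id.prodMk
    (contDiff_const (c := (((1, 0) : ℝ × ℝ), ((0, 1) : ℝ × ℝ)))))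

lemma contDiff_cd (M : TorusMetric) : ContDiff ℝ (⊤ : ℕ∞) M.cd :=
  M.smooth.comp (contDiff_id.prodMk
    (contDiff_const (c := (((0, 1) : ℝ × ℝ), ((0, 1) : ℝ × ℝ)))))

lemma ca_pos (M : TorusMetric) (x : ℝ × ℝ) : 0 < M.ca x := M.posdef _ _ (by simp)

lemma det_pos (M : TorusMetric) (x : ℝ × ℝ) : 0 < M.ca x * M.cd x - M.cb x ^ 2 := by
  have h := M.posdef x (-M.cb x, M.ca x) (by simp [(M.ca_pos x).ne'])
  rw [g_eq] at h
  simp only at h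
  have h2 := M.ca_pos x
  have : 0 < M.ca x * (M.ca x * M.cd x - M.cb x ^ 2) := by nlinarith
  exact pos_of_mul_pos_right this h2.le

lemma g_nonneg (M : TorusMetric) (x v : ℝ × ℝ) : 0 ≤ M.g x v v := by
  by_cases h : v = 0
  · subst h; rw [g_eq]; simp
  · exact (M.posdef x v h).le

lemma g_cauchy_schwarz (M : TorusMetric) (x v w : ℝ × ℝ) :
    M.g x v w ^ 2 ≤ M.g x v v * M.g x w w := by
  simp only [g_eq]
  have h := (M.det_pos x).le
  nlinarith [mul_nonneg h (sq_nonneg (v.1 * w.2 - v.2 * w.1))]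

/-- The norm of a tangent vector. -/
def nrm (M : TorusMetric) (x v : ℝ × ℝ) : ℝ := Real.sqrt (M.g x v v)

lemma nrm_nonneg (M : TorusMetric) (x v : ℝ × ℝ) : 0 ≤ M.nrm x v := Real.sqrt_nonneg _

lemma nrm_sq (M : TorusMetric) (x v : ℝ × ℝ) : M.nrm x v ^ 2 = M.g x v v :=
  Real.sq_sqrt (M.g_nonneg x v)

lemma nrm_zero (M : TorusMetric) (x : ℝ × ℝ) : M.nrm x 0 = 0 := by
  simp [nrm, g_eq]

lemma g_le_nrm_mul (M : TorusMetric) (x v w : ℝ × ℝ) : M.g x v w ≤ M.nrm x v * M.nrm x w := by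
  rw [nrm, nrm, ← Real.sqrt_mul (M.g_nonneg x v)]
  exact Real.le_sqrt_of_sq_le (M.g_cauchy_schwarz x v w)

lemma nrm_smul (M : TorusMetric) (x : ℝ × ℝ) (r : ℝ) (v : ℝ × ℝ) :
    M.nrm x (r • v) = |r| * M.nrm x v := by
  rw [nrm, g_smul_left, g_smul_right, ← mul_assoc, Real.sqrt_mul (mul_self_nonneg r),
    Real.sqrt_mul_self_eq_abs, nrm]

lemma continuous_nrm (M : TorusMetric) : Continuous fun p : (ℝ × ℝ) × (ℝ × ℝ) => M.nrm p.1 p.2 := by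
  have h : Continuous fun p : (ℝ × ℝ) × (ℝ × ℝ) => M.g p.1 p.2 p.2 :=
    M.smooth.continuous.comp (continuous_fst.prodMk (continuous_snd.prodMk continuous_snd))
  exact h.sqrt

lemma nrm_periodic (M : TorusMetric) (k : ℤ × ℤ) (x v : ℝ × ℝ) :
    M.nrm (x + lat k) v = M.nrm x v := by simp [nrm, M.periodic]

lemma exists_nrm_bounds (M : TorusMetric) : ∃ m > 0, ∃ C > 0, ∀ x v : ℝ × ℝ,
    m * ‖v‖ ≤ M.nrm x v ∧ M.nrm x v ≤ C * ‖v‖ := by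
  have hK : IsCompact (Icc (0 : ℝ × ℝ) 1 ×ˢ Metric.sphere (0 : ℝ × ℝ) 1) :=
    isCompact_Icc.prod (isCompact_sphere _ _)
  have hne : (Icc (0 : ℝ × ℝ) 1 ×ˢ Metric.sphere (0 : ℝ × ℝ) 1).Nonempty :=
    ⟨((0, 0), (1, 0)), ⟨⟨le_refl _, by constructor <;> simp⟩, by simp [Prod.norm_def]⟩⟩
  obtain ⟨p, hp, hmin⟩ := hK.exists_isMinOn hne M.continuous_nrm.continuousOn
  obtain ⟨q, hq, hmax⟩ := hK.exists_isMaxOn hne M.continuous_nrm.continuousOn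
  have hpp : 0 < M.nrm p.1 p.2 := by
    apply Real.sqrt_pos.2 (M.posdef _ _ _)
    intro h
    have := hp.2
    simp [h] at this
  have key : ∀ x v : ℝ × ℝ, M.nrm p.1 p.2 * ‖v‖ ≤ M.nrm x v ∧ M.nrm x v ≤ M.nrm q.1 q.2 * ‖v‖ := by
    intro x v
    by_cases hv : v = 0
    · subst hv; simp [nrm_zero]
    have hv' : 0 < ‖v‖ := norm_pos_iff.2 hv
    obtain ⟨y, hy, k, rfl⟩ := exists_eq_add_lat x
    have e : v = ‖v‖ • (‖v‖⁻¹ • v) := by rw [smul_smul, mul_inv_cancel₀ hv'.ne', one_smul]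
    have hs : (y, ‖v‖⁻¹ • v) ∈ Icc (0 : ℝ × ℝ) 1 ×ˢ Metric.sphere (0 : ℝ × ℝ) 1 := by
      refine ⟨hy, ?_⟩
      simp [norm_smul, hv'.ne']
    have h1 := hmin hs
    have h2 := hmax hs
    simp only [mem_ofPred_eq] at h1 h2
    have e2 : M.nrm (y + lat k) v = ‖v‖ * M.nrm y (‖v‖⁻¹ • v) := by
      conv_lhs => rw [e]
      rw [nrm_smul, nrm_periodic, abs_of_pos hv']
    rw [e2]
    constructor <;> nlinarith
  refine ⟨_, hpp, M.nrm q.1 q.2, ?_, key⟩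
  have := hmax hp
  simp only [mem_ofPred_eq] at this
  linarith

/-- A lower bound for the metric in terms of the sup norm. -/
def lo (M : TorusMetric) : ℝ := M.exists_nrm_bounds.choose
/-- An upper bound for the metric in terms of the sup norm. -/
def hi (M : TorusMetric) : ℝ := M.exists_nrm_bounds.choose_spec.2.choose

lemma lo_pos (M : TorusMetric) : 0 < M.lo := M.exists_nrm_bounds.choose_spec.1
lemma hi_pos (M : TorusMetric) : 0 < M.hi := M.exists_nrm_bounds.choose_spec.2.choose_spec.1
lemma lo_le (M : TorusMetric) (x v : ℝ × ℝ) : M.lo * ‖v‖ ≤ M.nrm x v :=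
  (M.exists_nrm_bounds.choose_spec.2.choose_spec.2 x v).1
lemma le_hi (M : TorusMetric) (x v : ℝ × ℝ) : M.nrm x v ≤ M.hi * ‖v‖ :=
  (M.exists_nrm_bounds.choose_spec.2.choose_spec.2 x v).2

lemma lattice_periodic_fderiv {f : ℝ × ℝ → ℝ} (hp : ∀ (k : ℤ × ℤ) x, f (x + lat k) = f x)
    (k : ℤ × ℤ) (x : ℝ × ℝ) : fderiv ℝ f (x + lat k) = fderiv ℝ f x := by
  rw [← fderiv_comp_add_right]
  congr 1
  funext y
  exact hp k y

lemma lattice_periodic_lipschitz {f : ℝ × ℝ → ℝ} (hf : ContDiff ℝ (⊤ : ℕ∞) f)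
    (hp : ∀ (k : ℤ × ℤ) x, f (x + lat k) = f x) : ∃ C > 0, ∀ x y, |f x - f y| ≤ C * ‖x - y‖ := by
  obtain ⟨C, hC, h⟩ := periodic_bounded (hf.continuous_fderiv (by simp)) (lattice_periodic_fderiv hp)
  refine ⟨C, hC, fun x y => ?_⟩
  exact Convex.norm_image_sub_le_of_norm_fderiv_le (𝕜 := ℝ) (s := univ) (f := f)
    (fun z _ => hf.differentiable (by simp) z) (fun z _ => h z) convex_univ (mem_univ _) (mem_univ _)

lemma ca_periodic (M : TorusMetric) (k : ℤ × ℤ) (x : ℝ × ℝ) : M.ca (x + lat k) = M.ca x :=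
  M.periodic _ _ _ _
lemma cb_periodic (M : TorusMetric) (k : ℤ × ℤ) (x : ℝ × ℝ) : M.cb (x + lat k) = M.cb x :=
  M.periodic _ _ _ _
lemma cd_periodic (M : TorusMetric) (k : ℤ × ℤ) (x : ℝ × ℝ) : M.cd (x + lat k) = M.cd x :=
  M.periodic _ _ _ _

lemma exists_g_lipschitz (M : TorusMetric) : ∃ C > 0, ∀ x y v : ℝ × ℝ,
    |M.g x v v - M.g y v v| ≤ C * ‖x - y‖ * ‖v‖ ^ 2 := by
  obtain ⟨A, hA, ha⟩ := lattice_periodic_lipschitz M.contDiff_ca M.ca_periodic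
  obtain ⟨B, hB, hb⟩ := lattice_periodic_lipschitz M.contDiff_cb M.cb_periodic
  obtain ⟨D, hD, hd⟩ := lattice_periodic_lipschitz M.contDiff_cd M.cd_periodic
  refine ⟨A + 2 * B + D, by positivity, fun x y v => ?_⟩
  have e : M.g x v v - M.g y v v = (v.1 * v.1) * (M.ca x - M.ca y)
      + (2 * (v.1 * v.2)) * (M.cb x - M.cb y) + (v.2 * v.2) * (M.cd x - M.cd y) := by
    simp only [g_eq]; ring
  have h1 := abs_fst_le v
  have h2 := abs_snd_le v
  have n1 := abs_nonneg v.1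
  have n2 := abs_nonneg v.2
  rw [e]
  refine (abs_add_three _ _ _).trans ?_
  simp only [abs_mul, abs_two]
  have b1 : |v.1| * |v.1| ≤ ‖v‖ ^ 2 := by nlinarith
  have b2 : |v.1| * |v.2| ≤ ‖v‖ ^ 2 := by nlinarith [norm_nonneg v]
  have b3 : |v.2| * |v.2| ≤ ‖v‖ ^ 2 := by nlinarith
  have c1 := mul_le_mul b1 (ha x y) (abs_nonneg _) (by positivity)
  have c2 := mul_le_mul b2 (hb x y) (abs_nonneg _) (by positivity)
  have c3 := mul_le_mul b3 (hd x y) (abs_nonneg _) (by positivity)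
  nlinarith

lemma exists_nrm_compare (M : TorusMetric) : ∃ C > 0, ∀ x y v : ℝ × ℝ,
    M.nrm y v ≤ (1 + C * ‖x - y‖) * M.nrm x v := by
  obtain ⟨C, hC, h⟩ := M.exists_g_lipschitz
  have hlo := M.lo_pos
  refine ⟨C / M.lo ^ 2, by positivity, fun x y v => ?_⟩
  apply Real.sqrt_le_iff.2
  refine ⟨mul_nonneg (by positivity) (M.nrm_nonneg _ _), ?_⟩
  have h1 := (abs_le.1 (h x y v)).1
  have h2 : M.lo ^ 2 * ‖v‖ ^ 2 ≤ M.nrm x v ^ 2 := by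
    rw [← mul_pow]
    exact pow_le_pow_left₀ (by positivity) (M.lo_le x v) 2
  have h3 : C * ‖x - y‖ * ‖v‖ ^ 2 ≤ C / M.lo ^ 2 * ‖x - y‖ * M.nrm x v ^ 2 := by
    have : C * ‖x - y‖ * ‖v‖ ^ 2 = C / M.lo ^ 2 * ‖x - y‖ * (M.lo ^ 2 * ‖v‖ ^ 2) := by
      field_simp
    rw [this]
    gcongr
  rw [mul_pow]
  have h5 : 0 ≤ C / M.lo ^ 2 * ‖x - y‖ := by positivity
  have h4 := M.nrm_sq x v
  nlinarith [sq_nonneg (M.nrm x v), mul_nonneg h5 (sq_nonneg (M.nrm x v)),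
    mul_nonneg (mul_nonneg h5 h5) (sq_nonneg (M.nrm x v))]

/-- A Lipschitz constant for the logarithm of the metric. -/
def osc (M : TorusMetric) : ℝ := M.exists_nrm_compare.choose
lemma osc_pos (M : TorusMetric) : 0 < M.osc := M.exists_nrm_compare.choose_spec.1
lemma nrm_le_osc (M : TorusMetric) (x y v : ℝ × ℝ) :
    M.nrm y v ≤ (1 + M.osc * ‖x - y‖) * M.nrm x v := M.exists_nrm_compare.choose_spec.2 x y v

end TorusMetric

namespace TorusMetric

lemma continuous_speed (M : TorusMetric) {c : ℝ → ℝ × ℝ} (hc : ContDiff ℝ 1 c) :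
    Continuous fun t => M.nrm (c t) (deriv c t) :=
  M.continuous_nrm.comp (hc.continuous.prodMk (hc.continuous_deriv le_rfl))

lemma length_eq (M : TorusMetric) (c : ℝ → ℝ × ℝ) (a b : ℝ) :
    M.length c a b = ∫ t in a..b, M.nrm (c t) (deriv c t) := rfl

lemma length_nonneg (M : TorusMetric) (c : ℝ → ℝ × ℝ) {a b : ℝ} (hab : a ≤ b) :
    0 ≤ M.length c a b :=
  intervalIntegral.integral_nonneg hab fun _ _ => Real.sqrt_nonneg _

lemma length_congr (M : TorusMetric) {c c' : ℝ → ℝ × ℝ} {a b : ℝ} (hab : a ≤ b)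
    (h : EqOn c c' (Icc a b)) : M.length c a b = M.length c' a b := by
  rw [length_eq, length_eq, intervalIntegral.integral_of_le hab,
    intervalIntegral.integral_of_le hab, MeasureTheory.integral_Ioc_eq_integral_Ioo,
    MeasureTheory.integral_Ioc_eq_integral_Ioo]
  refine MeasureTheory.setIntegral_congr_fun measurableSet_Ioo fun t ht => ?_
  have : c =ᶠ[𝓝 t] c' := by
    filter_upwards [Icc_mem_nhds ht.1 ht.2] with s hs using h hs
  simp only [this.deriv_eq, this.eq_of_nhds]

lemma length_comp (M : TorusMetric) {c : ℝ → ℝ × ℝ} (hc : ContDiff ℝ 1 c) {φ : ℝ → ℝ}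
    (hφ : ContDiff ℝ 1 φ) (hpos : ∀ t, 0 ≤ deriv φ t) (a b : ℝ) :
    M.length (c ∘ φ) a b = M.length c (φ a) (φ b) := by
  rw [length_eq, length_eq, ← intervalIntegral.integral_comp_mul_deriv (f' := deriv φ)
    (fun x _ => (hφ.differentiable one_ne_zero x).hasDerivAt)
    (hφ.continuous_deriv le_rfl).continuousOn (M.continuous_speed hc)]
  refine intervalIntegral.integral_congr fun t _ => ?_
  have : deriv (c ∘ φ) t = deriv φ t • deriv c (φ t) :=
    ((hc.differentiable one_ne_zero (φ t)).hasDerivAt.scomp t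
      (hφ.differentiable one_ne_zero t).hasDerivAt).deriv
  simp only [this, nrm_smul, Function.comp, abs_of_nonneg (hpos t), mul_comm]

lemma bddBelow_lengths (M : TorusMetric) (x y : ℝ × ℝ) : BddBelow {L | ∃ c : ℝ → ℝ × ℝ,
    ContDiff ℝ 1 c ∧ c 0 = x ∧ c 1 = y ∧ L = M.length c 0 1} := by
  refine ⟨0, ?_⟩
  rintro L ⟨c, -, -, -, rfl⟩
  exact M.length_nonneg c zero_le_one

lemma dist_le_length' (M : TorusMetric) {c : ℝ → ℝ × ℝ} (hc : ContDiff ℝ 1 c) :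
    M.dist (c 0) (c 1) ≤ M.length c 0 1 :=
  csInf_le (M.bddBelow_lengths _ _) ⟨c, hc, rfl, rfl, rfl⟩

lemma dist_le_length (M : TorusMetric) {c : ℝ → ℝ × ℝ} (hc : ContDiff ℝ 1 c) {a b : ℝ}
    (hab : a ≤ b) : M.dist (c a) (c b) ≤ M.length c a b := by
  have hφ : ContDiff ℝ 1 fun t : ℝ => a + t * (b - a) := by fun_prop
  have hd : ∀ t, deriv (fun t : ℝ => a + t * (b - a)) t = b - a := by intro t; simp
  have h := M.dist_le_length' (hc.comp hφ)
  rw [M.length_comp hc hφ (fun t => by rw [hd]; linarith)] at h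
  simpa using h

lemma exists_length_lt (M : TorusMetric) (x y : ℝ × ℝ) {δ : ℝ} (hδ : 0 < δ) :
    ∃ c : ℝ → ℝ × ℝ, ContDiff ℝ 1 c ∧ c 0 = x ∧ c 1 = y ∧ M.length c 0 1 < M.dist x y + δ := by
  obtain ⟨L, ⟨c, hc, h0, h1, rfl⟩, hL⟩ := exists_lt_of_csInf_lt (s := {L | ∃ c : ℝ → ℝ × ℝ,
    ContDiff ℝ 1 c ∧ c 0 = x ∧ c 1 = y ∧ L = M.length c 0 1})
    ⟨_, fun t => x + t • (y - x), by fun_prop, by simp, by simp, rfl⟩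
    (lt_add_of_pos_right (M.dist x y) hδ)
  exact ⟨c, hc, h0, h1, hL⟩

lemma le_dist (M : TorusMetric) {x y : ℝ × ℝ} {B : ℝ} (h : ∀ c : ℝ → ℝ × ℝ, ContDiff ℝ 1 c →
    c 0 = x → c 1 = y → B ≤ M.length c 0 1) : B ≤ M.dist x y := by
  refine le_of_forall_pos_lt_add fun δ hδ => ?_
  obtain ⟨c, hc, h0, h1, hl⟩ := M.exists_length_lt x y hδ
  exact (h c hc h0 h1).trans_lt hl

lemma dist_nonneg (M : TorusMetric) (x y : ℝ × ℝ) : 0 ≤ M.dist x y :=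
  M.le_dist fun c _ _ _ => M.length_nonneg c zero_le_one

lemma dist_comm_le (M : TorusMetric) (x y : ℝ × ℝ) : M.dist x y ≤ M.dist y x := by
  refine M.le_dist fun c hc h0 h1 => ?_
  have h := M.dist_le_length' (hc.comp (contDiff_const.sub contDiff_id : ContDiff ℝ 1
    fun t : ℝ => (1 : ℝ) - t))
  simp only [Function.comp, sub_zero, sub_self, h0, h1] at h
  refine h.trans (le_of_eq ?_)
  rw [length_eq, length_eq]
  have e := intervalIntegral.integral_comp_sub_left (a := 0) (b := 1)
    (fun t => M.nrm (c t) (deriv c t)) (1 : ℝ)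
  simp only [sub_zero, sub_self] at e
  rw [← e]
  refine intervalIntegral.integral_congr fun t _ => ?_
  have : deriv (c ∘ fun t : ℝ => (1 : ℝ) - t) t = (-1 : ℝ) • deriv c (1 - t) :=
    ((hc.differentiable one_ne_zero (1 - t)).hasDerivAt.scomp t
      ((hasDerivAt_id t).const_sub 1)).deriv
  simp only [Function.comp_def] at this
  simp only [Function.comp_def, this, nrm_smul]
  simp

lemma dist_comm (M : TorusMetric) (x y : ℝ × ℝ) : M.dist x y = M.dist y x :=
  le_antisymm (M.dist_comm_le x y) (M.dist_comm_le y x)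

lemma dist_triangle (M : TorusMetric) (x y z : ℝ × ℝ) : M.dist x z ≤ M.dist x y + M.dist y z := by
  refine le_of_forall_pos_lt_add fun δ hδ => ?_
  obtain ⟨c, hc, c0, c1, hcl⟩ := M.exists_length_lt x y (half_pos hδ)
  obtain ⟨e, he, e0, e1, hel⟩ := M.exists_length_lt y z (half_pos hδ)
  have hψ : ContDiff ℝ 1 Real.smoothTransition := Real.smoothTransition.contDiff (n := 1)
  have hφ : ContDiff ℝ 1 fun t : ℝ => Real.smoothTransition (2 * t) := hψ.comp (by fun_prop)
  have hφ' : ContDiff ℝ 1 fun t : ℝ => Real.smoothTransition (2 * t - 1) := hψ.comp (by fun_prop)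
  have hm : Monotone fun t : ℝ => Real.smoothTransition (2 * t) := fun a b h =>
    Real.smoothTransition.monotone (by linarith)
  have hm' : Monotone fun t : ℝ => Real.smoothTransition (2 * t - 1) := fun a b h =>
    Real.smoothTransition.monotone (by linarith)
  set f : ℝ → ℝ × ℝ := fun t => c (Real.smoothTransition (2 * t)) +
    (e (Real.smoothTransition (2 * t - 1)) - y) with hf
  have hfc : ContDiff ℝ 1 f := (hc.comp hφ).add ((he.comp hφ').sub contDiff_const)
  have l1 : M.length f 0 (1 / 2) = M.length c 0 1 := by
    rw [M.length_congr (c' := c ∘ fun t : ℝ => Real.smoothTransition (2 * t)) (by norm_num),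
      M.length_comp hc hφ (fun t => hm.deriv_nonneg)]
    · norm_num
    · intro t ht
      simp [hf, Real.smoothTransition.zero_of_nonpos (show 2 * t - 1 ≤ 0 by linarith [ht.2]), e0]
  have l2 : M.length f (1 / 2) 1 = M.length e 0 1 := by
    rw [M.length_congr (c' := e ∘ fun t : ℝ => Real.smoothTransition (2 * t - 1)) (by norm_num),
      M.length_comp he hφ' (fun t => hm'.deriv_nonneg)]
    · norm_num
    · intro t ht
      simp [hf, Real.smoothTransition.one_of_one_le (show 1 ≤ 2 * t by linarith [ht.1]), c1]
  have l3 : M.length f 0 1 = M.length c 0 1 + M.length e 0 1 := by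
    rw [← l1, ← l2]
    exact (intervalIntegral.integral_add_adjacent_intervals
      ((M.continuous_speed hfc).intervalIntegrable _ _)
      ((M.continuous_speed hfc).intervalIntegrable _ _)).symm
  have h := M.dist_le_length' hfc
  have f0 : f 0 = x := by
    simp [hf, Real.smoothTransition.zero_of_nonpos (show (-1 : ℝ) ≤ 0 by norm_num), c0, e0]
  have f1 : f 1 = z := by
    simp [hf, Real.smoothTransition.one_of_one_le (show (1 : ℝ) ≤ 2 by norm_num), c1, e1,
      show (2 : ℝ) - 1 = 1 by norm_num]
  rw [f0, f1, l3] at h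
  linarith

lemma length_le_mul (M : TorusMetric) {c : ℝ → ℝ × ℝ} (hc : ContDiff ℝ 1 c) {a b B : ℝ}
    (hab : a ≤ b) (h : ∀ t ∈ Icc a b, M.nrm (c t) (deriv c t) ≤ B) :
    M.length c a b ≤ B * (b - a) := by
  rw [length_eq]
  refine (intervalIntegral.integral_mono_on hab ((M.continuous_speed hc).intervalIntegrable _ _)
    (continuous_const.intervalIntegrable _ _) h).trans (le_of_eq ?_)
  simp [mul_comm]

lemma dist_le_segment (M : TorusMetric) (x y : ℝ × ℝ) :
    M.dist x y ≤ (1 + M.osc * ‖y - x‖) * M.nrm x (y - x) := by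
  have hc : ContDiff ℝ 1 fun t : ℝ => x + t • (y - x) := by fun_prop
  have h := M.dist_le_length' hc
  have hd : ∀ t, deriv (fun t : ℝ => x + t • (y - x)) t = y - x := by
    intro t
    have : HasDerivAt (fun t : ℝ => x + t • (y - x)) ((1 : ℝ) • (y - x)) t :=
      ((hasDerivAt_id t).smul_const (y - x)).const_add x
    simpa using this.deriv
  have h2 := M.length_le_mul hc (B := (1 + M.osc * ‖y - x‖) * M.nrm x (y - x)) zero_le_one (by
    intro t ht
    rw [hd]
    refine (M.nrm_le_osc x _ _).trans ?_
    have := M.osc_pos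
    have := M.nrm_nonneg x (y - x)
    gcongr
    simp only [sub_add_cancel_left, norm_neg, norm_smul]
    have : ‖t‖ ≤ 1 := by rw [Real.norm_eq_abs, abs_of_nonneg ht.1]; exact ht.2
    nlinarith [norm_nonneg (y - x)])
  simpa using h.trans h2

lemma dist_le (M : TorusMetric) (x y : ℝ × ℝ) : M.dist x y ≤ M.hi * ‖x - y‖ := by
  have hc : ContDiff ℝ 1 fun t : ℝ => x + t • (y - x) := by fun_prop
  have h := M.dist_le_length' hc
  have hd : ∀ t, deriv (fun t : ℝ => x + t • (y - x)) t = y - x := by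
    intro t
    have : HasDerivAt (fun t : ℝ => x + t • (y - x)) ((1 : ℝ) • (y - x)) t :=
      ((hasDerivAt_id t).smul_const (y - x)).const_add x
    simpa using this.deriv
  have h2 := M.length_le_mul hc (B := M.hi * ‖x - y‖) zero_le_one (by
    intro t ht
    rw [hd, norm_sub_rev]
    exact M.le_hi _ _)
  simpa using h.trans h2

lemma dist_self (M : TorusMetric) (x : ℝ × ℝ) : M.dist x x = 0 :=
  le_antisymm (by simpa using M.dist_le x x) (M.dist_nonneg x x)

lemma integral_deriv_eq (c : ℝ → ℝ × ℝ) (hc : ContDiff ℝ 1 c) (a b : ℝ) :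
    ∫ t in a..b, deriv c t = c b - c a :=
  intervalIntegral.integral_deriv_eq_sub (fun t _ => hc.differentiable one_ne_zero t)
    ((hc.continuous_deriv le_rfl).intervalIntegrable _ _)

lemma lo_mul_norm_le_length (M : TorusMetric) {c : ℝ → ℝ × ℝ} (hc : ContDiff ℝ 1 c) {a b : ℝ}
    (hab : a ≤ b) : M.lo * ‖c b - c a‖ ≤ M.length c a b := by
  rw [← integral_deriv_eq c hc]
  have h := intervalIntegral.norm_integral_le_integral_norm (f := deriv c) (μ := MeasureTheory.volume)
    hab
  have h2 : M.lo * ∫ t in a..b, ‖deriv c t‖ ≤ M.length c a b := by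
    rw [← intervalIntegral.integral_const_mul, length_eq]
    refine intervalIntegral.integral_mono_on hab ?_
      ((M.continuous_speed hc).intervalIntegrable _ _) (fun t _ => M.lo_le _ _)
    exact (continuous_const.mul (hc.continuous_deriv le_rfl).norm).intervalIntegrable _ _
  exact (mul_le_mul_of_nonneg_left h M.lo_pos.le).trans h2

lemma lo_le_dist (M : TorusMetric) (x y : ℝ × ℝ) : M.lo * ‖x - y‖ ≤ M.dist x y := by
  refine M.le_dist fun c hc h0 h1 => ?_
  rw [norm_sub_rev, ← h0, ← h1]
  exact M.lo_mul_norm_le_length hc zero_le_one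

lemma norm_le_dist (M : TorusMetric) (x y : ℝ × ℝ) : ‖x - y‖ ≤ M.dist x y / M.lo := by
  rw [le_div_iff₀ M.lo_pos, mul_comm]
  exact M.lo_le_dist x y

/-- The norm of an integral is at most the integral of the norm, for a fixed inner product. -/
lemma nrm_sub_le_integral (M : TorusMetric) (x : ℝ × ℝ) {c : ℝ → ℝ × ℝ} (hc : ContDiff ℝ 1 c) :
    M.nrm x (c 1 - c 0) ≤ ∫ t in (0 : ℝ)..1, M.nrm x (deriv c t) := by
  set v := c 1 - c 0 with hv
  have hcd := hc.continuous_deriv le_rfl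
  let T : ℝ × ℝ →ₗ[ℝ] ℝ := IsLinearMap.mk' _ (M.linear x v)
  let L : ℝ × ℝ →L[ℝ] ℝ := LinearMap.toContinuousLinearMap T
  have hL : ∀ w, L w = M.g x w v := fun w => rfl
  have h1 : ∫ t in (0 : ℝ)..1, L (deriv c t) = L v := by
    rw [hv, ← integral_deriv_eq c hc]
    exact L.intervalIntegral_comp_comm (hcd.intervalIntegrable _ _)
  have h2 : L v ≤ (∫ t in (0 : ℝ)..1, M.nrm x (deriv c t)) * M.nrm x v := by
    rw [← h1, ← intervalIntegral.integral_mul_const]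
    have c1 : Continuous fun t => M.nrm x (deriv c t) :=
      M.continuous_nrm.comp (continuous_const.prodMk hcd)
    refine intervalIntegral.integral_mono_on zero_le_one
      ((L.continuous.comp hcd).intervalIntegrable _ _)
      ((c1.mul continuous_const).intervalIntegrable _ _) fun t _ => ?_
    rw [hL]
    exact M.g_le_nrm_mul _ _ _
  rw [hL, ← nrm_sq, sq] at h2
  by_cases h0 : M.nrm x v = 0
  · rw [h0]
    exact intervalIntegral.integral_nonneg zero_le_one fun _ _ => M.nrm_nonneg _ _
  · exact le_of_mul_le_mul_right h2 (lt_of_le_of_ne (M.nrm_nonneg _ _) (Ne.symm h0))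

lemma nrm_le_dist (M : TorusMetric) (x y : ℝ × ℝ) :
    M.nrm x (y - x) ≤ (1 + M.osc * (M.hi / M.lo) * ‖y - x‖) * M.dist x y := by
  have hlo := M.lo_pos
  have hhi := M.hi_pos
  have hosc := M.osc_pos
  set κ := 1 + M.osc * (M.hi / M.lo) * ‖y - x‖ with hκ
  have hκ0 : 1 ≤ κ := by
    have : 0 ≤ M.osc * (M.hi / M.lo) * ‖y - x‖ := by positivity
    linarith
  rw [mul_comm, ← div_le_iff₀ (by linarith)]
  refine M.le_dist fun c hc h0 h1 => ?_
  rw [div_le_iff₀ (by linarith)]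
  by_cases hstay : ∀ t ∈ Icc (0 : ℝ) 1, ‖c t - x‖ ≤ (M.hi / M.lo) * ‖y - x‖
  · have hi := M.nrm_sub_le_integral x hc
    rw [h0, h1] at hi
    refine hi.trans ?_
    rw [length_eq, ← intervalIntegral.integral_mul_const]
    refine intervalIntegral.integral_mono_on zero_le_one
      ((M.continuous_nrm.comp (continuous_const.prodMk
        (hc.continuous_deriv le_rfl))).intervalIntegrable _ _)
      (((M.continuous_speed hc).mul continuous_const).intervalIntegrable _ _) fun t ht => ?_
    refine (M.nrm_le_osc (c t) x _).trans ?_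
    rw [mul_comm (M.nrm _ _), hκ]
    have := M.nrm_nonneg (c t) (deriv c t)
    have := hstay t ht
    rw [mul_assoc M.osc]
    gcongr
  · push Not at hstay
    obtain ⟨t, ht, hlt⟩ := hstay
    have a1 := M.lo_mul_norm_le_length hc ht.1
    have a2 := M.length_nonneg c ht.2
    have a3 : M.length c 0 1 = M.length c 0 t + M.length c t 1 :=
      (intervalIntegral.integral_add_adjacent_intervals
        ((M.continuous_speed hc).intervalIntegrable _ _)
        ((M.continuous_speed hc).intervalIntegrable _ _)).symm
    rw [h0] at a1
    have a4 : M.hi * ‖y - x‖ ≤ M.lo * ‖c t - x‖ := by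
      rw [div_mul_eq_mul_div, div_lt_iff₀ hlo] at hlt
      linarith
    have a5 := M.le_hi x (y - x)
    have a6 := M.length_nonneg c zero_le_one
    nlinarith

lemma dist_translate_le (M : TorusMetric) (x y h : ℝ × ℝ) :
    M.dist (x + h) (y + h) ≤ (1 + M.osc * ‖h‖) * M.dist x y := by
  have hosc := M.osc_pos
  have hp : 0 < 1 + M.osc * ‖h‖ := by positivity
  rw [mul_comm, ← div_le_iff₀ hp]
  refine M.le_dist fun c hc h0 h1 => ?_
  rw [div_le_iff₀ hp]
  have hce : ContDiff ℝ 1 fun t => c t + h := hc.add contDiff_const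
  have := M.dist_le_length' hce
  simp only [h0, h1] at this
  refine this.trans ?_
  rw [length_eq, length_eq, ← intervalIntegral.integral_mul_const]
  refine intervalIntegral.integral_mono_on zero_le_one
    ((M.continuous_speed hce).intervalIntegrable _ _)
    (((M.continuous_speed hc).mul continuous_const).intervalIntegrable _ _) fun t ht => ?_
  rw [deriv_add_const, mul_comm (M.nrm _ _)]
  simpa using M.nrm_le_osc (c t) (c t + h) (deriv c t)

lemma dist_add_lat_le (M : TorusMetric) (x y : ℝ × ℝ) (k : ℤ × ℤ) :
    M.dist (x + lat k) (y + lat k) ≤ M.dist x y := by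
  refine M.le_dist fun c hc h0 h1 => ?_
  have hce : ContDiff ℝ 1 fun t => c t + lat k := hc.add contDiff_const
  have := M.dist_le_length' hce
  simp only [h0, h1] at this
  refine this.trans (le_of_eq ?_)
  simp only [length_eq, deriv_add_const, nrm_periodic]

lemma lat_neg (k : ℤ × ℤ) : lat (-k) = -lat k := by ext <;> simp [lat]

lemma dist_add_lat (M : TorusMetric) (x y : ℝ × ℝ) (k : ℤ × ℤ) :
    M.dist (x + lat k) (y + lat k) = M.dist x y := by
  refine le_antisymm (M.dist_add_lat_le x y k) ?_
  have := M.dist_add_lat_le (x + lat k) (y + lat k) (-k)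
  simpa [lat_neg] using this

lemma exists_lipschitz_path (M : TorusMetric) (x y : ℝ × ℝ) {δ : ℝ} (hδ : 0 < δ) :
    ∃ η : ℝ → ℝ × ℝ, η 0 = x ∧ η 1 = y ∧ ∀ s ∈ Icc (0 : ℝ) 1, ∀ t ∈ Icc (0 : ℝ) 1,
      M.dist (η s) (η t) ≤ (M.dist x y + δ) * |s - t| := by
  obtain ⟨c, hc, c0, c1, hcl⟩ := M.exists_length_lt x y (half_pos hδ)
  set ρ : ℝ → ℝ := fun t => M.length c 0 t + δ / 2 * t with hρ
  have hcont : Continuous ρ :=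
    (intervalIntegral.continuous_primitive
      (fun a b => (M.continuous_speed hc).intervalIntegrable a b) 0).add
      (continuous_const.mul continuous_id)
  have hadd : ∀ s t, M.length c 0 t = M.length c 0 s + M.length c s t := fun s t =>
    (intervalIntegral.integral_add_adjacent_intervals
        ((M.continuous_speed hc).intervalIntegrable _ _)
        ((M.continuous_speed hc).intervalIntegrable _ _)).symm
  have hmono : StrictMono ρ := by
    intro s t hst
    have h1 := hadd s t
    have h2 := M.length_nonneg c hst.le
    simp only [hρ]
    nlinarith
  have hkey : ∀ s t, s ≤ t → M.dist (c s) (c t) ≤ ρ t - ρ s := by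
    intro s t hst
    have h1 := hadd s t
    have h2 := M.dist_le_length hc hst
    simp only [hρ]
    nlinarith
  have hρ0 : ρ 0 = 0 := by simp [hρ, length_eq]
  set Λ := ρ 1 with hΛ
  have hΛle : Λ ≤ M.dist x y + δ := by simp only [hΛ, hρ]; linarith
  have hΛpos : 0 < Λ := by rw [← hρ0]; exact hmono zero_lt_one
  have hsurj : ∀ u : ℝ, ∃ τ : ℝ, u ∈ Icc (0 : ℝ) 1 → ρ τ = u * Λ := by
    intro u
    by_cases hu : u ∈ Icc (0 : ℝ) 1
    · have : u * Λ ∈ Icc (ρ 0) (ρ 1) := by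
        rw [hρ0]
        exact ⟨mul_nonneg hu.1 hΛpos.le, by nlinarith [hu.2]⟩
      obtain ⟨τ, -, h⟩ := intermediate_value_Icc zero_le_one hcont.continuousOn this
      exact ⟨τ, fun _ => h⟩
    · exact ⟨0, fun h => absurd h hu⟩
  choose τ hτ using hsurj
  have key : ∀ s ∈ Icc (0 : ℝ) 1, ∀ t ∈ Icc (0 : ℝ) 1, s ≤ t →
      M.dist (c (τ s)) (c (τ t)) ≤ (M.dist x y + δ) * |s - t| := by
    intro s hs t ht hst
    have hle : τ s ≤ τ t := by
      rw [← hmono.le_iff_le, hτ s hs, hτ t ht]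
      nlinarith
    have h1 := hkey _ _ hle
    rw [hτ s hs, hτ t ht] at h1
    rw [abs_sub_comm, abs_of_nonneg (by linarith)]
    nlinarith
  refine ⟨fun t => c (τ t), ?_, ?_, ?_⟩
  · have : τ 0 = 0 := hmono.injective (by rw [hτ 0 (by simp), hρ0, zero_mul])
    simp [this, c0]
  · have : τ 1 = 1 := hmono.injective (by rw [hτ 1 (by simp), one_mul])
    simp [this, c1]
  · intro s hs t ht
    rcases le_total s t with h | h
    · exact key s hs t ht h
    · rw [M.dist_comm, abs_sub_comm]
      exact key t ht s hs h

end TorusMetric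

open MeasureTheory in
lemma intervalIntegrable_of_bounded {f : ℝ → ℝ} {C a b : ℝ} (hf : Measurable f)
    (h : ∀ t ∈ uIoc a b, |f t| ≤ C) : IntervalIntegrable f volume a b := by
  rw [intervalIntegrable_iff]
  refine Integrable.mono' (g := fun _ => C) ?_ hf.aestronglyMeasurable ?_
  · exact integrableOn_const (by simp [uIoc]) (by simp)
  · rw [ae_restrict_iff' measurableSet_uIoc]
    exact Eventually.of_forall fun t ht => h t ht

open MeasureTheory in
lemma lipschitz_primitive {u : ℝ → ℝ} {K : NNReal} (hu : Measurable u) (hK : ∀ t, |u t| ≤ K)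
    (a : ℝ) : LipschitzWith K fun t => ∫ s in a..t, u s := by
  refine LipschitzWith.of_dist_le_mul fun x y => ?_
  have hi : ∀ p q, IntervalIntegrable u volume p q := fun p q =>
    intervalIntegrable_of_bounded hu fun t _ => hK t
  rw [Real.dist_eq, intervalIntegral.integral_interval_sub_left (hi _ _) (hi _ _), Real.dist_eq]
  exact intervalIntegral.norm_integral_le_of_norm_le_const (C := (K : ℝ)) fun t _ => by
    rw [Real.norm_eq_abs]; exact hK t

open MeasureTheory in
lemma ae_deriv_primitive {u : ℝ → ℝ} {K : ℝ} (hu : Measurable u) (hK : ∀ t, |u t| ≤ K)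
    (a : ℝ) : ∀ᵐ t, HasDerivAt (fun t => ∫ s in a..t, u s) (u t) t := by
  have hl : LocallyIntegrable u volume := by
    refine (locallyIntegrable_const K).mono hu.aestronglyMeasurable ?_
    exact Eventually.of_forall fun t => (hK t).trans (le_abs_self K)
  filter_upwards [LocallyIntegrable.ae_hasDerivAt_integral hl] with t ht using ht a

lemma lipschitz_absCont {f : ℝ → ℝ} {K : NNReal} (hf : LipschitzWith K f) (a b : ℝ) :
    AbsolutelyContinuousOnInterval f a b :=
  (hf.lipschitzOnWith (s := uIcc a b)).absolutelyContinuousOnInterval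

open MeasureTheory in
/-- The lemma of du Bois-Reymond, for bounded measurable functions. -/
lemma du_bois_reymond {A B : ℝ → ℝ} {K : ℝ} {α β : ℝ} (hαβ : α < β) (hA : Measurable A)
    (hB : Measurable B) (hAK : ∀ t, |A t| ≤ K) (hBK : ∀ t, |B t| ≤ K)
    (h : ∀ (C : NNReal) (ψ : ℝ → ℝ), LipschitzWith C ψ → ψ α = 0 → ψ β = 0 →
      ∫ t in α..β, (ψ t * A t + deriv ψ t * B t) = 0) :
    ∃ C : ℝ, ∀ᵐ t, t ∈ Icc α β → B t = C + ∫ s in α..t, A s := by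
  have hK0 : 0 ≤ K := (abs_nonneg _).trans (hAK 0)
  have hKn : ((K.toNNReal : NNReal) : ℝ) = K := Real.coe_toNNReal _ hK0
  set Q : ℝ → ℝ := fun t => ∫ s in α..t, A s with hQ
  have hQl : LipschitzWith K.toNNReal Q := lipschitz_primitive hA (by simpa [hKn] using hAK) α
  have hQb : ∀ t ∈ Icc α β, |Q t| ≤ K * (β - α) := by
    intro t ht
    have := hQl.dist_le_mul t α
    rw [Real.dist_eq, Real.dist_eq, hKn] at this
    simp only [hQ, intervalIntegral.integral_same, sub_zero] at this
    refine this.trans (mul_le_mul_of_nonneg_left ?_ hK0)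
    rw [abs_of_nonneg (by linarith [ht.1])]; linarith [ht.2]
  have hQm : Measurable Q := hQl.continuous.measurable
  have hBi : IntervalIntegrable B volume α β := intervalIntegrable_of_bounded hB fun t _ => hBK t
  have hQi : IntervalIntegrable Q volume α β := hQl.continuous.intervalIntegrable _ _
  set C : ℝ := (∫ t in α..β, (B t - Q t)) / (β - α) with hC
  set u : ℝ → ℝ := indicator (Ioc α β) fun t => B t - Q t - C with hu
  have hum : Measurable u := ((hB.sub hQm).sub_const C).indicator measurableSet_Ioc
  set K' : NNReal := (K + K * (β - α) + |C|).toNNReal with hK'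
  have hK'n : (K' : ℝ) = K + K * (β - α) + |C| := Real.coe_toNNReal _ (by
    have : 0 ≤ K * (β - α) := mul_nonneg hK0 (by linarith)
    positivity)
  have huK : ∀ t, |u t| ≤ K' := by
    intro t
    by_cases ht : t ∈ Ioc α β
    · rw [hu, indicator_of_mem ht, hK'n]
      refine (abs_sub _ _).trans (add_le_add ((abs_sub _ _).trans (add_le_add (hBK t) ?_)) le_rfl)
      exact hQb t (Ioc_subset_Icc_self ht)
    · rw [hu, indicator_of_notMem ht]; simp
  have hui : ∀ p q, IntervalIntegrable u volume p q := fun p q =>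
    intervalIntegrable_of_bounded hum fun t _ => huK t
  set ψ : ℝ → ℝ := fun t => ∫ s in α..t, u s with hψ
  have hψl : LipschitzWith K' ψ := lipschitz_primitive hum huK α
  have hψα : ψ α = 0 := by simp [hψ]
  have hu_int : ∀ F : ℝ → ℝ → ℝ, ∫ t in α..β, F (u t) t = ∫ t in α..β, F (B t - Q t - C) t := by
    intro F
    refine intervalIntegral.integral_congr_ae (Eventually.of_forall fun t ht => ?_)
    rw [uIoc_of_le hαβ.le] at ht
    simp only [hu, indicator_of_mem ht]
  have hψβ : ψ β = 0 := by
    simp only [hψ]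
    rw [hu_int fun x _ => x, intervalIntegral.integral_sub (hBi.sub hQi) (by simp),
      intervalIntegral.integral_const, hC, smul_eq_mul, mul_div_cancel₀ _ (by linarith)]
    simp
  have hd := ae_deriv_primitive hum huK α
  have hAQ := ae_deriv_primitive hA hAK α
  have key := h K' ψ hψl hψα hψβ
  have hip := (lipschitz_absCont hψl α β).integral_mul_deriv_eq_deriv_mul
    (lipschitz_absCont hQl α β)
  rw [hψα, hψβ, zero_mul, zero_mul, sub_zero, zero_sub] at hip
  have e1 : ∫ t in α..β, ψ t * deriv Q t = ∫ t in α..β, ψ t * A t := by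
    refine intervalIntegral.integral_congr_ae ?_
    filter_upwards [hAQ] with t ht _
    rw [ht.deriv]
  have e2 : ∫ t in α..β, deriv ψ t * Q t = ∫ t in α..β, u t * Q t := by
    refine intervalIntegral.integral_congr_ae ?_
    filter_upwards [hd] with t ht _
    rw [ht.deriv]
  have e3 : ∫ t in α..β, (ψ t * A t + deriv ψ t * B t) =
      ∫ t in α..β, (ψ t * A t + u t * B t) := by
    refine intervalIntegral.integral_congr_ae ?_
    filter_upwards [hd] with t ht _
    rw [ht.deriv]
  rw [e1, e2] at hip
  have hψA : IntervalIntegrable (fun t => ψ t * A t) volume α β :=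
    (intervalIntegrable_of_bounded hA fun t _ => hAK t).continuousOn_mul hψl.continuous.continuousOn
  have huB : IntervalIntegrable (fun t => u t * B t) volume α β :=
    intervalIntegrable_of_bounded (C := K' * K) (hum.mul hB) fun t _ => by
      rw [abs_mul]; exact mul_le_mul (huK t) (hBK t) (abs_nonneg _) (by positivity)
  have huQ : IntervalIntegrable (fun t => u t * Q t) volume α β :=
    (hui _ _).mul_continuousOn hQl.continuous.continuousOn
  rw [e3, intervalIntegral.integral_add hψA huB, hip] at key
  have hsq : ∫ t in α..β, u t * u t = 0 := by
    have : ∫ t in α..β, u t * u t = ∫ t in α..β, (u t * B t - u t * Q t - u t * C) := by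
      rw [hu_int fun x _ => x * x, hu_int fun x t => x * B t - x * Q t - x * C]
      congr 1; funext t; ring
    rw [this, intervalIntegral.integral_sub (huB.sub huQ) ((hui _ _).mul_const C),
      intervalIntegral.integral_sub huB huQ, intervalIntegral.integral_mul_const]
    have : ∫ t in α..β, u t = 0 := hψβ
    rw [this]; linarith
  refine ⟨C, ?_⟩
  rw [intervalIntegral.integral_of_le hαβ.le, integral_eq_zero_iff_of_nonneg
    (fun t => mul_self_nonneg _), Filter.EventuallyEq, ae_restrict_iff' measurableSet_Ioc] at hsq
  · have hne : ∀ᵐ t : ℝ, t ≠ α := by simp [ae_iff]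
    filter_upwards [hsq, hne] with t ht htα htm
    have hm : t ∈ Ioc α β := ⟨lt_of_le_of_ne htm.1 (Ne.symm htα), htm.2⟩
    have := mul_self_eq_zero.1 (ht hm)
    rw [hu, indicator_of_mem hm] at this
    linarith
  · have := (intervalIntegrable_of_bounded (C := K' * K') (hum.mul hum) (a := α) (b := β)
      fun t _ => by
        rw [Pi.mul_apply, abs_mul]; exact mul_le_mul (huK t) (huK t) (abs_nonneg _) (by positivity))
    exact (intervalIntegrable_iff_integrableOn_Ioc_of_le hαβ.le).1 this

namespace TorusMetric

lemma abs_dist_sub_le (M : TorusMetric) (x y z : ℝ × ℝ) :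
    |M.dist x y - M.dist x z| ≤ M.dist y z := by
  rw [abs_le]
  constructor
  · have := M.dist_triangle x y z; linarith
  · have := M.dist_triangle x z y; rw [M.dist_comm z y] at this; linarith

/-- Infinitesimally, `M.dist` is given by the norm of the metric. -/
lemma tendsto_dist_div (M : TorusMetric) {η : ℝ → ℝ × ℝ} {v : ℝ × ℝ} {t : ℝ}
    (h : HasDerivAt η v t) :
    Tendsto (fun s => M.dist (η t) (η s) / |s - t|) (𝓝[≠] t) (𝓝 (M.nrm (η t) v)) := by
  have hs : Tendsto (fun s => M.nrm (η t) ((s - t)⁻¹ • (η s - η t))) (𝓝[≠] t)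
      (𝓝 (M.nrm (η t) v)) := by
    have h1 := hasDerivAt_iff_tendsto_slope.1 h
    have h2 : Continuous fun w => M.nrm (η t) w :=
      M.continuous_nrm.comp (continuous_const.prodMk continuous_id)
    exact (h2.tendsto v).comp h1
  have hz : Tendsto (fun s => ‖η s - η t‖) (𝓝[≠] t) (𝓝 0) := by
    have h0 : ContinuousAt (fun s => ‖η s - η t‖) t := (h.continuousAt.sub continuousAt_const).norm
    have := h0.tendsto.mono_left (nhdsWithin_le_nhds (s := {t}ᶜ))
    simpa using this
  have hq : ∀ s ≠ t, M.nrm (η t) ((s - t)⁻¹ • (η s - η t)) =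
      M.nrm (η t) (η s - η t) / |s - t| := by
    intro s _
    rw [nrm_smul, abs_inv, div_eq_inv_mul]
  have up : Tendsto (fun s => (1 + M.osc * ‖η s - η t‖) *
      M.nrm (η t) ((s - t)⁻¹ • (η s - η t))) (𝓝[≠] t) (𝓝 (M.nrm (η t) v)) := by
    have := ((hz.const_mul M.osc).const_add 1).mul hs
    simpa using this
  have down : Tendsto (fun s => (1 + M.osc * (M.hi / M.lo) * ‖η s - η t‖)⁻¹ *
      M.nrm (η t) ((s - t)⁻¹ • (η s - η t))) (𝓝[≠] t) (𝓝 (M.nrm (η t) v)) := by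
    have := (((hz.const_mul (M.osc * (M.hi / M.lo))).const_add 1).inv₀ (by simp)).mul hs
    simpa using this
  refine tendsto_of_tendsto_of_tendsto_of_le_of_le' down up ?_ ?_
  · filter_upwards [self_mem_nhdsWithin] with s hs
    have hst : 0 < |s - t| := abs_pos.2 (sub_ne_zero.2 hs)
    have hp : 0 < 1 + M.osc * (M.hi / M.lo) * ‖η s - η t‖ := by
      have := M.osc_pos; have := M.lo_pos; have := M.hi_pos; positivity
    rw [hq s hs, inv_mul_le_iff₀ hp, ← mul_div_assoc]
    exact div_le_div_of_nonneg_right (M.nrm_le_dist _ _) hst.le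
  · filter_upwards [self_mem_nhdsWithin] with s hs
    have hst : 0 < |s - t| := abs_pos.2 (sub_ne_zero.2 hs)
    rw [hq s hs, ← mul_div_assoc]
    exact div_le_div_of_nonneg_right (M.dist_le_segment _ _) hst.le

lemma measurable_nrm_deriv (M : TorusMetric) {η : ℝ → ℝ × ℝ} (hη : Continuous η) :
    Measurable fun t => M.nrm (η t) (deriv η t) :=
  M.continuous_nrm.measurable.comp (hη.measurable.prodMk (measurable_deriv η))

/-- The distance between the ends of a Lipschitz curve is at most its length. -/
lemma dist_le_integral_of_lipschitz (M : TorusMetric) {η : ℝ → ℝ × ℝ} {K : NNReal}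
    (hη : LipschitzWith K η) {α β : ℝ} (h : α ≤ β) :
    M.dist (η α) (η β) ≤ ∫ t in α..β, M.nrm (η t) (deriv η t) := by
  set F : ℝ → ℝ := fun t => M.dist (η α) (η t) with hF
  have hFl : LipschitzWith (M.hi.toNNReal * K) F := by
    refine LipschitzWith.of_dist_le_mul fun x y => ?_
    rw [Real.dist_eq]
    refine (M.abs_dist_sub_le _ _ _).trans ((M.dist_le _ _).trans ?_)
    rw [NNReal.coe_mul, Real.coe_toNNReal _ M.hi_pos.le, mul_assoc]
    exact mul_le_mul_of_nonneg_left (by rw [← dist_eq_norm]; exact hη.dist_le_mul _ _) M.hi_pos.le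
  have e := (lipschitz_absCont hFl α β).integral_deriv_eq_sub
  have e0 : F α = 0 := M.dist_self _
  rw [e0, sub_zero] at e
  change F β ≤ _
  rw [← e]
  have hb : ∀ t, |M.nrm (η t) (deriv η t)| ≤ M.hi * K := fun t => by
    rw [abs_of_nonneg (M.nrm_nonneg _ _)]
    exact (M.le_hi _ _).trans (mul_le_mul_of_nonneg_left (norm_deriv_le_of_lipschitz hη) M.hi_pos.le)
  refine intervalIntegral.integral_mono_ae h
    (lipschitz_absCont hFl α β).intervalIntegrable_deriv
    (intervalIntegrable_of_bounded (M.measurable_nrm_deriv hη.continuous) fun t _ => hb t) ?_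
  filter_upwards [hFl.ae_differentiableAt_real, hη.ae_differentiableAt_real] with t h1 h2
  have l1 := M.tendsto_dist_div h2.hasDerivAt
  have l2 := (hasDerivAt_iff_tendsto_slope.1 h1.hasDerivAt)
  refine le_of_tendsto_of_tendsto l2 l1 ?_
  filter_upwards [self_mem_nhdsWithin] with s hs
  have hst : 0 < |s - t| := abs_pos.2 (sub_ne_zero.2 hs)
  rw [slope_def_field]
  refine (le_abs_self _).trans ?_
  rw [abs_div]
  refine div_le_div_of_nonneg_right ?_ hst.le
  rw [M.dist_comm (η t)]
  exact M.abs_dist_sub_le _ _ _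

end TorusMetric

namespace TorusMetric

/-- The kinetic Lagrangian of the metric (without the factor `1/2`). -/
def lag (M : TorusMetric) (p : (ℝ × ℝ) × (ℝ × ℝ)) : ℝ := M.g p.1 p.2 p.2

lemma contDiff_lag (M : TorusMetric) : ContDiff ℝ (⊤ : ℕ∞) M.lag :=
  M.smooth.comp (contDiff_fst.prodMk (contDiff_snd.prodMk contDiff_snd))

lemma fderiv_lag_vert (M : TorusMetric) (x v w : ℝ × ℝ) :
    fderiv ℝ M.lag (x, v) (0, w) = 2 * M.g x v w := by
  have h1 : HasDerivAt (fun h : ℝ => (x, v) + h • ((0 : ℝ × ℝ), w)) ((0 : ℝ × ℝ), w) 0 := by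
    simpa using ((hasDerivAt_id (0 : ℝ)).smul_const ((0 : ℝ × ℝ), w)).const_add (x, v)
  have h2 : HasFDerivAt M.lag (fderiv ℝ M.lag (x, v)) ((x, v) + (0 : ℝ) • ((0 : ℝ × ℝ), w)) := by
    simpa using (M.contDiff_lag.differentiable (by simp) (x, v)).hasFDerivAt
  have h3 := h2.comp_hasDerivAt 0 h1
  have h4 : (M.lag ∘ fun h : ℝ => (x, v) + h • ((0 : ℝ × ℝ), w)) =
      fun h => M.g x v v + 2 * M.g x v w * h + M.g x w w * h ^ 2 := by
    funext h
    simp only [lag, Function.comp, Prod.smul_mk, Prod.mk_add_mk, smul_zero, add_zero]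
    rw [g_add_left, g_add_right, g_add_right, g_smul_left, g_smul_right, g_smul_left, g_smul_right,
      M.symm x w v]
    ring
  rw [h4] at h3
  have h5 : HasDerivAt (fun h : ℝ => M.g x v v + 2 * M.g x v w * h + M.g x w w * h ^ 2)
      (2 * M.g x v w) 0 := by
    have := (((hasDerivAt_id (0 : ℝ)).const_mul (2 * M.g x v w)).const_add (M.g x v v)).add
      (((hasDerivAt_id (0 : ℝ)).pow 2).const_mul (M.g x w w))
    exact this.congr_deriv (by simp)
  exact h3.unique h5

/-- The covector dual to a tangent vector. -/
def flat (M : TorusMetric) (x v : ℝ × ℝ) : ℝ × ℝ := (M.g x v (1, 0), M.g x v (0, 1))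

/-- The tangent vector dual to a covector. -/
def sharp (M : TorusMetric) (x p : ℝ × ℝ) : ℝ × ℝ :=
  ((M.cd x * p.1 - M.cb x * p.2) / (M.ca x * M.cd x - M.cb x ^ 2),
    (M.ca x * p.2 - M.cb x * p.1) / (M.ca x * M.cd x - M.cb x ^ 2))

lemma sharp_flat (M : TorusMetric) (x v : ℝ × ℝ) : M.sharp x (M.flat x v) = v := by
  have h := (M.det_pos x).ne'
  ext <;> simp only [sharp, flat, g_eq] <;> rw [div_eq_iff h] <;> ring

lemma flat_sharp (M : TorusMetric) (x p : ℝ × ℝ) : M.flat x (M.sharp x p) = p := by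
  have h := (M.det_pos x).ne'
  have hr : ∀ a b e f : ℝ, a / (M.ca x * M.cd x - M.cb x ^ 2) * e +
      b / (M.ca x * M.cd x - M.cb x ^ 2) * f = (a * e + b * f) / (M.ca x * M.cd x - M.cb x ^ 2) := by
    intros; ring
  ext <;> simp only [sharp, flat, g_eq, mul_one, mul_zero, zero_mul, add_zero, zero_add] <;>
    rw [hr, div_eq_iff h] <;> ring

/-- The horizontal derivative of the kinetic Lagrangian. -/
def force (M : TorusMetric) (x v : ℝ × ℝ) : ℝ × ℝ :=
  (2⁻¹ * fderiv ℝ M.lag (x, v) ((1, 0), 0), 2⁻¹ * fderiv ℝ M.lag (x, v) ((0, 1), 0))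

/-- The Hamiltonian vector field of the geodesic flow on `T*ℝ²`. -/
def hamX (M : TorusMetric) (z : (ℝ × ℝ) × (ℝ × ℝ)) : (ℝ × ℝ) × (ℝ × ℝ) :=
  (M.sharp z.1 z.2, M.force z.1 (M.sharp z.1 z.2))

lemma contDiff_sharp (M : TorusMetric) :
    ContDiff ℝ (⊤ : ℕ∞) fun z : (ℝ × ℝ) × (ℝ × ℝ) => M.sharp z.1 z.2 := by
  have ha : ContDiff ℝ (⊤ : ℕ∞) fun z : (ℝ × ℝ) × (ℝ × ℝ) => M.ca z.1 := M.contDiff_ca.comp contDiff_fst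
  have hb : ContDiff ℝ (⊤ : ℕ∞) fun z : (ℝ × ℝ) × (ℝ × ℝ) => M.cb z.1 := M.contDiff_cb.comp contDiff_fst
  have hd : ContDiff ℝ (⊤ : ℕ∞) fun z : (ℝ × ℝ) × (ℝ × ℝ) => M.cd z.1 := M.contDiff_cd.comp contDiff_fst
  have h1 : ContDiff ℝ (⊤ : ℕ∞) fun z : (ℝ × ℝ) × (ℝ × ℝ) => z.2.1 := contDiff_fst.comp contDiff_snd
  have h2 : ContDiff ℝ (⊤ : ℕ∞) fun z : (ℝ × ℝ) × (ℝ × ℝ) => z.2.2 := contDiff_snd.comp contDiff_snd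
  have hdet := (ha.mul hd).sub (hb.pow 2)
  have hne : ∀ z : (ℝ × ℝ) × (ℝ × ℝ), M.ca z.1 * M.cd z.1 - M.cb z.1 ^ 2 ≠ 0 :=
    fun z => (M.det_pos z.1).ne'
  exact (((hd.mul h1).sub (hb.mul h2)).div hdet hne).prodMk
    (((ha.mul h2).sub (hb.mul h1)).div hdet hne)

lemma contDiff_force (M : TorusMetric) :
    ContDiff ℝ (⊤ : ℕ∞) fun z : (ℝ × ℝ) × (ℝ × ℝ) => M.force z.1 z.2 := by
  have h : ContDiff ℝ (⊤ : ℕ∞) (fderiv ℝ M.lag) := M.contDiff_lag.fderiv_right (by simp)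
  exact (contDiff_const.mul (h.clm_apply contDiff_const)).prodMk
    (contDiff_const.mul (h.clm_apply contDiff_const))

lemma contDiff_hamX (M : TorusMetric) : ContDiff ℝ (⊤ : ℕ∞) M.hamX :=
  M.contDiff_sharp.prodMk (M.contDiff_force.comp (contDiff_fst.prodMk M.contDiff_sharp))

lemma unit_speed_of_isometric (M : TorusMetric) {γ : ℝ → ℝ × ℝ} {α β : ℝ}
    (h : ∀ s ∈ Icc α β, ∀ t ∈ Icc α β, s ≤ t → M.dist (γ s) (γ t) = t - s) {t : ℝ}
    (ht : t ∈ Ioo α β) (hd : DifferentiableAt ℝ γ t) : M.nrm (γ t) (deriv γ t) = 1 := by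
  refine tendsto_nhds_unique (M.tendsto_dist_div hd.hasDerivAt) ?_
  refine tendsto_const_nhds.congr' ?_
  filter_upwards [self_mem_nhdsWithin, mem_nhdsWithin_of_mem_nhds (Icc_mem_nhds ht.1 ht.2)] with s hs hs'
  have hst : 0 < |s - t| := abs_pos.2 (sub_ne_zero.2 hs)
  have e : M.dist (γ t) (γ s) = |s - t| := by
    rcases le_total t s with hle | hle
    · rw [h t (Ioo_subset_Icc_self ht) s hs' hle, abs_of_nonneg (by linarith)]
    · rw [M.dist_comm, h s hs' t (Ioo_subset_Icc_self ht) hle, abs_of_nonpos (by linarith)]; ring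
  rw [e, div_self hst.ne']

open MeasureTheory in
/-- The first variation formula for locally isometric curves. -/
lemma first_variation (M : TorusMetric) {γ : ℝ → ℝ × ℝ} {K : NNReal} (hγ : LipschitzWith K γ)
    {α β : ℝ} (hαβ : α < β)
    (h : ∀ s ∈ Icc α β, ∀ t ∈ Icc α β, s ≤ t → M.dist (γ s) (γ t) = t - s) (e : ℝ × ℝ)
    (C : NNReal) (ψ : ℝ → ℝ) (hψ : LipschitzWith C ψ) (hψα : ψ α = 0) (hψβ : ψ β = 0) :
    ∫ t in α..β, (ψ t * fderiv ℝ M.lag (γ t, deriv γ t) (e, 0) +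
      deriv ψ t * fderiv ℝ M.lag (γ t, deriv γ t) (0, e)) = 0 := by
  have hαI : α ∈ Icc α β := left_mem_Icc.2 hαβ.le
  have hβI : β ∈ Icc α β := right_mem_Icc.2 hαβ.le
  set P : ℝ → ℝ → (ℝ × ℝ) × (ℝ × ℝ) := fun h t =>
    (γ t, deriv γ t) + h • (ψ t • e, deriv ψ t • e) with hP
  -- a bounded region containing all the phase points
  have hcont : ContinuousOn γ (Icc α β) := hγ.continuous.continuousOn
  obtain ⟨R₁, hR₁⟩ := isCompact_Icc.exists_bound_of_continuousOn hcont
  obtain ⟨R₂, hR₂⟩ := isCompact_Icc.exists_bound_of_continuousOn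
    (hψ.continuous.continuousOn (s := Icc α β))
  set R : ℝ := max (R₁ + R₂ * ‖e‖) (K + C * ‖e‖) with hR
  have hPR : ∀ h ∈ Metric.ball (0 : ℝ) 1, ∀ t ∈ Icc α β, P h t ∈ Metric.closedBall 0 R := by
    intro h hh t ht
    have hh' : |h| ≤ 1 := by simpa [Real.dist_eq] using (Metric.mem_ball.1 hh).le
    rw [mem_closedBall_zero_iff, hP]
    simp only [Prod.smul_mk, Prod.mk_add_mk, Prod.norm_mk]
    refine max_le_max ?_ ?_
    · refine (norm_add_le _ _).trans (add_le_add (hR₁ t ht) ?_)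
      rw [norm_smul, norm_smul, Real.norm_eq_abs]
      refine (mul_le_of_le_one_left (by positivity) hh').trans ?_
      exact mul_le_mul_of_nonneg_right (hR₂ t ht) (norm_nonneg _)
    · refine (norm_add_le _ _).trans (add_le_add (norm_deriv_le_of_lipschitz hγ) ?_)
      rw [norm_smul, norm_smul, Real.norm_eq_abs]
      refine (mul_le_of_le_one_left (by positivity) hh').trans ?_
      exact mul_le_mul_of_nonneg_right (norm_deriv_le_of_lipschitz hψ) (norm_nonneg _)
  have hfc : Continuous (fderiv ℝ M.lag) := M.contDiff_lag.continuous_fderiv (by simp)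
  obtain ⟨D, hD⟩ := (isCompact_closedBall (0 : (ℝ × ℝ) × (ℝ × ℝ)) R).exists_bound_of_continuousOn
    hfc.continuousOn
  obtain ⟨D₀, hD₀⟩ := (isCompact_closedBall (0 : (ℝ × ℝ) × (ℝ × ℝ)) R).exists_bound_of_continuousOn
    M.contDiff_lag.continuous.continuousOn
  have hwm : Measurable fun t => (ψ t • e, deriv ψ t • e) :=
    (hψ.continuous.measurable.smul_const e).prodMk ((measurable_deriv ψ).smul_const e)
  have hPm : ∀ h, Measurable (P h) := fun h =>
    (hγ.continuous.measurable.prodMk (measurable_deriv γ)).add (hwm.const_smul h)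
  have hwb : ∀ t ∈ Icc α β, ‖(ψ t • e, deriv ψ t • e)‖ ≤ max (R₂ * ‖e‖) (C * ‖e‖) := by
    intro t ht
    rw [Prod.norm_mk, norm_smul, norm_smul]
    exact max_le_max (mul_le_mul_of_nonneg_right (hR₂ t ht) (norm_nonneg _))
      (mul_le_mul_of_nonneg_right (norm_deriv_le_of_lipschitz hψ) (norm_nonneg _))
  have hlm : ∀ h, Measurable fun t => M.lag (P h t) := fun h =>
    M.contDiff_lag.continuous.measurable.comp (hPm h)
  have hIcc : ∀ t, t ∈ uIoc α β → t ∈ Icc α β := fun t ht => by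
    rw [uIoc_of_le hαβ.le] at ht; exact Ioc_subset_Icc_self ht
  have hlint : ∀ h ∈ Metric.ball (0 : ℝ) 1,
      IntervalIntegrable (fun t => M.lag (P h t)) volume α β := fun h hh =>
    intervalIntegrable_of_bounded (hlm h) fun t ht => hD₀ _ (hPR h hh t (hIcc t ht))
  have h0 : (0 : ℝ) ∈ Metric.ball (0 : ℝ) 1 := by simp
  have hder := intervalIntegral.hasDerivAt_integral_of_dominated_loc_of_deriv_le
    (μ := volume) (a := α) (b := β) (F := fun h t => M.lag (P h t))
    (F' := fun h t => fderiv ℝ M.lag (P h t) (ψ t • e, deriv ψ t • e))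
    (bound := fun _ => D * max (R₂ * ‖e‖) (C * ‖e‖)) (x₀ := 0)
    (Metric.ball_mem_nhds (0 : ℝ) one_pos)
    (Eventually.of_forall fun h => (hlm h).aestronglyMeasurable) (hlint 0 h0)
    (by
      have hm : Measurable fun t =>
          ((fderiv ℝ M.lag (P 0 t)) (ψ t • e, deriv ψ t • e) : ℝ) := by
        have hc : Continuous fun q : (((ℝ × ℝ) × (ℝ × ℝ)) × ((ℝ × ℝ) × (ℝ × ℝ))) =>
            fderiv ℝ M.lag q.1 q.2 := (hfc.comp continuous_fst).clm_apply continuous_snd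
        exact hc.measurable.comp ((hPm 0).prodMk hwm)
      exact hm.aestronglyMeasurable)
    (Eventually.of_forall fun t ht h hh => by
      refine (ContinuousLinearMap.le_opNorm _ _).trans ?_
      exact mul_le_mul (hD _ (hPR h hh t (hIcc t ht))) (hwb t (hIcc t ht)) (norm_nonneg _)
        ((norm_nonneg _).trans (hD _ (hPR h hh t (hIcc t ht)))))
    (by simp)
    (Eventually.of_forall fun t ht h hh => by
      have h1 : HasDerivAt (fun h => P h t) (ψ t • e, deriv ψ t • e) h := by
        exact (((hasDerivAt_id h).smul_const (ψ t • e, deriv ψ t • e)).const_add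
          (γ t, deriv γ t)).congr_deriv (one_smul _ _)
      exact (M.contDiff_lag.differentiable (by simp) (P h t)).hasFDerivAt.comp_hasDerivAt h h1)
  have hmin : IsLocalMin (fun h => ∫ t in α..β, M.lag (P h t)) 0 := by
    have hzero : ∫ t in α..β, M.lag (P 0 t) = β - α := by
      have : ∫ t in α..β, M.lag (P 0 t) = ∫ t in α..β, (1 : ℝ) := by
        refine intervalIntegral.integral_congr_ae ?_
        have hne : ∀ᵐ t : ℝ, t ≠ β := by simp [ae_iff]
        filter_upwards [hγ.ae_differentiableAt_real, hne] with t ht htβ htm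
        rw [uIoc_of_le hαβ.le] at htm
        have := M.unit_speed_of_isometric h ⟨htm.1, lt_of_le_of_ne htm.2 htβ⟩ ht
        simp only [hP, zero_smul, add_zero, lag]
        rw [← nrm_sq, this, one_pow]
      rw [this]; simp
    filter_upwards [Metric.ball_mem_nhds (0 : ℝ) one_pos] with h' hh
    rw [hzero]
    set η : ℝ → ℝ × ℝ := fun t => γ t + (h' * ψ t) • e with hη
    have hηl : LipschitzWith (K + (‖h'‖₊ * C) * ‖e‖₊) η := by
      refine hγ.add (LipschitzWith.of_dist_le_mul fun x y => ?_)
      rw [dist_eq_norm, ← sub_smul, ← mul_sub, norm_smul, norm_mul, NNReal.coe_mul, NNReal.coe_mul,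
        coe_nnnorm, coe_nnnorm]
      have := hψ.dist_le_mul x y
      rw [dist_eq_norm] at this
      calc ‖h'‖ * ‖ψ x - ψ y‖ * ‖e‖ ≤ ‖h'‖ * (C * Dist.dist x y) * ‖e‖ := by gcongr
        _ = _ := by ring
    have hηα : η α = γ α := by simp [hη, hψα]
    have hηβ : η β = γ β := by simp [hη, hψβ]
    have hd := M.dist_le_integral_of_lipschitz hηl hαβ.le
    rw [hηα, hηβ, h α hαI β hβI hαβ.le] at hd
    have hle : ∫ t in α..β, M.nrm (η t) (deriv η t) ≤ ∫ t in α..β, (1 + M.lag (P h' t)) / 2 := by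
      refine intervalIntegral.integral_mono_ae hαβ.le
        (intervalIntegrable_of_bounded (C := M.hi * (K + (‖h'‖₊ * C) * ‖e‖₊ : NNReal))
          (M.measurable_nrm_deriv hηl.continuous) fun t _ => ?_)
        (((IntervalIntegrable.add (by simp) (hlint h' hh))).div_const 2) ?_
      · rw [abs_of_nonneg (M.nrm_nonneg _ _)]
        exact (M.le_hi _ _).trans
          (mul_le_mul_of_nonneg_left (norm_deriv_le_of_lipschitz hηl) M.hi_pos.le)
      · filter_upwards [hγ.ae_differentiableAt_real, hψ.ae_differentiableAt_real] with t h1 h2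
        have hde : deriv η t = deriv γ t + (h' * deriv ψ t) • e :=
          (h1.hasDerivAt.add ((h2.hasDerivAt.const_mul h').smul_const e)).deriv
        have : M.lag (P h' t) = M.nrm (η t) (deriv η t) ^ 2 := by
          rw [nrm_sq, hde]
          simp only [hP, lag, Prod.smul_mk, Prod.mk_add_mk, smul_smul, hη]
        rw [this]
        nlinarith [sq_nonneg (M.nrm (η t) (deriv η t) - 1)]
    have hIn : ∫ t in α..β, (1 + M.lag (P h' t)) / 2 =
        ((β - α) + ∫ t in α..β, M.lag (P h' t)) / 2 := by
      rw [intervalIntegral.integral_div, intervalIntegral.integral_add (by simp) (hlint h' hh)]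
      simp
    linarith
  have hfin := hmin.hasDerivAt_eq_zero hder.2
  rw [← hfin]
  refine intervalIntegral.integral_congr fun t _ => ?_
  have : ((ψ t • e, deriv ψ t • e) : (ℝ × ℝ) × (ℝ × ℝ)) =
      ψ t • (e, 0) + deriv ψ t • (0, e) := by simp
  simp only [this, map_add, map_smul, smul_eq_mul, hP, zero_smul, add_zero]

open MeasureTheory in
/-- A curve which locally realizes the distance solves the Hamilton equations. -/
lemma hamilton_of_isometric (M : TorusMetric) {γ : ℝ → ℝ × ℝ} {K : NNReal}
    (hγ : LipschitzWith K γ) {α β : ℝ} (hαβ : α < β)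
    (h : ∀ s ∈ Icc α β, ∀ t ∈ Icc α β, s ≤ t → M.dist (γ s) (γ t) = t - s) {t : ℝ}
    (ht : t ∈ Ioo α β) :
    HasDerivAt (fun s => (γ s, M.flat (γ s) (deriv γ s)))
      (M.hamX (γ t, M.flat (γ t) (deriv γ t))) t := by
  have hfc : Continuous (fderiv ℝ M.lag) := M.contDiff_lag.continuous_fderiv (by simp)
  have hcont : ContinuousOn γ (Icc α β) := hγ.continuous.continuousOn
  obtain ⟨R₁, hR₁⟩ := isCompact_Icc.exists_bound_of_continuousOn hcont
  -- the phase curve, cut off outside the interval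
  set z : ℝ → (ℝ × ℝ) × (ℝ × ℝ) := fun t => (γ t, deriv γ t) with hz
  have hzm : Measurable z := hγ.continuous.measurable.prodMk (measurable_deriv γ)
  have hzR : ∀ t ∈ Icc α β, z t ∈ Metric.closedBall 0 (max R₁ K) := fun t ht => by
    rw [mem_closedBall_zero_iff]
    exact max_le_max (hR₁ t ht) (norm_deriv_le_of_lipschitz hγ)
  obtain ⟨D, hD⟩ := (isCompact_closedBall (0 : (ℝ × ℝ) × (ℝ × ℝ)) _).exists_bound_of_continuousOn
    hfc.continuousOn (s := Metric.closedBall 0 (max R₁ K))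
  have key : ∀ e : ℝ × ℝ, ∃ C : ℝ, ∀ᵐ t, t ∈ Icc α β →
      2 * M.g (γ t) (deriv γ t) e = C + ∫ s in α..t, fderiv ℝ M.lag (z s) (e, 0) := by
    intro e
    set A : ℝ → ℝ := indicator (Icc α β) fun t => fderiv ℝ M.lag (z t) (e, 0) with hA
    set B : ℝ → ℝ := indicator (Icc α β) fun t => fderiv ℝ M.lag (z t) (0, e) with hB
    have hev : ∀ w : (ℝ × ℝ) × (ℝ × ℝ), Measurable fun t => fderiv ℝ M.lag (z t) w := fun w =>
      (hfc.clm_apply continuous_const).measurable.comp hzm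
    have hbd : ∀ w : (ℝ × ℝ) × (ℝ × ℝ), ‖w‖ ≤ ‖e‖ → ∀ t,
        |indicator (Icc α β) (fun t => fderiv ℝ M.lag (z t) w) t| ≤ max D 0 * ‖e‖ := by
      intro w hw t
      by_cases ht : t ∈ Icc α β
      · rw [indicator_of_mem ht]
        refine ((fderiv ℝ M.lag (z t)).le_opNorm w).trans ?_
        exact mul_le_mul ((hD _ (hzR t ht)).trans (le_max_left _ _)) hw (norm_nonneg _)
          (le_max_right _ _)
      · rw [indicator_of_notMem ht, abs_zero]; positivity
    obtain ⟨C, hC⟩ := du_bois_reymond (A := A) (B := B) hαβ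
      ((hev _).indicator measurableSet_Icc) ((hev _).indicator measurableSet_Icc)
      (hbd _ (by simp)) (hbd _ (by simp)) (fun C ψ hψ h0 h1 => by
        rw [← M.first_variation hγ hαβ h e C ψ hψ h0 h1]
        refine intervalIntegral.integral_congr fun t ht => ?_
        rw [uIcc_of_le hαβ.le] at ht
        simp only [hA, hB, indicator_of_mem ht, hz])
    refine ⟨C, ?_⟩
    filter_upwards [hC] with t ht htm
    have h1 := ht htm
    simp only [hB, indicator_of_mem htm, hz] at h1
    rw [← fderiv_lag_vert, h1]
    congr 1
    refine intervalIntegral.integral_congr fun s hs => ?_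
    rw [uIcc_of_le htm.1] at hs
    have : s ∈ Icc α β := ⟨hs.1, hs.2.trans htm.2⟩
    simp only [hA, indicator_of_mem this, hz]
  obtain ⟨C₁, hC₁⟩ := key (1, 0)
  obtain ⟨C₂, hC₂⟩ := key (0, 1)
  have hAint : ∀ e : ℝ × ℝ, IntervalIntegrable (fun s => fderiv ℝ M.lag (z s) (e, 0)) volume α β :=
    fun e => intervalIntegrable_of_bounded (C := D * ‖(e, (0 : ℝ × ℝ))‖)
      ((hfc.clm_apply continuous_const).measurable.comp hzm) fun t ht => by
        rw [uIoc_of_le hαβ.le] at ht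
        refine ((fderiv ℝ M.lag (z t)).le_opNorm (e, 0)).trans ?_
        exact mul_le_mul_of_nonneg_right (hD _ (hzR t (Ioc_subset_Icc_self ht))) (norm_nonneg _)
  set p : ℝ → ℝ × ℝ := fun t =>
    (2⁻¹ * (C₁ + ∫ s in α..t, fderiv ℝ M.lag (z s) ((1, 0), 0)),
      2⁻¹ * (C₂ + ∫ s in α..t, fderiv ℝ M.lag (z s) ((0, 1), 0))) with hp
  have hpc : ContinuousOn p (Icc α β) := by
    have := fun e => intervalIntegral.continuousOn_primitive_interval' (hAint e) left_mem_uIcc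
    rw [uIcc_of_le hαβ.le] at this
    exact (continuousOn_const.mul (continuousOn_const.add (this _))).prodMk
      (continuousOn_const.mul (continuousOn_const.add (this _)))
  set w : ℝ → ℝ × ℝ := fun t => M.sharp (γ t) (p t) with hw
  have hwc : ContinuousOn w (Icc α β) :=
    M.contDiff_sharp.continuous.comp_continuousOn (hcont.prodMk hpc)
  have hae : ∀ᵐ t, t ∈ Icc α β → deriv γ t = w t := by
    filter_upwards [hC₁, hC₂] with t h1 h2 htm
    have : M.flat (γ t) (deriv γ t) = p t := by
      ext
      · simp only [flat, hp]; linarith [h1 htm]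
      · simp only [flat, hp]; linarith [h2 htm]
    rw [hw]; simp only; rw [← this, sharp_flat]
  have hwi : IntervalIntegrable w volume α β := (by
    rw [← uIcc_of_le hαβ.le] at hwc; exact hwc.intervalIntegrable)
  have hγint : ∀ t ∈ Icc α β, γ t = γ α + ∫ s in α..t, w s := by
    intro t htm
    have hcomp : ∀ (L : ℝ × ℝ →L[ℝ] ℝ), L (γ t) = L (γ α) + L (∫ s in α..t, w s) := by
      intro L
      have hLl : LipschitzWith (‖L‖₊ * K) fun s => L (γ s) := L.lipschitz.comp hγ
      have e1 := (lipschitz_absCont hLl α t).integral_deriv_eq_sub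
      have hwt : IntervalIntegrable w volume α t := hwi.mono_set (by
        rw [uIcc_of_le hαβ.le, uIcc_of_le htm.1]; exact Icc_subset_Icc_right htm.2)
      rw [← L.intervalIntegral_comp_comm hwt]
      have e2 : ∫ s in α..t, deriv (fun s => L (γ s)) s = ∫ s in α..t, L (w s) := by
        refine intervalIntegral.integral_congr_ae ?_
        filter_upwards [hae, hγ.ae_differentiableAt_real] with s hs hs2 hsm
        rw [uIoc_of_le htm.1] at hsm
        rw [← hs ⟨hsm.1.le, hsm.2.trans htm.2⟩]
        exact (L.hasFDerivAt.comp_hasDerivAt s hs2.hasDerivAt).deriv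
      rw [← e2, e1]; ring
    ext
    · exact hcomp (ContinuousLinearMap.fst ℝ ℝ ℝ)
    · exact hcomp (ContinuousLinearMap.snd ℝ ℝ ℝ)
  have hγd : ∀ t ∈ Ioo α β, HasDerivAt γ (w t) t := by
    intro t ht
    have hmem : Icc α β ∈ 𝓝 t := Icc_mem_nhds ht.1 ht.2
    have hd : HasDerivAt (fun u => ∫ s in α..u, w s) (w t) t := by
      refine intervalIntegral.integral_hasDerivAt_right (hwi.mono_set ?_) ?_ ?_
      · rw [uIcc_of_le hαβ.le, uIcc_of_le ht.1.le]; exact Icc_subset_Icc_right ht.2.le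
      · exact hwc.stronglyMeasurableAtFilter_nhdsWithin measurableSet_Icc t |>.filter_mono
          (by rw [nhdsWithin_eq_nhds.2 hmem])
      · exact hwc.continuousAt hmem
    refine (hd.const_add (γ α)).congr_of_eventuallyEq ?_
    filter_upwards [hmem] with u hu using hγint u hu
  have hpflat : ∀ t ∈ Ioo α β, M.flat (γ t) (deriv γ t) = p t := by
    intro t ht
    rw [(hγd t ht).deriv, hw]; exact M.flat_sharp _ _
  have hpd : HasDerivAt p (M.force (γ t) (w t)) t := by
    have hmem : Icc α β ∈ 𝓝 t := Icc_mem_nhds ht.1 ht.2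
    have hzc : ContinuousOn (fun t => (γ t, w t)) (Icc α β) := hcont.prodMk hwc
    have hone : ∀ e : ℝ × ℝ, HasDerivAt (fun u => ∫ s in α..u, fderiv ℝ M.lag (z s) (e, 0))
        (fderiv ℝ M.lag (γ t, w t) (e, 0)) t := by
      intro e
      have hfe : ContinuousOn (fun t => fderiv ℝ M.lag (γ t, w t) (e, 0)) (Icc α β) :=
        (hfc.clm_apply continuous_const).comp_continuousOn hzc
      have hd : HasDerivAt (fun u => ∫ s in α..u, fderiv ℝ M.lag (γ s, w s) (e, 0))
          (fderiv ℝ M.lag (γ t, w t) (e, 0)) t := by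
        refine intervalIntegral.integral_hasDerivAt_right ?_ ?_ ?_
        · refine ContinuousOn.intervalIntegrable ?_
          rw [uIcc_of_le ht.1.le]; exact hfe.mono (Icc_subset_Icc_right ht.2.le)
        · exact hfe.stronglyMeasurableAtFilter_nhdsWithin measurableSet_Icc t |>.filter_mono
            (by rw [nhdsWithin_eq_nhds.2 hmem])
        · exact hfe.continuousAt hmem
      refine hd.congr_of_eventuallyEq ?_
      filter_upwards [hmem] with u hu
      refine intervalIntegral.integral_congr_ae ?_
      filter_upwards [hae] with s hs hsm
      rw [uIoc_of_le hu.1] at hsm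
      simp only [hz]
      rw [hs ⟨hsm.1.le, hsm.2.trans hu.2⟩]
    exact ((hone (1, 0)).const_add C₁ |>.const_mul 2⁻¹).prodMk
      ((hone (0, 1)).const_add C₂ |>.const_mul 2⁻¹)
  have hfin : HasDerivAt (fun s => (γ s, p s)) (w t, M.force (γ t) (w t)) t :=
    (hγd t ht).prodMk hpd
  rw [hpflat t ht]
  refine hfin.congr_of_eventuallyEq ?_
  filter_upwards [Ioo_mem_nhds ht.1 ht.2] with s hs
  rw [hpflat s hs]

end TorusMetric

lemma contDiff_of_hasDerivAt {E : Type*} [NormedAddCommGroup E] [NormedSpace ℝ E]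
    {X : E → E} (hX : ContDiff ℝ (⊤ : ℕ∞) X) {z : ℝ → E} (hz : ∀ t, HasDerivAt z (X (z t)) t) :
    ContDiff ℝ (⊤ : ℕ∞) z := by
  have hd : deriv z = X ∘ z := funext fun t => (hz t).deriv
  refine contDiff_infty.2 fun n => ?_
  induction n with
  | zero => exact contDiff_zero.2 (continuous_iff_continuousAt.2 fun t => (hz t).continuousAt)
  | succ n ih =>
    rw [Nat.cast_succ]
    refine contDiff_succ_iff_deriv.2 ⟨fun t => (hz t).differentiableAt, by simp, ?_⟩
    rw [hd]
    exact (hX.of_le (by exact_mod_cast le_top)).comp ih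

lemma ode_unique {E : Type*} [NormedAddCommGroup E] [NormedSpace ℝ E] [ProperSpace E]
    {X : E → E} (hX : ContDiff ℝ (⊤ : ℕ∞) X) {y z : ℝ → E} (hy : ∀ t, HasDerivAt y (X (y t)) t)
    (hz : ∀ t, HasDerivAt z (X (z t)) t) (h0 : y 0 = z 0) : y = z := by
  funext t
  set T : ℝ := |t| + 1 with hT
  have cy : Continuous y := continuous_iff_continuousAt.2 fun t => (hy t).continuousAt
  have cz : Continuous z := continuous_iff_continuousAt.2 fun t => (hz t).continuousAt
  obtain ⟨R₁, h₁⟩ := (isCompact_Icc (a := -T) (b := T)).exists_bound_of_continuousOn cy.continuousOn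
  obtain ⟨R₂, h₂⟩ := (isCompact_Icc (a := -T) (b := T)).exists_bound_of_continuousOn cz.continuousOn
  obtain ⟨K, hK⟩ := (hX.contDiffOn (s := Metric.closedBall (0 : E) (max R₁ R₂))).exists_lipschitzOnWith
    (by simp) (convex_closedBall _ _) (isCompact_closedBall _ _)
  have hT0 : 0 < T := by positivity
  refine ODE_solution_unique_of_mem_Ioo (v := fun _ => X) (s := fun _ => Metric.closedBall 0 (max R₁ R₂))
    (a := -T) (b := T) (t₀ := 0) (K := K) (fun _ _ => hK) ⟨by linarith, hT0⟩ (fun s hs => ⟨hy s, ?_⟩)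
    (fun s hs => ⟨hz s, ?_⟩) h0 ?_
  · rw [mem_closedBall_zero_iff]; exact (h₁ s (Ioo_subset_Icc_self hs)).trans (le_max_left _ _)
  · rw [mem_closedBall_zero_iff]; exact (h₂ s (Ioo_subset_Icc_self hs)).trans (le_max_right _ _)
  · rw [mem_Ioo, ← abs_lt]; simp [hT]

namespace TorusMetric

/-- Every parameter has a neighbourhood on which the curve realizes the distance. -/
def LocIso (M : TorusMetric) (γ : ℝ → ℝ × ℝ) : Prop :=
  ∀ t : ℝ, ∃ ε > 0, ∀ s₁ s₂, t - ε ≤ s₁ → s₁ ≤ s₂ → s₂ ≤ t + ε → M.dist (γ s₁) (γ s₂) = s₂ - s₁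

/-- The trajectory of a curve in the cotangent bundle. -/
def phase (M : TorusMetric) (γ : ℝ → ℝ × ℝ) (t : ℝ) : (ℝ × ℝ) × (ℝ × ℝ) :=
  (γ t, M.flat (γ t) (deriv γ t))

variable {M : TorusMetric} {c : ℝ → ℝ × ℝ}

lemma LocIso.hasDerivAt_phase (h : M.LocIso c) {K : NNReal} (hK : LipschitzWith K c) (t : ℝ) :
    HasDerivAt (M.phase c) (M.hamX (M.phase c t)) t := by
  obtain ⟨ε, hε, hiso⟩ := h t
  exact M.hamilton_of_isometric hK (α := t - ε) (β := t + ε) (by linarith)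
    (fun s hs s' hs' hle => hiso s s' hs.1 hle hs'.2) ⟨by linarith, by linarith⟩

lemma LocIso.contDiff (h : M.LocIso c) {K : NNReal} (hK : LipschitzWith K c) :
    ContDiff ℝ (⊤ : ℕ∞) c :=
  contDiff_fst.comp (contDiff_of_hasDerivAt M.contDiff_hamX (h.hasDerivAt_phase hK))

lemma LocIso.isGeodesic (h : M.LocIso c) {K : NNReal} (hK : LipschitzWith K c) :
    M.IsGeodesic c := by
  have hs := h.contDiff hK
  have hsp : ∀ t, M.nrm (c t) (deriv c t) = 1 := fun t => by
    obtain ⟨ε, hε, hiso⟩ := h t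
    exact M.unit_speed_of_isometric (α := t - ε) (β := t + ε)
      (fun s hs s' hs' hle => hiso s s' hs.1 hle hs'.2) ⟨by linarith, by linarith⟩
      (hs.differentiable (by simp) t)
  refine ⟨hs, fun t => by rw [← nrm_sq, hsp, one_pow], fun t => ?_⟩
  obtain ⟨ε, hε, hiso⟩ := h t
  refine ⟨ε, hε, fun s₁ s₂ h1 h2 h3 => ?_⟩
  rw [hiso s₁ s₂ h1 h2 h3, length_eq]
  simp [hsp]

lemma IsGeodesic.nrm_deriv (hc : M.IsGeodesic c) (t : ℝ) : M.nrm (c t) (deriv c t) = 1 := by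
  rw [nrm, hc.2.1, Real.sqrt_one]

lemma IsGeodesic.deriv_ne_zero (hc : M.IsGeodesic c) (t : ℝ) : deriv c t ≠ 0 := fun h => by
  have := hc.nrm_deriv t
  rw [h, nrm_zero] at this; norm_num at this

lemma IsGeodesic.locIso (hc : M.IsGeodesic c) : M.LocIso c := fun t => by
  obtain ⟨ε, hε, h⟩ := hc.2.2 t
  refine ⟨ε, hε, fun s₁ s₂ h1 h2 h3 => ?_⟩
  rw [h s₁ s₂ h1 h2 h3, length_eq]
  simp [hc.nrm_deriv]

lemma IsGeodesic.lipschitz (hc : M.IsGeodesic c) : LipschitzWith (M.lo⁻¹).toNNReal c := by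
  refine lipschitzWith_of_nnnorm_deriv_le (hc.1.differentiable (by simp)) fun t => ?_
  rw [← NNReal.coe_le_coe, coe_nnnorm, Real.coe_toNNReal _ (inv_pos.2 M.lo_pos).le,
    ← one_div, le_div_iff₀ M.lo_pos, mul_comm, ← hc.nrm_deriv t]
  exact M.lo_le _ _

lemma IsGeodesic.shift (hc : M.IsGeodesic c) (a : ℝ) : M.IsGeodesic fun t => c (a + t) := by
  have h : M.LocIso fun t => c (a + t) := fun t => by
    obtain ⟨ε, hε, h⟩ := hc.locIso (a + t)
    exact ⟨ε, hε, fun s₁ s₂ h1 h2 h3 => by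
      rw [h _ _ (by linarith) (by linarith) (by linarith)]; ring⟩
  exact h.isGeodesic (hc.lipschitz.comp (isometry_add_left a).lipschitz)

lemma IsGeodesic.reverse (hc : M.IsGeodesic c) : M.IsGeodesic fun t => c (-t) := by
  have h : M.LocIso fun t => c (-t) := fun t => by
    obtain ⟨ε, hε, h⟩ := hc.locIso (-t)
    exact ⟨ε, hε, fun s₁ s₂ h1 h2 h3 => by
      rw [M.dist_comm, h _ _ (by linarith) (by linarith) (by linarith)]; ring⟩
  exact h.isGeodesic (hc.lipschitz.comp (LipschitzWith.id.neg))

lemma IsGeodesic.eq_of_deriv_eq {c' : ℝ → ℝ × ℝ} (hc : M.IsGeodesic c) (hc' : M.IsGeodesic c')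
    (h0 : c 0 = c' 0) (h1 : deriv c 0 = deriv c' 0) : c = c' := by
  have := ode_unique M.contDiff_hamX (hc.locIso.hasDerivAt_phase hc.lipschitz)
    (hc'.locIso.hasDerivAt_phase hc'.lipschitz) (by simp [phase, h0, h1])
  funext t
  exact congrArg Prod.fst (congrFun this t)

lemma IsGeodesic.not_opposite (hc : M.IsGeodesic c) {s s' : ℝ} (h : c s = c s') :
    deriv c s ≠ -deriv c s' := by
  intro hd
  have e : (fun t => c (s + t)) = fun t => c (s' - t) := by
    have hr : M.IsGeodesic fun t => c (s' - t) := by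
      simpa only [sub_eq_add_neg] using (hc.shift s').reverse
    refine (hc.shift s).eq_of_deriv_eq hr (by simpa using h) ?_
    rw [deriv_comp_const_add, deriv_comp_const_sub]
    simpa using hd
  set m := (s + s') / 2 with hm
  have e2 : ∀ y, c (m + y) = c (m - y) := fun y => by
    have := congrFun e (m - s + y)
    rw [show s + (m - s + y) = m + y by ring, show s' - (m - s + y) = m - y by rw [hm]; ring] at this
    exact this
  have e3 : deriv (fun y => c (m + y)) 0 = deriv (fun y => c (m - y)) 0 := by rw [funext e2]
  rw [deriv_comp_const_add, deriv_comp_const_sub] at e3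
  simp only [add_zero, sub_zero] at e3
  exact hc.deriv_ne_zero m (by
    have := self_eq_neg.1 e3
    exact this)

/-- At a self-intersection a geodesic either is periodic or intersects itself transversally. -/
lemma IsGeodesic.periodic_or_transverse (hc : M.IsGeodesic c) {s s' : ℝ} (h : c s = c s') :
    (∀ x, c (s + x) = c (s' + x)) ∨ crossDet (deriv c s) (deriv c s') ≠ 0 := by
  by_cases hx : crossDet (deriv c s) (deriv c s') = 0
  · left
    set v := deriv c s with hv
    set w := deriv c s' with hw
    have hv1 : M.g (c s) v v = 1 := hc.2.1 s
    have hw1 : M.g (c s) w w = 1 := by rw [h]; exact hc.2.1 s'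
    have hv0 : v ≠ 0 := hc.deriv_ne_zero s
    obtain ⟨r, hr⟩ : ∃ r : ℝ, w = r • v := by
      unfold crossDet at hx
      by_cases h1 : v.1 = 0
      · have h2 : v.2 ≠ 0 := fun h2 => hv0 (Prod.ext h1 h2)
        refine ⟨w.2 / v.2, ?_⟩
        ext
        · simp only [Prod.smul_fst, h1, smul_eq_mul, mul_zero]
          rw [h1, zero_mul, zero_sub, neg_eq_zero] at hx
          exact (mul_eq_zero.1 hx).resolve_left h2
        · simp only [Prod.smul_snd, smul_eq_mul]; field_simp
      · refine ⟨w.1 / v.1, ?_⟩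
        ext
        · simp only [Prod.smul_fst, smul_eq_mul]; field_simp
        · simp only [Prod.smul_snd, smul_eq_mul]; field_simp; linarith
    have hr2 : r * r = 1 := by
      rw [hr, g_smul_left, g_smul_right, hv1] at hw1; linarith
    rcases mul_self_eq_one_iff.1 hr2 with h1 | h1
    · have := (hc.shift s).eq_of_deriv_eq (hc.shift s') (by simpa using h) (by
        rw [deriv_comp_const_add, deriv_comp_const_add]
        simp only [add_zero]
        rw [← hv, ← hw, hr, h1, one_smul])
      exact fun x => congrFun this x
    · exact absurd (by rw [← hv, ← hw, hr, h1]; simp) (hc.not_opposite h)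
  · exact Or.inr hx

end TorusMetric

namespace TorusMetric

variable {M : TorusMetric} {c : ℝ → ℝ × ℝ}

/-- A function whose zero set is, near the point `c s`, the given branch of the geodesic. -/
lemma IsGeodesic.exists_chart (hc : M.IsGeodesic c) {s : ℝ} {p : ℝ × ℝ} (hs : c s = p) :
    ∃ (F : ℝ × ℝ → ℝ) (n : ℝ × ℝ), (∀ z h, F (z + h • n) = F z + h) ∧
      (∀ᶠ z in 𝓝 p, ContinuousAt F z) ∧ (∀ᶠ x in 𝓝 0, F (c (s + x)) = 0) ∧
      (∀ ε > 0, ∀ᶠ z in 𝓝 p, F z = 0 → ∃ x, |x| < ε ∧ z = c (s + x)) ∧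
      ∀ k, c k = p → crossDet (deriv c s) (deriv c k) ≠ 0 →
        ∀ᶠ x in 𝓝[≠] 0, 0 < F (c (k + x)) * (crossDet (deriv c s) (deriv c k) * x) := by
  set v := deriv c s with hv
  have hv0 : v ≠ 0 := hc.deriv_ne_zero s
  set q : ℝ := v.1 ^ 2 + v.2 ^ 2 with hq
  have hq0 : 0 < q := by
    by_contra h
    have h1 : v.1 = 0 := by nlinarith [sq_nonneg v.1, sq_nonneg v.2]
    have h2 : v.2 = 0 := by nlinarith [sq_nonneg v.1, sq_nonneg v.2]
    exact hv0 (Prod.ext h1 h2)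
  set ξ : ℝ × ℝ → ℝ := fun w => (w.1 * v.1 + w.2 * v.2) / q with hξ
  set ν : ℝ × ℝ → ℝ := fun w => v.1 * w.2 - v.2 * w.1 with hν
  have hξc : Continuous ξ := by fun_prop
  have hνc : Continuous ν := by fun_prop
  have hcs : ∀ k, HasStrictDerivAt (fun x => c (k + x)) (deriv c k) 0 := fun k => by
    have h1 : ContDiffAt ℝ (⊤ : ℕ∞) (fun x => c (k + x)) 0 :=
      (hc.1.comp (contDiff_const.add contDiff_id)).contDiffAt
    have := h1.hasStrictDerivAt (by simp)
    rwa [deriv_comp_const_add, add_zero] at this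
  have hfst : ∀ {f : ℝ → ℝ × ℝ} {f' : ℝ × ℝ}, HasStrictDerivAt f f' 0 →
      HasStrictDerivAt (fun x => (f x).1) f'.1 0 := fun h =>
    (ContinuousLinearMap.fst ℝ ℝ ℝ).hasStrictFDerivAt.comp_hasStrictDerivAt 0 h
  have hsnd : ∀ {f : ℝ → ℝ × ℝ} {f' : ℝ × ℝ}, HasStrictDerivAt f f' 0 →
      HasStrictDerivAt (fun x => (f x).2) f'.2 0 := fun h =>
    (ContinuousLinearMap.snd ℝ ℝ ℝ).hasStrictFDerivAt.comp_hasStrictDerivAt 0 h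
  have hξd : ∀ k, HasStrictDerivAt (fun x => ξ (c (k + x) - p)) (ξ (deriv c k)) 0 := fun k => by
    have h := (hcs k).sub_const p
    exact (((hfst h).mul_const v.1).add ((hsnd h).mul_const v.2)).div_const q
  have hνd : ∀ k, HasStrictDerivAt (fun x => ν (c (k + x) - p)) (ν (deriv c k)) 0 := fun k => by
    have h := (hcs k).sub_const p
    exact ((hsnd h).const_mul v.1).sub ((hfst h).const_mul v.2)
  have hξv : ξ v = 1 := by
    simp only [hξ]; rw [div_eq_one_iff_eq hq0.ne', hq]; ring
  have hu := hξd s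
  rw [← hv, hξv] at hu
  set u : ℝ → ℝ := fun x => ξ (c (s + x) - p) with hu_def
  have hu' := hu.hasStrictFDerivAt_equiv one_ne_zero
  set e := hu'.toOpenPartialHomeomorph u with he
  have heu : ∀ x, e x = u x := fun x => rfl
  have h0s : (0 : ℝ) ∈ e.source := hu'.mem_toOpenPartialHomeomorph_source
  have hu0 : u 0 = 0 := by simp [hu_def, hs, hξ]
  have h0t : (0 : ℝ) ∈ e.target := by
    have := e.map_source h0s
    rwa [heu, hu0] at this
  have hes0 : e.symm 0 = 0 := by
    have := e.left_inv h0s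
    rwa [heu, hu0] at this
  have hed : HasDerivAt e.symm 1 0 := by
    have := e.hasDerivAt_symm (a := 0) (f' := 1) h0t one_ne_zero (by rw [hes0]; exact hu.hasDerivAt)
    simpa using this
  set F : ℝ × ℝ → ℝ := fun z => ν (z - p) - ν (c (s + e.symm (ξ (z - p))) - p) with hF
  have hp0 : ξ (p - p) = 0 := by simp [hξ]
  have hξt : Tendsto (fun z => ξ (z - p)) (𝓝 p) (𝓝 0) := by
    have : ContinuousAt (fun z => ξ (z - p)) p := (hξc.comp (continuous_id.sub continuous_const)).continuousAt
    rwa [ContinuousAt, hp0] at this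
  have htgt : ∀ᶠ z in 𝓝 p, ξ (z - p) ∈ e.target := hξt.eventually (e.open_target.mem_nhds h0t)
  refine ⟨F, (-v.2 / q, v.1 / q), ?_, ?_, ?_, ?_, ?_⟩
  · intro z h
    have h1 : ξ (z + h • (-v.2 / q, v.1 / q) - p) = ξ (z - p) := by
      simp only [hξ, Prod.fst_sub, Prod.snd_sub, Prod.fst_add, Prod.snd_add, Prod.smul_fst,
        Prod.smul_snd, smul_eq_mul]
      congr 1; ring
    have h2 : ν (z + h • (-v.2 / q, v.1 / q) - p) = ν (z - p) + h := by
      simp only [hν, Prod.fst_sub, Prod.snd_sub, Prod.fst_add, Prod.snd_add, Prod.smul_fst,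
        Prod.smul_snd, smul_eq_mul]
      have : h = h * (v.1 ^ 2 + v.2 ^ 2) / q := by rw [← hq]; field_simp
      rw [this]; ring_nf; field_simp; rw [hq]; ring
    simp only [hF, h1, h2]; ring
  · filter_upwards [htgt] with z hz
    have h1 : ContinuousAt (fun z => e.symm (ξ (z - p))) z :=
      ContinuousAt.comp (f := fun z => ξ (z - p)) (e.continuousAt_symm hz)
        (hξc.comp (continuous_id.sub continuous_const)).continuousAt
    have h2 : ContinuousAt (fun z => c (s + e.symm (ξ (z - p)))) z :=
      ContinuousAt.comp (f := fun z => s + e.symm (ξ (z - p))) hc.1.continuous.continuousAt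
        (continuousAt_const.add h1)
    exact (hνc.comp (continuous_id.sub continuous_const)).continuousAt.sub
      (ContinuousAt.comp (f := fun z => c (s + e.symm (ξ (z - p))) - p) hνc.continuousAt
        (h2.sub continuousAt_const))
  · filter_upwards [e.open_source.mem_nhds h0s] with x hx
    have : e.symm (ξ (c (s + x) - p)) = x := e.left_inv hx
    simp only [hF, this, sub_self]
  · intro ε hε
    have hsm : Tendsto (fun z => |e.symm (ξ (z - p))|) (𝓝 p) (𝓝 0) := by
      have := ((e.continuousAt_symm h0t).tendsto.comp hξt).abs
      rw [hes0, abs_zero] at this; exact this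
    filter_upwards [htgt, hsm.eventually (gt_mem_nhds hε)] with z hz hzε hFz
    refine ⟨_, hzε, ?_⟩
    set x := e.symm (ξ (z - p)) with hx
    have e1 : ξ (c (s + x) - p) = ξ (z - p) := e.right_inv hz
    have e2 : ν (c (s + x) - p) = ν (z - p) := by simp only [hF] at hFz; linarith
    have hz' : ∀ w : ℝ × ℝ, w = (v.1 * ξ w - v.2 / q * ν w, v.2 * ξ w + v.1 / q * ν w) := by
      intro w
      ext
      · simp only [hξ, hν]; field_simp; rw [hq]; ring
      · simp only [hξ, hν]; field_simp; rw [hq]; ring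
    have : z - p = c (s + x) - p := by rw [hz' (z - p), hz' (c (s + x) - p), e1, e2]
    exact sub_left_injective this
  · intro k hk hD
    set D := crossDet v (deriv c k) with hDdef
    have hG : HasDerivAt (fun x => F (c (k + x))) D 0 := by
      have h1 := (hνd k).hasDerivAt
      have h2 := (hνd s).hasDerivAt
      have hνv : ν v = 0 := by simp only [hν]; ring
      rw [← hv, hνv] at h2
      have h3 : HasDerivAt (fun x => e.symm (ξ (c (k + x) - p))) (1 * ξ (deriv c k)) 0 := by
        refine HasDerivAt.comp (h₂ := e.symm) (h := fun x => ξ (c (k + x) - p)) 0 ?_ (hξd k).hasDerivAt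
        rw [add_zero, hk, hp0]; exact hed
      have h4 : HasDerivAt (fun x => ν (c (s + e.symm (ξ (c (k + x) - p))) - p))
          (0 * (1 * ξ (deriv c k))) 0 := by
        refine HasDerivAt.comp (h₂ := fun y => ν (c (s + y) - p))
          (h := fun x => e.symm (ξ (c (k + x) - p))) 0 ?_ h3
        rw [add_zero, hk, hp0, hes0]; exact h2
      exact (h1.sub h4).congr_deriv (by simp [hDdef, crossDet, hν])
    have hG0 : F (c (k + 0)) = 0 := by
      have : F (c (k + 0)) = ν (p - p) - ν (c (s + e.symm (ξ (p - p))) - p) := by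
        simp only [hF, add_zero, hk]
      rw [this, hp0, hes0, add_zero, hs, sub_self]
    have hsl := hasDerivAt_iff_tendsto_slope.1 hG
    have hpos : ∀ᶠ x in 𝓝[≠] (0 : ℝ), 0 < slope (fun x => F (c (k + x))) 0 x * D := by
      have := hsl.mul_const D
      exact this.eventually (lt_mem_nhds (mul_self_pos.2 hD))
    filter_upwards [hpos, self_mem_nhdsWithin] with x hx hx0
    rw [slope_def_field, hG0, sub_zero, sub_zero] at hx
    have hx2 : 0 < x * x := mul_self_pos.2 hx0
    have : F (c (k + x)) * (D * x) = F (c (k + x)) / x * D * (x * x) := by field_simp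
    rw [this]; positivity

end TorusMetric

namespace TorusMetric

variable {M : TorusMetric} {c : ℝ → ℝ × ℝ}

/-- The curve `η` is `L`-Lipschitz on `S` for the Riemannian distance. -/
def LipOn (M : TorusMetric) (L : ℝ) (η : ℝ → ℝ × ℝ) (S : Set ℝ) : Prop :=
  ∀ s ∈ S, ∀ t ∈ S, M.dist (η s) (η t) ≤ L * |s - t|

lemma LipOn.mono {L : ℝ} {η : ℝ → ℝ × ℝ} {S T : Set ℝ} (h : M.LipOn L η S) (hT : T ⊆ S) :
    M.LipOn L η T := fun s hs t ht => h s (hT hs) t (hT ht)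

lemma LipOn.of_le {L L' : ℝ} {η : ℝ → ℝ × ℝ} {S : Set ℝ} (h : M.LipOn L η S) (hL : L ≤ L') :
    M.LipOn L' η S := fun s hs t ht =>
  (h s hs t ht).trans (mul_le_mul_of_nonneg_right hL (abs_nonneg _))

lemma LipOn.congr {L : ℝ} {η η' : ℝ → ℝ × ℝ} {S : Set ℝ} (h : M.LipOn L η S)
    (he : ∀ s ∈ S, η' s = η s) : M.LipOn L η' S := fun s hs t ht => by
  rw [he s hs, he t ht]; exact h s hs t ht

lemma lipOn_of_le {L : ℝ} {η : ℝ → ℝ × ℝ} {S : Set ℝ}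
    (h : ∀ s ∈ S, ∀ t ∈ S, s ≤ t → M.dist (η s) (η t) ≤ L * (t - s)) : M.LipOn L η S := by
  intro s hs t ht
  rcases le_total s t with hst | hst
  · rw [abs_sub_comm, abs_of_nonneg (sub_nonneg.2 hst)]; exact h s hs t ht hst
  · rw [abs_of_nonneg (sub_nonneg.2 hst), dist_comm]; exact h t ht s hs hst

lemma LipOn.union {L a b d : ℝ} {η : ℝ → ℝ × ℝ} (h₁ : M.LipOn L η (Icc a b))
    (h₂ : M.LipOn L η (Icc b d)) : M.LipOn L η (Icc a d) := by
  refine lipOn_of_le fun s hs t ht hst => ?_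
  rcases le_total t b with htb | htb
  · have := h₁ s ⟨hs.1, hst.trans htb⟩ t ⟨ht.1, htb⟩
    rwa [abs_sub_comm, abs_of_nonneg (sub_nonneg.2 hst)] at this
  rcases le_total b s with hbs | hbs
  · have := h₂ s ⟨hbs, hs.2⟩ t ⟨htb, ht.2⟩
    rwa [abs_sub_comm, abs_of_nonneg (sub_nonneg.2 hst)] at this
  have e1 := h₁ s ⟨hs.1, hbs⟩ b ⟨hs.1.trans hbs, le_rfl⟩
  have e2 := h₂ b ⟨le_rfl, htb.trans ht.2⟩ t ⟨htb, ht.2⟩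
  rw [abs_sub_comm, abs_of_nonneg (sub_nonneg.2 hbs)] at e1
  rw [abs_sub_comm, abs_of_nonneg (sub_nonneg.2 htb)] at e2
  have := M.dist_triangle (η s) (η b) (η t)
  linarith

lemma LipOn.continuousOn {L : ℝ} {η : ℝ → ℝ × ℝ} {S : Set ℝ} (h : M.LipOn L η S) :
    ContinuousOn η S := by
  have hlo := M.lo_pos
  refine LipschitzOnWith.continuousOn (K := (L / M.lo).toNNReal) (LipschitzOnWith.of_dist_le_mul ?_)
  intro s hs t ht
  rw [dist_eq_norm, Real.dist_eq]
  refine (M.norm_le_dist _ _).trans ?_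
  have : M.dist (η s) (η t) / M.lo ≤ L / M.lo * |s - t| := by
    rw [div_mul_eq_mul_div]; exact div_le_div_of_nonneg_right (h s hs t ht) hlo.le
  exact this.trans (mul_le_mul_of_nonneg_right (Real.le_coe_toNNReal _) (abs_nonneg _))

/-- Almost minimizing curves with end points close to `p` stay close to `p`. -/
lemma LipOn.mem_ball {p A B : ℝ × ℝ} {R r δ : ℝ} {η : ℝ → ℝ × ℝ}
    (hr : r + (2 * r * M.hi + r) / M.lo ≤ R)
    (hA : A ∈ Metric.ball p r) (hB : B ∈ Metric.ball p r) (hδ : δ ≤ r)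
    (h0 : η 0 = A) (h : M.LipOn (M.dist A B + δ) η (Icc 0 1)) :
    ∀ t ∈ Icc (0 : ℝ) 1, η t ∈ Metric.ball p R := by
  intro t ht
  have hlo := M.lo_pos
  have hhi := M.hi_pos
  rw [Metric.mem_ball, dist_eq_norm] at *
  have hAB : ‖A - B‖ < 2 * r := by
    have : A - B = (A - p) - (B - p) := by abel
    rw [this]; exact (norm_sub_le _ _).trans_lt (by linarith)
  have hd : M.dist A B ≤ 2 * r * M.hi := (M.dist_le A B).trans (by nlinarith)
  have h1 := h 0 ⟨le_rfl, zero_le_one⟩ t ht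
  rw [h0, zero_sub, abs_neg, abs_of_nonneg ht.1] at h1
  have h1' : M.dist A (η t) ≤ 2 * r * M.hi + r := by
    have h2 := M.dist_nonneg A (η t)
    by_cases hneg : 0 ≤ M.dist A B + δ
    · have : (M.dist A B + δ) * t ≤ (M.dist A B + δ) * 1 := mul_le_mul_of_nonneg_left ht.2 hneg
      linarith
    · have h3 : 0 < r := lt_of_le_of_lt (norm_nonneg _) hA
      have : (M.dist A B + δ) * t ≤ 0 := mul_nonpos_of_nonpos_of_nonneg (le_of_not_ge hneg) ht.1
      have : 0 ≤ 2 * r * M.hi + r := by positivity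
      linarith
  have h2 : ‖A - η t‖ ≤ (2 * r * M.hi + r) / M.lo :=
    (M.norm_le_dist _ _).trans (div_le_div_of_nonneg_right h1' hlo.le)
  have : η t - p = (A - p) - (A - η t) := by abel
  rw [this]
  exact (norm_sub_le _ _).trans_lt (by linarith)

/-- Bumping a Lipschitz curve in a fixed direction. -/
lemma LipOn.bump {L h : ℝ} {η : ℝ → ℝ × ℝ} (hη : M.LipOn L η (Icc 0 1)) (hh : 0 ≤ h)
    (m : ℝ × ℝ) : M.LipOn (L + h * ‖m‖ * (M.osc * L + M.hi))
      (fun t => η t + (h * (t * (1 - t))) • m) (Icc 0 1) := by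
  intro s hs t ht
  have ho := M.osc_pos
  have hhi := M.hi_pos
  refine (M.dist_triangle _ (η t + (h * (s * (1 - s))) • m) _).trans ?_
  have e1 := M.dist_translate_le (η s) (η t) ((h * (s * (1 - s))) • m)
  have e2 := M.dist_le (η t + (h * (s * (1 - s))) • m) (η t + (h * (t * (1 - t))) • m)
  have e3 : ‖(h * (s * (1 - s))) • m‖ ≤ h * ‖m‖ := by
    rw [norm_smul, Real.norm_eq_abs, abs_of_nonneg (mul_nonneg hh (mul_nonneg hs.1 (by linarith [hs.2])))]
    refine mul_le_mul_of_nonneg_right ?_ (norm_nonneg _)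
    have : s * (1 - s) ≤ 1 := by nlinarith [hs.1, hs.2]
    nlinarith
  have e4 : ‖η t + (h * (s * (1 - s))) • m - (η t + (h * (t * (1 - t))) • m)‖ ≤ h * ‖m‖ * |s - t| := by
    have : η t + (h * (s * (1 - s))) • m - (η t + (h * (t * (1 - t))) • m) =
      (h * ((s - t) * (1 - s - t))) • m := by
      rw [add_sub_add_left_eq_sub, ← sub_smul]; congr 1; ring
    rw [this, norm_smul, Real.norm_eq_abs, abs_mul, abs_mul, abs_of_nonneg hh]
    have h1 : |1 - s - t| ≤ 1 := by
      rw [abs_le]; constructor <;> linarith [hs.1, hs.2, ht.1, ht.2]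
    have h2 := abs_nonneg (s - t)
    have h3 : |s - t| * |1 - s - t| ≤ |s - t| := by nlinarith
    nlinarith [mul_le_mul_of_nonneg_left h3 (mul_nonneg hh (norm_nonneg m))]
  have h5 := hη s hs t ht
  have h6 := M.dist_nonneg (η s) (η t)
  have h7 : (1 + M.osc * ‖(h * (s * (1 - s))) • m‖) * M.dist (η s) (η t) ≤
      (1 + M.osc * (h * ‖m‖)) * (L * |s - t|) := by gcongr
  have h8 : M.hi * ‖η t + (h * (s * (1 - s))) • m - (η t + (h * (t * (1 - t))) • m)‖ ≤
      M.hi * (h * ‖m‖ * |s - t|) := by gcongr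
  calc _ ≤ (1 + M.osc * (h * ‖m‖)) * (L * |s - t|) + M.hi * (h * ‖m‖ * |s - t|) := by linarith
    _ = _ := by ring

end TorusMetric

namespace TorusMetric

variable {M : TorusMetric} {c : ℝ → ℝ × ℝ}

/-- A family of transverse branches of `c` through `p`, straightened by functions `F k`. -/
structure Charts (M : TorusMetric) (c : ℝ → ℝ × ℝ) (p : ℝ × ℝ) (J : Finset ℝ)
    (F : ℝ → ℝ × ℝ → ℝ) (n : ℝ → ℝ × ℝ) (R ε : ℝ) : Prop where
  pos : 0 < ε
  base : ∀ k ∈ J, c k = p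
  push : ∀ k ∈ J, ∀ z h, F k (z + h • n k) = F k z + h
  cont : ∀ k ∈ J, ContinuousOn (F k) (Metric.ball p R)
  zero : ∀ k ∈ J, ∀ x, |x| < ε → F k (c (k + x)) = 0
  of_zero : ∀ k ∈ J, ∀ z ∈ Metric.ball p R, F k z = 0 → ∃ x, |x| < ε ∧ z = c (k + x)
  sign : ∀ j ∈ J, ∀ k ∈ J, j ≠ k → ∃ D ≠ 0, ∀ x, x ≠ 0 → |x| < ε → 0 < F j (c (k + x)) * (D * x)
  iso : ∀ k ∈ J, ∀ x y, |x| < ε → |y| < ε → M.dist (c (k + x)) (c (k + y)) = |x - y|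

/-- Cutting along the branch `k`: a Lipschitz curve joining two points on the same side of the
branch can be made to stay on this side up to the boundary. -/
lemma Charts.cut {p : ℝ × ℝ} {J : Finset ℝ} {F : ℝ → ℝ × ℝ → ℝ} {n : ℝ → ℝ × ℝ}
    {R ε : ℝ} (H : M.Charts c p J F n R ε) {J' : Finset ℝ} (hJ' : J' ⊆ J) {k : ℝ} (hk : k ∈ J)
    (hkJ' : k ∉ J') {L : ℝ} {η : ℝ → ℝ × ℝ} (hη : M.LipOn L η (Icc 0 1))
    (hR : ∀ t ∈ Icc (0 : ℝ) 1, η t ∈ Metric.ball p R)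
    (hJ : ∀ j ∈ J', ∀ t ∈ Icc (0 : ℝ) 1, 0 < F j (η t) * F j (η 0))
    (hk0 : 0 < F k (η 0) * F k (η 1)) :
    ∃ η' : ℝ → ℝ × ℝ, M.LipOn L η' (Icc 0 1) ∧ η' 0 = η 0 ∧ η' 1 = η 1 ∧
      (∀ j ∈ J', ∀ t ∈ Icc (0 : ℝ) 1, 0 < F j (η' t) * F j (η 0)) ∧
      ∀ t ∈ Icc (0 : ℝ) 1, 0 ≤ F k (η' t) * F k (η 0) := by
  have hFc : ContinuousOn (fun t => F k (η t) * F k (η 0)) (Icc 0 1) :=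
    ((H.cont k hk).comp hη.continuousOn hR).mul continuousOn_const
  have hA : F k (η 0) ≠ 0 := fun h => by simp [h] at hk0
  have hB : F k (η 1) ≠ 0 := fun h => by simp [h] at hk0
  -- the sign is kept on intervals without zeros
  have key : ∀ a b, a ∈ Icc (0 : ℝ) 1 → b ∈ Icc (0 : ℝ) 1 → 0 < F k (η a) * F k (η 0) →
      (∀ t ∈ uIcc a b, F k (η t) ≠ 0) → 0 < F k (η b) * F k (η 0) := by
    intro a b ha hb hpos hne
    by_contra hcon
    have hsub : uIcc a b ⊆ Icc 0 1 := uIcc_subset_Icc ha hb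
    have hmem : (0 : ℝ) ∈ uIcc (F k (η a) * F k (η 0)) (F k (η b) * F k (η 0)) :=
      mem_uIcc.2 (Or.inr ⟨not_lt.1 hcon, hpos.le⟩)
    obtain ⟨t, ht, h0⟩ := intermediate_value_uIcc (hFc.mono hsub) hmem
    exact hne t ht ((mul_eq_zero.1 h0).resolve_right hA)
  have h00 : (0 : ℝ) ∈ Icc (0 : ℝ) 1 := ⟨le_rfl, zero_le_one⟩
  have h11 : (1 : ℝ) ∈ Icc (0 : ℝ) 1 := ⟨zero_le_one, le_rfl⟩
  have hpos0 : 0 < F k (η 0) * F k (η 0) := mul_self_pos.2 hA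
  have hpos1 : 0 < F k (η 1) * F k (η 0) := by rwa [mul_comm]
  set Z : Set ℝ := Icc 0 1 ∩ (fun t => F k (η t) * F k (η 0)) ⁻¹' {0} with hZ
  have hZc : IsCompact Z :=
    isCompact_Icc.of_isClosed_subset (hFc.preimage_isClosed_of_isClosed isClosed_Icc
      isClosed_singleton) inter_subset_left
  have hZm : ∀ t, t ∈ Z ↔ t ∈ Icc (0 : ℝ) 1 ∧ F k (η t) = 0 := fun t => by
    simp [hZ, hA]
  rcases Z.eq_empty_or_nonempty with hZe | hZn
  · refine ⟨η, hη, rfl, rfl, hJ, fun t ht => (key 0 t h00 ht hpos0 fun s hs h0 => ?_).le⟩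
    have : s ∈ Z := (hZm s).2 ⟨uIcc_subset_Icc h00 ht hs, h0⟩
    rw [hZe] at this; exact this
  obtain ⟨a, haZ, hamin⟩ := hZc.exists_isLeast hZn
  obtain ⟨b, hbZ, hbmax⟩ := hZc.exists_isGreatest hZn
  obtain ⟨ha, ha0⟩ := (hZm a).1 haZ
  obtain ⟨hb, hb0⟩ := (hZm b).1 hbZ
  have hab : a ≤ b := hamin hbZ
  obtain ⟨x, hx, hxa⟩ := H.of_zero k hk _ (hR a ha) ha0
  obtain ⟨y, hy, hyb⟩ := H.of_zero k hk _ (hR b hb) hb0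
  set w : ℝ → ℝ := fun t => x + (t - a) / (b - a) * (y - x) with hw
  have hθ : ∀ t ∈ Icc a b, 0 ≤ (t - a) / (b - a) ∧ (t - a) / (b - a) ≤ 1 := fun t ht =>
    ⟨div_nonneg (by linarith [ht.1]) (by linarith),
      div_le_one_of_le₀ (by linarith [ht.2]) (by linarith)⟩
  have hwε : ∀ t ∈ Icc a b, |w t| < ε := fun t ht => by
    obtain ⟨h1, h2⟩ := hθ t ht
    rw [abs_lt] at hx hy ⊢
    have h3 := (convex_Ioo (-ε) ε) hx hy (sub_nonneg.2 h2) h1 (by ring)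
    have h4 : w t = (1 - (t - a) / (b - a)) • x + ((t - a) / (b - a)) • y := by
      simp only [hw, smul_eq_mul]; ring
    rw [h4]; exact h3
  have hwa : w a = x := by simp [hw]
  have hwb : w b = y ∨ a = b := by
    rcases hab.eq_or_lt with h | h
    · exact Or.inr h
    · left; simp only [hw]; rw [div_self (sub_pos.2 h).ne']; ring
  set η' : ℝ → ℝ × ℝ := fun t => if t ∈ Icc a b then c (k + w t) else η t with hη'
  have hin : ∀ t ∈ Icc a b, η' t = c (k + w t) := fun t ht => by simp only [hη', if_pos ht]
  have hout : ∀ t, t ∉ Ioo a b → η' t = η t := fun t ht => by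
    by_cases h : t ∈ Icc a b
    · rw [hin t h]
      have : t = a ∨ t = b := by
        by_contra hne
        push Not at hne
        exact ht ⟨lt_of_le_of_ne h.1 (Ne.symm hne.1), lt_of_le_of_ne h.2 hne.2⟩
      rcases this with rfl | rfl
      · rw [hwa, hxa]
      · rcases hwb with h' | h'
        · rw [h', hyb]
        · rw [← h', hwa, hxa]
    · simp only [hη', if_neg h]
  have hsub1 : Icc 0 a ⊆ Icc (0 : ℝ) 1 := Icc_subset_Icc le_rfl ha.2
  have hsub2 : Icc b 1 ⊆ Icc (0 : ℝ) 1 := Icc_subset_Icc hb.1 le_rfl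
  have hlip1 : M.LipOn L η' (Icc 0 a) := (hη.mono hsub1).congr fun t ht =>
    hout t fun h => absurd h.1 (not_lt.2 ht.2)
  have hlip3 : M.LipOn L η' (Icc b 1) := (hη.mono hsub2).congr fun t ht =>
    hout t fun h => absurd h.2 (not_lt.2 ht.1)
  have hlip2 : M.LipOn L η' (Icc a b) := by
    intro s hs t ht
    rw [hin s hs, hin t ht, H.iso k hk _ _ (hwε s hs) (hwε t ht)]
    have e1 : w s - w t = (s - t) * ((y - x) / (b - a)) := by simp only [hw]; ring
    have e2 := hη a ha b hb
    rw [hxa, hyb, H.iso k hk _ _ hx hy] at e2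
    rcases hab.eq_or_lt with h | h
    · have hst : s = t := le_antisymm (by linarith [hs.2, ht.1]) (by linarith [hs.1, ht.2])
      rw [hst]; simp
    · rw [e1, abs_mul, abs_div, mul_comm]
      refine mul_le_mul_of_nonneg_right ?_ (abs_nonneg _)
      rw [div_le_iff₀ (abs_pos.2 (sub_pos.2 h).ne'), abs_sub_comm y, abs_sub_comm b]
      exact e2
  refine ⟨η', (hlip1.union hlip2).union hlip3, hout 0 fun h => absurd h.1 (not_lt.2 ha.1),
    hout 1 fun h => absurd h.2 (not_lt.2 hb.2), fun j hj t ht => ?_, fun t ht => ?_⟩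
  · by_cases h : t ∈ Icc a b
    · rw [hin t h]
      have hjk : j ≠ k := fun h => hkJ' (h ▸ hj)
      obtain ⟨D, hD, hDx⟩ := H.sign j (hJ' hj) k hk hjk
      have hjx := hJ j hj a ha
      have hjy := hJ j hj b hb
      rw [hxa] at hjx; rw [hyb] at hjy
      have hzero : F j (c (k + 0)) = 0 := by
        rw [add_zero, H.base k hk, ← H.base j (hJ' hj)]
        have := H.zero j (hJ' hj) 0 (by simpa using H.pos)
        rwa [add_zero] at this
      have hx0 : x ≠ 0 := fun h => by rw [h, hzero] at hjx; simp at hjx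
      have hy0 : y ≠ 0 := fun h => by rw [h, hzero] at hjy; simp at hjy
      have hDx' := hDx x hx0 hx
      have hDy' := hDx y hy0 hy
      have same : ∀ u v r : ℝ, 0 < u * r → 0 < u * v → 0 < v * r := fun u v r h1 h2 => by
        have h3 : 0 < (u * u) * (v * r) := by nlinarith [mul_pos h1 h2]
        by_contra hcon
        nlinarith [mul_self_nonneg u]
      have sx : 0 < F j (η 0) * (D * x) := same _ _ _ hDx' hjx
      have sy : 0 < F j (η 0) * (D * y) := same _ _ _ hDy' hjy
      obtain ⟨h1, h2⟩ := hθ t h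
      have sw : 0 < F j (η 0) * (D * w t) := by
        have : F j (η 0) * (D * w t) = (1 - (t - a) / (b - a)) * (F j (η 0) * (D * x)) +
            (t - a) / (b - a) * (F j (η 0) * (D * y)) := by simp only [hw]; ring
        rw [this]
        rcases h1.eq_or_lt with h1 | h1
        · rw [← h1]; linarith
        · have := mul_pos h1 sy
          have := mul_nonneg (sub_nonneg.2 h2) sx.le
          linarith
      have hw0 : w t ≠ 0 := fun h => by rw [h] at sw; simp at sw
      have hDw := hDx _ hw0 (hwε t h)
      exact same (D * w t) _ _ (by linarith) (by linarith)
    · rw [hout t fun h' => h ⟨h'.1.le, h'.2.le⟩]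
      exact hJ j hj t ht
  · by_cases h : t ∈ Icc a b
    · rw [hin t h, H.zero k hk _ (hwε t h), zero_mul]
    · rw [hout t fun h' => h ⟨h'.1.le, h'.2.le⟩]
      rcases lt_or_ge t a with hta | hta
      · refine (key 0 t h00 ht hpos0 fun s hs h0 => ?_).le
        rw [uIcc_of_le ht.1] at hs
        have : a ≤ s := hamin ((hZm s).2 ⟨⟨hs.1, hs.2.trans ht.2⟩, h0⟩)
        linarith [hs.2]
      · have htb : b < t := not_le.1 fun h' => h ⟨hta, h'⟩
        refine (key 1 t h11 ht hpos1 fun s hs h0 => ?_).le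
        rw [uIcc_of_ge ht.2] at hs
        have : s ≤ b := hbmax ((hZm s).2 ⟨⟨ht.1.trans hs.1, hs.2⟩, h0⟩)
        linarith [hs.1]

lemma Charts.push_off {p : ℝ × ℝ} {J : Finset ℝ} {F : ℝ → ℝ × ℝ → ℝ} {n : ℝ → ℝ × ℝ}
    {R ε : ℝ} (H : M.Charts c p J F n R ε) {J' : Finset ℝ} (hJ' : J' ⊆ J) {k : ℝ} (hk : k ∈ J)
    {L δ : ℝ} (hδ : 0 < δ) {η : ℝ → ℝ × ℝ} (hη : M.LipOn L η (Icc 0 1))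
    (hR : ∀ t ∈ Icc (0 : ℝ) 1, η t ∈ Metric.ball p R)
    (hJ : ∀ j ∈ J', ∀ t ∈ Icc (0 : ℝ) 1, 0 < F j (η t) * F j (η 0))
    (hk0 : F k (η 0) ≠ 0) (hk1 : 0 < F k (η 1) * F k (η 0))
    (hk' : ∀ t ∈ Icc (0 : ℝ) 1, 0 ≤ F k (η t) * F k (η 0)) :
    ∃ η' : ℝ → ℝ × ℝ, M.LipOn (L + δ) η' (Icc 0 1) ∧ η' 0 = η 0 ∧ η' 1 = η 1 ∧
      ∀ j ∈ insert k J', ∀ t ∈ Icc (0 : ℝ) 1, 0 < F j (η' t) * F j (η 0) := by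
  set U : Set (ℝ × ℝ) := Metric.ball p R ∩ ⋂ j ∈ J', {z | z ∈ Metric.ball p R → 0 < F j z * F j (η 0)}
    with hU
  have hUo : IsOpen U := by
    have : U = Metric.ball p R ∩ ⋂ j ∈ J',
        (Metric.ball p R ∩ (fun z => F j z * F j (η 0)) ⁻¹' Ioi 0) := by
      ext z
      simp only [hU, mem_inter_iff, mem_iInter, mem_ofPred_eq, mem_preimage, mem_Ioi]
      constructor
      · rintro ⟨h1, h2⟩; exact ⟨h1, fun j hj => ⟨h1, h2 j hj h1⟩⟩
      · rintro ⟨h1, h2⟩; exact ⟨h1, fun j hj _ => (h2 j hj).2⟩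
    rw [this]
    refine Metric.isOpen_ball.inter (isOpen_biInter_finset fun j hj => ?_)
    exact ((H.cont j (hJ' hj)).mul continuousOn_const).isOpen_inter_preimage Metric.isOpen_ball
      isOpen_Ioi
  have hcomp : IsCompact (η '' Icc 0 1) := isCompact_Icc.image_of_continuousOn hη.continuousOn
  have hsub : η '' Icc 0 1 ⊆ U := by
    rintro _ ⟨t, ht, rfl⟩
    refine ⟨hR t ht, mem_iInter₂.2 fun j hj _ => hJ j hj t ht⟩
  obtain ⟨d, hd, hdU⟩ := hcomp.exists_cthickening_subset_open hUo hsub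
  set m : ℝ × ℝ := F k (η 0) • n k with hm
  have hlim : Tendsto (fun h : ℝ => h * ‖m‖ * (M.osc * L + M.hi)) (𝓝[>] 0) (𝓝 0) := by
    have : Continuous fun h : ℝ => h * ‖m‖ * (M.osc * L + M.hi) := by fun_prop
    have := this.tendsto 0
    simp only [zero_mul] at this
    exact this.mono_left nhdsWithin_le_nhds
  have hlim2 : Tendsto (fun h : ℝ => h * ‖m‖) (𝓝[>] 0) (𝓝 0) := by
    have : Continuous fun h : ℝ => h * ‖m‖ := by fun_prop
    have := this.tendsto 0
    simp only [zero_mul] at this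
    exact this.mono_left nhdsWithin_le_nhds
  obtain ⟨h, h1, h2, hh : 0 < h⟩ := ((hlim.eventually (gt_mem_nhds hδ)).and
    ((hlim2.eventually (gt_mem_nhds hd)).and self_mem_nhdsWithin)).exists
  refine ⟨fun t => η t + (h * (t * (1 - t))) • m, (hη.bump hh.le m).of_le (by linarith),
    by simp, by simp, fun j hj t ht => ?_⟩
  have hc : 0 ≤ t * (1 - t) := mul_nonneg ht.1 (by linarith [ht.2])
  rcases Finset.mem_insert.1 hj with rfl | hj
  · have e : η t + (h * (t * (1 - t))) • m = η t + (h * (t * (1 - t)) * F j (η 0)) • n j := by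
      rw [hm, smul_smul]
    simp only [e]
    rw [H.push j hk, add_mul]
    have hsq : 0 < F j (η 0) * F j (η 0) := mul_self_pos.2 hk0
    have h0 := hk' t ht
    rcases ht.1.eq_or_lt with rfl | ht0
    · simpa using hk0
    rcases ht.2.eq_or_lt with rfl | ht1
    · simpa using hk1
    have : 0 < h * (t * (1 - t)) * (F j (η 0) * F j (η 0)) :=
      mul_pos (mul_pos hh (mul_pos ht0 (by linarith))) hsq
    nlinarith
  · have hmem : η t + (h * (t * (1 - t))) • m ∈ U := by
      refine hdU (Metric.mem_cthickening_of_dist_le _ (η t) _ _ ⟨t, ht, rfl⟩ ?_)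
      rw [dist_eq_norm, add_sub_cancel_left, norm_smul, Real.norm_eq_abs,
        abs_of_nonneg (mul_nonneg hh.le hc)]
      have : t * (1 - t) ≤ 1 := by nlinarith [ht.1, ht.2]
      have : h * (t * (1 - t)) * ‖m‖ ≤ h * 1 * ‖m‖ := by gcongr
      linarith
    exact mem_iInter₂.1 hmem.2 j hj hmem.1

lemma Charts.exists_path {p : ℝ × ℝ} {J : Finset ℝ} {F : ℝ → ℝ × ℝ → ℝ} {n : ℝ → ℝ × ℝ}
    {R ε r : ℝ} (H : M.Charts c p J F n R ε) (hr : r + (2 * r * M.hi + r) / M.lo ≤ R)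
    {A B : ℝ × ℝ} (hA : A ∈ Metric.ball p r) (hB : B ∈ Metric.ball p r) (J' : Finset ℝ) :
    J' ⊆ J → (∀ j ∈ J', 0 < F j A * F j B) → ∀ δ > 0, δ ≤ r →
    ∃ η : ℝ → ℝ × ℝ, M.LipOn (M.dist A B + δ) η (Icc 0 1) ∧ η 0 = A ∧ η 1 = B ∧
      ∀ j ∈ J', ∀ t ∈ Icc (0 : ℝ) 1, 0 < F j (η t) * F j A := by
  induction J' using Finset.induction_on with
  | empty =>
    intro _ _ δ hδ _
    obtain ⟨η, h0, h1, h⟩ := M.exists_lipschitz_path A B hδ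
    exact ⟨η, h, h0, h1, by simp⟩
  | insert k J' hkJ' ih =>
    intro hJ hs δ hδ hδr
    have hJ' : J' ⊆ J := (Finset.subset_insert k J').trans hJ
    have hk : k ∈ J := hJ (Finset.mem_insert_self k J')
    obtain ⟨η, hη, h0, h1, hp⟩ := ih hJ' (fun j hj => hs j (Finset.mem_insert_of_mem hj)) (δ / 2)
      (by positivity) (by linarith)
    have hkk := hs k (Finset.mem_insert_self k J')
    rw [← h0, ← h1] at hkk
    obtain ⟨η₁, l1, a1, b1, p1, q1⟩ := H.cut hJ' hk hkJ' hη
      (LipOn.mem_ball hr hA hB (by linarith) h0 hη) (by rw [h0]; exact hp) hkk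
    rw [h0] at a1; rw [h1] at b1; rw [h0] at p1 q1; rw [h0, h1] at hkk
    obtain ⟨η₂, l2, a2, b2, p2⟩ := H.push_off hJ' hk (half_pos hδ) l1
      (LipOn.mem_ball hr hA hB (by linarith) a1 l1) (by rw [a1]; exact p1)
      (by rw [a1]; intro h; simp [h] at hkk) (by rw [a1, b1, mul_comm]; exact hkk)
      (by rw [a1]; exact q1)
    refine ⟨η₂, l2.of_le (by linarith), a2.trans a1, b2.trans b1, ?_⟩
    rw [a1] at p2; exact p2

end TorusMetric

lemma eventually_radius {P : ℝ → Prop} (h : ∀ᶠ x in 𝓝 0, P x) :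
    ∀ᶠ ε in 𝓝[>] (0 : ℝ), ∀ x, |x| < ε → P x := by
  obtain ⟨ε, hε, hP⟩ := Metric.eventually_nhds_iff.1 h
  filter_upwards [Ioo_mem_nhdsGT hε] with e he x hx
  exact hP (by simpa using hx.trans he.2)

lemma eventually_radius' {P : ℝ → Prop} (h : ∀ᶠ x in 𝓝[≠] 0, P x) :
    ∀ᶠ ε in 𝓝[>] (0 : ℝ), ∀ x, x ≠ 0 → |x| < ε → P x := by
  filter_upwards [eventually_radius (eventually_nhdsWithin_iff.1 h)] with e he x hx0 hx
  exact he x hx hx0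

lemma mul_pos_of_preconnected {C : Set (ℝ × ℝ)} (hC : IsPreconnected C) {f : ℝ × ℝ → ℝ}
    (hf : ContinuousOn f C) (h0 : ∀ z ∈ C, f z ≠ 0) {A B : ℝ × ℝ} (hA : A ∈ C) (hB : B ∈ C) :
    0 < f A * f B := by
  by_contra hcon
  have hpre := hC.image f hf
  have : (0 : ℝ) ∈ f '' C := by
    refine hpre.ordConnected.uIcc_subset ⟨A, hA, rfl⟩ ⟨B, hB, rfl⟩ ?_
    rw [mem_uIcc]
    rcases le_total 0 (f A) with h | h
    · right; refine ⟨?_, h⟩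
      have : 0 < f A := lt_of_le_of_ne h (Ne.symm (h0 A hA))
      by_contra h'; exact hcon (mul_pos this (not_le.1 h'))
    · left; refine ⟨h, ?_⟩
      have : f A < 0 := lt_of_le_of_ne h (h0 A hA)
      by_contra h'; exact hcon (mul_pos_of_neg_of_neg this (not_le.1 h'))
  obtain ⟨z, hz, hz0⟩ := this
  exact h0 z hz hz0

namespace TorusMetric

variable {M : TorusMetric} {c : ℝ → ℝ × ℝ}

/-- Near `p`, the set `K` consists of finitely many pairwise transverse branches of `c`; each of
them either passes through `p` or starts at `p`, and in the latter case there is another branch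
passing through `p`. -/
structure Star (c : ℝ → ℝ × ℝ) (K : Set (ℝ × ℝ)) (p : ℝ × ℝ) (S : Finset ℝ) (I : ℝ → Set ℝ) :
    Prop where
  base : ∀ s ∈ S, c s = p
  transverse : ∀ s ∈ S, ∀ t ∈ S, s ≠ t → crossDet (deriv c s) (deriv c t) ≠ 0
  cover : ∀ ε > 0, ∀ᶠ z in 𝓝 p, z ∈ K → ∃ s ∈ S, ∃ x ∈ I s, |x| < ε ∧ z = c (s + x)
  mem : ∀ s ∈ S, ∀ x ∈ I s, c (s + x) ∈ K
  arm : ∀ s ∈ S, (∀ᶠ x in 𝓝 0, x ∈ I s) ∨ ∃ σ : ℝ, (∀ x ∈ I s, 0 ≤ σ * x) ∧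
    (∀ᶠ x in 𝓝 0, 0 ≤ σ * x → x ∈ I s) ∧ ∃ f ∈ S, f ≠ s ∧ ∀ᶠ x in 𝓝 0, x ∈ I f

/-- Every branch family through a point has charts of arbitrarily small size. -/
lemma IsGeodesic.exists_charts (hc : M.IsGeodesic c) {p : ℝ × ℝ} {S : Finset ℝ}
    (hb : ∀ s ∈ S, c s = p)
    (ht : ∀ s ∈ S, ∀ t ∈ S, s ≠ t → crossDet (deriv c s) (deriv c t) ≠ 0) :
    ∃ F n, ∀ᶠ ε in 𝓝[>] (0 : ℝ), ∀ᶠ R in 𝓝[>] (0 : ℝ), M.Charts c p S F n R ε := by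
  have h := fun (s : ℝ) (hs : s ∈ S) => hc.exists_chart (hb s hs)
  choose! F n h1 h2 h3 h4 h5 using h
  refine ⟨F, n, ?_⟩
  have e3 : ∀ᶠ ε in 𝓝[>] (0 : ℝ), ∀ s ∈ S, ∀ x, |x| < ε → F s (c (s + x)) = 0 :=
    (eventually_all_finset S).2 fun s hs => eventually_radius (h3 s hs)
  have e5 : ∀ᶠ ε in 𝓝[>] (0 : ℝ), ∀ j ∈ S, ∀ k ∈ S, j ≠ k → ∃ D : ℝ, D ≠ 0 ∧
      ∀ x, x ≠ 0 → |x| < ε → 0 < F j (c (k + x)) * (D * x) := by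
    refine (eventually_all_finset S).2 fun j hj => (eventually_all_finset S).2 fun k hk => ?_
    by_cases hjk : j = k
    · exact Eventually.of_forall fun _ h => absurd hjk h
    · filter_upwards [eventually_radius' (h5 j hj k (hb k hk) (ht j hj k hk hjk))] with ε hε _
      exact ⟨_, ht j hj k hk hjk, hε⟩
  have e6 : ∀ᶠ ε in 𝓝[>] (0 : ℝ), ∀ s ∈ S, ∀ x y, |x| < ε → |y| < ε →
      M.dist (c (s + x)) (c (s + y)) = |x - y| := by
    refine (eventually_all_finset S).2 fun s _ => ?_
    obtain ⟨ε, hε, hi⟩ := hc.locIso s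
    filter_upwards [Ioo_mem_nhdsGT hε] with e he x y hx hy
    rw [abs_lt] at hx hy
    rcases le_total x y with h | h
    · rw [hi _ _ (by linarith [he.2]) (by linarith) (by linarith [he.2]), abs_sub_comm,
        abs_of_nonneg (by linarith)]; ring
    · rw [dist_comm, hi _ _ (by linarith [he.2]) (by linarith) (by linarith [he.2]),
        abs_of_nonneg (by linarith)]; ring
  filter_upwards [e3, e5, e6, self_mem_nhdsWithin] with ε a3 a5 a6 hε
  have h24 : ∀ᶠ z in 𝓝 p, ∀ s ∈ S, ContinuousAt (F s) z ∧
      (F s z = 0 → ∃ x, |x| < ε ∧ z = c (s + x)) :=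
    (eventually_all_finset S).2 fun s hs => (h2 s hs).and (h4 s hs ε hε)
  obtain ⟨R₀, hR₀, hR⟩ := Metric.eventually_nhds_iff_ball.1 h24
  filter_upwards [Ioo_mem_nhdsGT hR₀] with R hRR
  have hsub : Metric.ball p R ⊆ Metric.ball p R₀ := Metric.ball_subset_ball hRR.2.le
  exact ⟨hε, hb, h1, fun k hk z hz => (hR z (hsub hz) k hk).1.continuousWithinAt, a3,
    fun k hk z hz => (hR z (hsub hz) k hk).2, a5, a6⟩

/-- Local convexity of the complement of a star. -/
lemma Star.exists_path (hc : M.IsGeodesic c) {K : Set (ℝ × ℝ)} {p : ℝ × ℝ} {S : Finset ℝ}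
    {I : ℝ → Set ℝ} (St : Star c K p S I) : ∃ r > 0, ∀ C ⊆ Metric.ball p r \ K,
      IsPreconnected C → ∀ A ∈ C, ∀ B ∈ C, ∀ δ > 0, ∃ η : ℝ → ℝ × ℝ,
      M.LipOn (M.dist A B + δ) η (Icc 0 1) ∧ η 0 = A ∧ η 1 = B ∧ ∀ t ∈ Icc (0 : ℝ) 1, η t ∉ K := by
  obtain ⟨F, n, hch⟩ := hc.exists_charts St.base St.transverse
  have harm : ∀ᶠ ε in 𝓝[>] (0 : ℝ), ∀ s ∈ S, (∀ x, |x| < ε → x ∈ I s) ∨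
      ∃ σ : ℝ, (∀ x ∈ I s, 0 ≤ σ * x) ∧ (∀ x, |x| < ε → 0 ≤ σ * x → x ∈ I s) ∧
        ∃ f ∈ S, f ≠ s ∧ ∀ x, |x| < ε → x ∈ I f := by
    refine (eventually_all_finset S).2 fun s hs => ?_
    rcases St.arm s hs with h | ⟨σ, h1, h2, f, hf, hfs, h3⟩
    · filter_upwards [eventually_radius h] with ε hε; exact Or.inl hε
    · filter_upwards [eventually_radius h2, eventually_radius h3] with ε hε hε'
      exact Or.inr ⟨σ, h1, hε, f, hf, hfs, hε'⟩
  have hpos : ∀ᶠ ε in 𝓝[>] (0 : ℝ), 0 < ε := self_mem_nhdsWithin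
  obtain ⟨ε, hε, hR, harm⟩ := (hpos.and (hch.and harm)).exists
  obtain ⟨R₀, hR₀, hcov⟩ := Metric.eventually_nhds_iff_ball.1 (St.cover ε hε)
  obtain ⟨R, H, hRp, hRR⟩ := (hR.and (Ioo_mem_nhdsGT hR₀)).exists
  have hlo := M.lo_pos
  have hhi := M.hi_pos
  set q : ℝ := 1 + (2 * M.hi + 1) / M.lo with hq
  have hq1 : 1 ≤ q := by
    have : 0 ≤ (2 * M.hi + 1) / M.lo := by positivity
    linarith
  have hr : R / q + (2 * (R / q) * M.hi + R / q) / M.lo ≤ R := by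
    have : R / q + (2 * (R / q) * M.hi + R / q) / M.lo = R / q * q := by rw [hq]; ring
    rw [this, div_mul_cancel₀ _ (by linarith)]
  have hrR : R / q ≤ R := div_le_self hRp.le hq1
  have hrp : 0 < R / q := by positivity
  refine ⟨R / q, hrp, fun C hCK hC A hA B hB δ hδ => ?_⟩
  have hCb : C ⊆ Metric.ball p R := fun z hz => Metric.ball_subset_ball hrR (hCK hz).1
  have hFC : ∀ s ∈ S, ContinuousOn (F s) C := fun s hs => (H.cont s hs).mono hCb
  -- a branch whose zeros near `p` are avoided by `C` separates nothing
  have hfull : ∀ s ∈ S, (∀ x, |x| < ε → x ∈ I s) → ∀ z ∈ C, ∀ z' ∈ C, 0 < F s z * F s z' := by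
    intro s hs hI z hz z' hz'
    refine mul_pos_of_preconnected hC (hFC s hs) (fun w hw h0 => ?_) hz hz'
    obtain ⟨x, hx, rfl⟩ := H.of_zero s hs w (hCb hw) h0
    exact (hCK hw).2 (St.mem s hs x (hI x hx))
  have hzero : ∀ s ∈ S, ∀ f ∈ S, F f (c (s + 0)) = 0 := fun s hs f hf => by
    have := H.zero f hf 0 (by simpa using H.pos)
    rwa [add_zero, H.base f hf, ← H.base s hs, ← add_zero s] at this
  set J' := S.filter fun s => 0 < F s A * F s B with hJ'
  obtain ⟨η, hη, h0, h1, hp⟩ := H.exists_path hr (hCK hA).1 (hCK hB).1 J' (Finset.filter_subset _ _)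
    (fun j hj => (Finset.mem_filter.1 hj).2) (min δ (R / q)) (lt_min hδ hrp) (min_le_right _ _)
  refine ⟨η, hη.of_le (by linarith [min_le_left δ (R / q)]), h0, h1, fun t ht hK => ?_⟩
  have hball := LipOn.mem_ball hr (hCK hA).1 (hCK hB).1 (min_le_right _ _) h0 hη t ht
  obtain ⟨s, hs, x, hxI, hx, hz⟩ := hcov _ (Metric.ball_subset_ball hRR.le hball) hK
  have hFs : F s (η t) = 0 := by rw [hz]; exact H.zero s hs x hx
  have hsJ : s ∉ J' := fun h => by simpa [hFs] using hp s h t ht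
  rcases harm s hs with hI | ⟨σ, hσ, hI, f, hf, hfs, hIf⟩
  · exact hsJ (Finset.mem_filter.2 ⟨hs, hfull s hs hI A hA B hB⟩)
  have hfJ : f ∈ J' := Finset.mem_filter.2 ⟨hf, hfull f hf hIf A hA B hB⟩
  obtain ⟨D, hD, hDx⟩ := H.sign f hf s hs hfs
  have hFη := hp f hfJ t ht
  have hx0 : x ≠ 0 := fun h => by
    rw [hz, h, hzero s hs f hf] at hFη; simp at hFη
  have hpos : 0 < F f (η t) * (D * x) := by rw [hz]; exact hDx x hx0 hx
  have hσx := hσ x hxI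
  have sgn : ∀ a b d : ℝ, 0 < a * b → 0 < a * d → 0 < b * d := fun a b d h1 h2 => by
    have h3 : 0 < (a * a) * (b * d) := by nlinarith [mul_pos h1 h2]
    by_contra hcon
    nlinarith [mul_self_nonneg a]
  have hAD : 0 < F f A * (D * x) := sgn _ _ _ hFη hpos
  refine hsJ (Finset.mem_filter.2 ⟨hs, mul_pos_of_preconnected hC (hFC s hs) (fun w hw h0 => ?_)
    hA hB⟩)
  obtain ⟨y, hy, rfl⟩ := H.of_zero s hs w (hCb hw) h0
  have hwA := hfull f hf hIf A hA _ hw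
  have hy0 : y ≠ 0 := fun h => by rw [h, hzero s hs f hf] at hwA; simp at hwA
  have h1 := hDx y hy0 hy
  have h2 : 0 < (D * x) * (D * y) := sgn _ _ _ hAD (sgn _ _ _ (by linarith) h1)
  have h3 : 0 < x * y := by
    have : 0 < (D * D) * (x * y) := by linarith
    exact pos_of_mul_pos_right this (mul_self_nonneg D)
  refine (hCK hw).2 (St.mem s hs y (hI y hy ?_))
  by_contra hcon
  nlinarith [mul_self_nonneg x, mul_pos h3 h3, mul_self_pos.2 hx0, mul_self_pos.2 hy0]

end TorusMetric

lemma eventually_near_preimage {c : ℝ → ℝ × ℝ} (hc : Continuous c) (a b : ℝ) (p : ℝ × ℝ) {ε : ℝ}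
    (hε : 0 < ε) : ∀ᶠ z in 𝓝 p, ∀ t ∈ Icc a b, c t = z →
      ∃ s ∈ Icc a b, c s = p ∧ |t - s| < ε := by
  set E : Set ℝ := Icc a b \ ⋃ s ∈ {s | s ∈ Icc a b ∧ c s = p}, Metric.ball s ε with hE
  have hEc : IsCompact E := isCompact_Icc.diff (isOpen_biUnion fun _ _ => Metric.isOpen_ball)
  have hcl : IsClosed (c '' E) := (hEc.image hc).isClosed
  have hp : p ∉ c '' E := by
    rintro ⟨t, ⟨ht, hn⟩, hct⟩
    exact hn (mem_biUnion (show t ∈ {s | s ∈ Icc a b ∧ c s = p} from ⟨ht, hct⟩)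
      (Metric.mem_ball_self hε))
  filter_upwards [hcl.isOpen_compl.mem_nhds hp] with z hz t ht hct
  by_contra hcon
  push Not at hcon
  refine hz ⟨t, ⟨ht, fun hm => ?_⟩, hct⟩
  obtain ⟨s, hs, hts⟩ := mem_iUnion₂.1 hm
  exact absurd (by simpa [Real.dist_eq] using hts) (not_lt.2 (hcon s hs.1 hs.2))

namespace TorusMetric

variable {M : TorusMetric} {c : ℝ → ℝ × ℝ}

lemma LocIso.finite_preimage (h : M.LocIso c) (a b : ℝ) (p : ℝ × ℝ) :
    {s | s ∈ Icc a b ∧ c s = p}.Finite := by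
  by_contra hinf
  obtain ⟨t, _, ht⟩ := (Set.not_finite.1 hinf : _).exists_accPt_of_subset_isCompact
    isCompact_Icc (fun s hs => hs.1)
  obtain ⟨ε, hε, hiso⟩ := h t
  have inj : ∀ s s', |s - t| < ε → |s' - t| < ε → c s = p → c s' = p → s = s' := by
    intro s s' hs hs' e e'
    rw [abs_lt] at hs hs'
    rcases le_total s s' with hl | hl
    · have := hiso s s' (by linarith) hl (by linarith)
      rw [e, e', dist_self] at this; linarith
    · have := hiso s' s (by linarith) hl (by linarith)
      rw [e, e', dist_self] at this; linarith
  rw [accPt_iff_nhds] at ht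
  obtain ⟨s, ⟨hs1, hs2⟩, hst⟩ := ht _ (Metric.ball_mem_nhds t hε)
  obtain ⟨s', ⟨hs1', hs2'⟩, hst'⟩ := ht _ (Metric.ball_mem_nhds t (abs_pos.2 (sub_ne_zero.2 hst)))
  rw [Metric.mem_ball, Real.dist_eq] at hs1 hs1'
  have := inj s s' hs1 (hs1'.trans hs1) hs2.2 hs2'.2
  rw [this] at hs1'; exact lt_irrefl _ hs1'

lemma IsGeodesic.exists_star_of_transverse (hc : M.IsGeodesic c)
    (htr : ∀ s s', c s = c s' → s ≠ s' → crossDet (deriv c s) (deriv c s') ≠ 0)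
    {t₁ t₂ t₃ t₄ : ℝ} (h12 : t₁ < t₂) (h23 : t₂ < t₃) (h34 : t₃ < t₄)
    (e1 : c t₁ = c t₂) (e2 : c t₃ = c t₄) (p : ℝ × ℝ) :
    ∃ S I, Star c (c '' Icc t₁ t₄) p S I := by
  have hfin := hc.locIso.finite_preimage t₁ t₄ p
  have hm : ∀ s, s ∈ hfin.toFinset ↔ s ∈ Icc t₁ t₄ ∧ c s = p := fun s => by simp
  refine ⟨hfin.toFinset, fun s => {x | s + x ∈ Icc t₁ t₄}, ?_, ?_, ?_, ?_, ?_⟩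
  · exact fun s hs => ((hm s).1 hs).2
  · intro s hs t ht hst
    exact htr s t (((hm s).1 hs).2.trans ((hm t).1 ht).2.symm) hst
  · intro ε hε
    filter_upwards [eventually_near_preimage hc.1.continuous t₁ t₄ p hε] with z hz
    rintro ⟨t, ht, rfl⟩
    obtain ⟨s, hs, hsp, hts⟩ := hz t ht rfl
    exact ⟨s, (hm s).2 ⟨hs, hsp⟩, t - s, by simpa using ht, hts, by simp⟩
  · exact fun s _ x hx => ⟨s + x, hx, rfl⟩
  · intro s hs
    obtain ⟨hsI, hsp⟩ := (hm s).1 hs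
    have hIn : ∀ s, t₁ < s → s < t₄ → ∀ᶠ x in 𝓝 (0 : ℝ), x ∈ {x | s + x ∈ Icc t₁ t₄} := by
      intro s h1 h2
      have : Tendsto (fun x => s + x) (𝓝 0) (𝓝 s) := by
        have h : Continuous fun x : ℝ => s + x := by fun_prop
        simpa using h.tendsto 0
      exact this.eventually (Icc_mem_nhds h1 h2)
    rcases hsI.1.eq_or_lt with rfl | h1
    · refine Or.inr ⟨1, fun x hx => ?_, ?_, t₂, (hm _).2 ⟨⟨h12.le, by linarith⟩, ?_⟩, h12.ne',
        hIn t₂ h12 (by linarith)⟩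
      · have := hx.1; linarith
      · filter_upwards [gt_mem_nhds (show (0 : ℝ) < t₄ - t₁ by linarith)] with x hx h0
        exact ⟨by linarith, by linarith⟩
      · rw [← e1, hsp]
    rcases hsI.2.eq_or_lt with rfl | h2
    · refine Or.inr ⟨-1, fun x hx => ?_, ?_, t₃, (hm _).2 ⟨⟨by linarith, h34.le⟩, ?_⟩, h34.ne,
        hIn t₃ (by linarith) h34⟩
      · have := hx.2; linarith
      · filter_upwards [lt_mem_nhds (show t₁ - s < (0 : ℝ) by linarith)] with x hx h0
        exact ⟨by linarith, by linarith⟩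
      · rw [e2, hsp]
    exact Or.inl (hIn s h1 h2)

lemma IsGeodesic.exists_star_of_periodic (hc : M.IsGeodesic c) {ℓ : ℝ} (hℓ : 0 < ℓ)
    (hper : Function.Periodic c ℓ) (p : ℝ × ℝ) :
    ∃ S I, Star c (c '' Icc 0 ℓ) p S I := by
  have hfin := hc.locIso.finite_preimage 0 ℓ p
  obtain ⟨S, hS, hbij⟩ := Set.exists_subset_bijOn {s | s ∈ Icc 0 ℓ ∧ c s = p}
    (fun s x => c (s + x))
  have hSf := hfin.subset hS
  have hm : ∀ s, s ∈ hSf.toFinset ↔ s ∈ S := fun s => by simp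
  have hb : ∀ s ∈ S, c s = p := fun s hs => (hS hs).2
  refine ⟨hSf.toFinset, fun _ => univ, ?_, ?_, ?_, ?_, ?_⟩
  · exact fun s hs => hb s ((hm s).1 hs)
  · intro s hs t ht hst
    have hs := (hm s).1 hs
    have ht := (hm t).1 ht
    refine (hc.periodic_or_transverse ((hb s hs).trans (hb t ht).symm)).resolve_left fun h => ?_
    exact hst (hbij.injOn hs ht (funext h))
  · intro ε hε
    filter_upwards [eventually_near_preimage hc.1.continuous 0 ℓ p hε] with z hz
    rintro ⟨t, ht, rfl⟩
    obtain ⟨s, hs, hsp, hts⟩ := hz t ht rfl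
    obtain ⟨s', hs', he⟩ := hbij.surjOn ⟨s, ⟨hs, hsp⟩, rfl⟩
    refine ⟨s', (hm s').2 hs', t - s, mem_univ _, hts, ?_⟩
    have := congrFun he (t - s)
    simp only at this
    rw [this]; simp
  · intro s _ x _
    obtain ⟨y, hy, hxy⟩ := hper.exists_mem_Ico₀ hℓ (s + x)
    exact ⟨y, ⟨hy.1, hy.2.le⟩, hxy.symm⟩
  · exact fun s _ => Or.inl (Eventually.of_forall fun x => mem_univ x)

/-- A geodesic arc containing the given loop, whose complement is locally convex. -/
lemma IsGeodesic.exists_stars (hc : M.IsGeodesic c)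
    {t₁ t₂ t₃ t₄ : ℝ} (h12 : t₁ < t₂) (h23 : t₂ < t₃) (h34 : t₃ < t₄)
    (e1 : c t₁ = c t₂) (e2 : c t₃ = c t₄) :
    ∃ a b, c '' Icc t₁ t₂ ⊆ c '' Icc a b ∧ ∀ p, ∃ S I, Star c (c '' Icc a b) p S I := by
  by_cases h : ∃ s s', s < s' ∧ ∀ x, c (s + x) = c (s' + x)
  · obtain ⟨s, s', hss, h⟩ := h
    have hper : Function.Periodic c (s' - s) := fun x => by
      have := h (x - s)
      rw [add_sub_cancel] at this
      rw [this]; congr 1; ring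
    refine ⟨0, s' - s, ?_, hc.exists_star_of_periodic (sub_pos.2 hss) hper⟩
    rintro _ ⟨t, _, rfl⟩
    obtain ⟨y, hy, hxy⟩ := hper.exists_mem_Ico₀ (sub_pos.2 hss) t
    exact ⟨y, ⟨hy.1, hy.2.le⟩, hxy.symm⟩
  · push Not at h
    refine ⟨t₁, t₄, image_mono (Icc_subset_Icc le_rfl (by linarith)),
      hc.exists_star_of_transverse (fun s s' hss hne => ?_) h12 h23 h34 e1 e2⟩
    refine (hc.periodic_or_transverse hss).resolve_left fun hp => ?_
    rcases lt_or_gt_of_ne hne with hl | hl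
    · obtain ⟨x, hx⟩ := h s s' hl; exact hx (hp x)
    · obtain ⟨x, hx⟩ := h s' s hl; exact hx (hp x).symm

end TorusMetric

/-- `2πi` times the winding number of the closed curve `C` restricted to `[α, β]`. -/
def windInt (C : ℝ → ℂ) (α β : ℝ) (w : ℂ) : ℂ := ∫ t in α..β, deriv C t / (C t - w)

lemma windInt_eq_proj {C : ℝ → ℂ} {α β : ℝ} (hαβ : α ≤ β) (w : ℂ) : windInt C α β w =
    ∫ t in α..β, deriv C (projIcc α β hαβ t) / (C (projIcc α β hαβ t) - w) := by
  refine intervalIntegral.integral_congr fun t ht => ?_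
  rw [uIcc_of_le hαβ] at ht
  simp only [projIcc_of_mem hαβ ht]

lemma windInt_eq_int {C : ℝ → ℂ} (hC : ContDiff ℝ 1 C) {α β : ℝ} (hαβ : α ≤ β)
    (hcl : C α = C β) {w : ℂ} (hw : ∀ t ∈ Icc α β, C t ≠ w) :
    ∃ n : ℤ, windInt C α β w = n * (2 * Real.pi * Complex.I) := by
  set G : ℝ → ℂ := fun t => deriv C (projIcc α β hαβ t) / (C (projIcc α β hαβ t) - w) with hG
  have hpc : Continuous fun t => (projIcc α β hαβ t : ℝ) :=
    continuous_subtype_val.comp continuous_projIcc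
  have hGc : Continuous G := by
    refine ((hC.continuous_deriv le_rfl).comp hpc).div ((hC.continuous.comp hpc).sub
      continuous_const) fun t => sub_ne_zero.2 (hw _ (projIcc α β hαβ t).2)
  have hfd : ∀ t, HasDerivAt (fun t => ∫ s in α..t, G s) (G t) t := fun t =>
    intervalIntegral.integral_hasDerivAt_right (hGc.intervalIntegrable _ _)
      (hGc.stronglyMeasurableAtFilter _ _) hGc.continuousAt
  have hCd : ∀ t, HasDerivAt C (deriv C t) t := fun t =>
    (hC.differentiable one_ne_zero t).hasDerivAt
  have hgd : ∀ t ∈ Icc α β, HasDerivAt (fun t => (C t - w) * Complex.exp (-∫ s in α..t, G s)) 0 t := by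
    intro t ht
    have h1 := ((hCd t).sub_const w).mul (hfd t).neg.cexp
    refine h1.congr_deriv ?_
    have h2 : G t = deriv C t / (C t - w) := by simp only [hG, projIcc_of_mem hαβ ht]
    have h3 := sub_ne_zero.2 (hw t ht)
    rw [h2]; field_simp; ring
  have hconst := constant_of_has_deriv_right_zero
    (fun t ht => (hgd t ht).continuousAt.continuousWithinAt)
    (fun t ht => (hgd t (Ico_subset_Icc_self ht)).hasDerivWithinAt) β ⟨hαβ, le_rfl⟩
  simp only [intervalIntegral.integral_same, neg_zero, Complex.exp_zero, mul_one] at hconst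
  rw [hcl] at hconst
  have h1 : Complex.exp (-∫ s in α..β, G s) = 1 :=
    mul_left_cancel₀ (sub_ne_zero.2 (hw β ⟨hαβ, le_rfl⟩)) (by rw [hconst, mul_one])
  obtain ⟨n, hn⟩ := Complex.exp_eq_one_iff.1 h1
  refine ⟨-n, ?_⟩
  rw [windInt_eq_proj hαβ]
  rw [Int.cast_neg, neg_mul, ← hn, neg_neg]

lemma windInt_const {C : ℝ → ℂ} (hC : ContDiff ℝ 1 C) {α β : ℝ} (hαβ : α ≤ β)
    (hcl : C α = C β) {σ : ℝ → ℂ} (hσ : Continuous σ) (hw : ∀ s, ∀ t ∈ Icc α β, C t ≠ σ s)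
    (x y : ℝ) : windInt C α β (σ x) = windInt C α β (σ y) := by
  choose n hn using fun s => windInt_eq_int hC hαβ hcl (hw s)
  have hpc : Continuous fun t => (projIcc α β hαβ t : ℝ) :=
    continuous_subtype_val.comp continuous_projIcc
  have hcont : Continuous fun s => windInt C α β (σ s) := by
    simp only [windInt_eq_proj hαβ]
    refine intervalIntegral.continuous_parametric_intervalIntegral_of_continuous' ?_ _ _
    refine (((hC.continuous_deriv le_rfl).comp hpc).comp continuous_snd).div
      (((hC.continuous.comp hpc).comp continuous_snd).sub (hσ.comp continuous_fst))
      fun p => sub_ne_zero.2 (hw _ _ (projIcc α β hαβ p.2).2)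
  have hni : Continuous n := by
    rw [Int.isClosedEmbedding_coe_real.isInducing.continuous_iff]
    have : ((fun k : ℤ => (k : ℝ)) ∘ n) = fun s => (windInt C α β (σ s)).im / (2 * Real.pi) := by
      funext s
      have hpi := Real.pi_pos
      rw [hn s]
      simp
    rw [this]
    exact (Complex.continuous_im.comp hcont).div_const _
  rw [hn x, hn y, PreconnectedSpace.constant inferInstance hni]

lemma re_div_lower {v W : ℂ} {A : ℝ} (hA : 0 < A) (hv : ‖v - 1‖ ≤ 1 / 16)
    (hW : ‖W - A‖ ≤ 3 / 16 * A) : 1 / (2 * A) ≤ (v / W).re ∧ W ≠ 0 := by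
  set a := (v - 1).re with ha
  set b := (v - 1).im with hb
  set d := (W - A).re with hd
  set e := (W - A).im with he
  have h1 := (abs_le.1 ((Complex.abs_re_le_norm (v - 1)).trans hv))
  have h2 := (abs_le.1 ((Complex.abs_im_le_norm (v - 1)).trans hv))
  have h3 := (abs_le.1 ((Complex.abs_re_le_norm (W - A)).trans hW))
  have h4 := (abs_le.1 ((Complex.abs_im_le_norm (W - A)).trans hW))
  have hvr : v.re = 1 + a := by simp [ha]
  have hvi : v.im = b := by simp [hb]
  have hWr : W.re = A + d := by simp [hd]
  have hWi : W.im = e := by simp [he]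
  have hWr0 : 0 < W.re := by rw [hWr]; linarith [h3.1]
  have hn : Complex.normSq W = (A + d) ^ 2 + e ^ 2 := by
    rw [Complex.normSq_apply, hWr, hWi]; ring
  have hnp : 0 < (A + d) ^ 2 + e ^ 2 := by rw [← hWr]; positivity
  have hnle : (A + d) ^ 2 + e ^ 2 ≤ (19 / 16 * A) ^ 2 + (3 / 16 * A) ^ 2 := by
    gcongr ?_ + ?_
    · exact pow_le_pow_left₀ (by linarith [h3.1]) (by linarith [h3.2]) 2
    · exact sq_le_sq' (by linarith [h4.1]) h4.2
  refine ⟨?_, fun h => by rw [h] at hWr0; simp at hWr0⟩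
  have hbe : -(1 / 16 * (3 / 16 * A)) ≤ b * e := by
    have := abs_mul b e
    have h5 : |b| * |e| ≤ 1 / 16 * (3 / 16 * A) := by
      gcongr
      · exact abs_le.2 h2
      · exact abs_le.2 h4
    rw [← this] at h5; exact (abs_le.1 h5).1
  have hmain : 15 / 16 * (13 / 16 * A) - 1 / 16 * (3 / 16 * A) ≤ (1 + a) * (A + d) + b * e := by
    have : 15 / 16 * (13 / 16 * A) ≤ (1 + a) * (A + d) := by
      gcongr
      · linarith [h1.1]
      · linarith [h1.1]
      · linarith [h3.1]
    linarith
  rw [Complex.div_re, hn, hvr, hvi, hWr, hWi, ← add_div, div_le_div_iff₀ (by positivity) hnp]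
  nlinarith

lemma exists_windInt_ne_zero {C : ℝ → ℂ} (hC : ContDiff ℝ 1 C) {α β s₀ : ℝ} (h1 : α < s₀)
    (h2 : s₀ < β) (hT : deriv C s₀ ≠ 0) (hinj : ∀ t ∈ Icc α β, C t = C s₀ → t = s₀) :
    ∃ w, (∀ t ∈ Icc α β, C t ≠ w) ∧ windInt C α β w ≠ 0 := by
  have hαβ : α ≤ β := (h1.trans h2).le
  set T := deriv C s₀ with hTd
  set u : ℝ → ℂ := fun t => (C t - C s₀) / T with hu
  set v : ℝ → ℂ := fun t => deriv C t / T with hv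
  have huc : Continuous u := (hC.continuous.sub continuous_const).div_const _
  have hvc : Continuous v := (hC.continuous_deriv le_rfl).div_const _
  have hud : HasDerivAt u 1 s₀ := by
    have := (((hC.differentiable one_ne_zero s₀).hasDerivAt).sub_const (C s₀)).div_const T
    rwa [div_self hT] at this
  have hus : u s₀ = 0 := by simp [hu]
  have hvs : v s₀ = 1 := by simp [hv, ← hTd, hT]
  -- the near region
  have hnear : ∀ᶠ t in 𝓝 s₀, ‖v t - 1‖ ≤ 1 / 16 ∧ ‖u t - (t - s₀ : ℝ)‖ ≤ 1 / 16 * |t - s₀| := by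
    have e1 : ∀ᶠ t in 𝓝 s₀, ‖v t - 1‖ < 1 / 16 := by
      have : Tendsto (fun t => ‖v t - 1‖) (𝓝 s₀) (𝓝 0) := by
        have h : Continuous fun t => ‖v t - 1‖ := by fun_prop
        have := h.tendsto s₀
        rwa [hvs, sub_self, norm_zero] at this
      exact this.eventually (gt_mem_nhds (by norm_num))
    have e2 := (hasDerivAt_iff_isLittleO.1 hud).def (show (0 : ℝ) < 1 / 16 by norm_num)
    filter_upwards [e1, e2] with t a b
    refine ⟨a.le, ?_⟩
    rw [hus, sub_zero, Real.norm_eq_abs] at b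
    simpa using b
  obtain ⟨δ, hδ, hδn⟩ := Metric.eventually_nhds_iff_ball.1 hnear
  -- the far region
  have hfar : ∃ d > 0, ∀ t ∈ Icc α β, δ ≤ |t - s₀| → d ≤ ‖u t‖ := by
    set E : Set ℝ := Icc α β \ Metric.ball s₀ δ with hE
    have hEc : IsCompact E := isCompact_Icc.diff Metric.isOpen_ball
    rcases E.eq_empty_or_nonempty with he | he
    · refine ⟨1, one_pos, fun t ht htd => ?_⟩
      have : t ∈ E := ⟨ht, fun h => not_lt.2 htd (by simpa [Real.dist_eq] using h)⟩
      rw [he] at this; exact absurd this (notMem_empty t)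
    · obtain ⟨x, hx, hmin⟩ := hEc.exists_isMinOn he huc.norm.continuousOn
      refine ⟨‖u x‖, norm_pos_iff.2 fun h => ?_, fun t ht htd => hmin ⟨ht, fun h => not_lt.2 htd
        (by simpa [Real.dist_eq] using h)⟩⟩
      have : C x = C s₀ := sub_eq_zero.1 ((div_eq_zero_iff.1 h).resolve_right hT)
      have := hinj x hx.1 this
      exact hx.2 (by rw [this]; exact Metric.mem_ball_self hδ)
  obtain ⟨d, hd, hdu⟩ := hfar
  obtain ⟨V, hV⟩ := isCompact_Icc.exists_bound_of_continuousOn (s := Icc α β) hvc.continuousOn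
  have hV0 : 0 ≤ V := (norm_nonneg _).trans (hV α ⟨le_rfl, hαβ⟩)
  set B := 2 * V / d ^ 2 with hB
  have hB0 : 0 ≤ B := by positivity
  obtain ⟨η, hη, hη1, hη2, hη3, hη4, hη5⟩ : ∃ η : ℝ, 0 < η ∧ η < δ ∧ η < d / 2 ∧ η < s₀ - α ∧
      η < β - s₀ ∧ B * (β - α) < 1 / (2 * η) := by
    have hpos : ∀ᶠ η in 𝓝[>] (0 : ℝ), 0 < η := self_mem_nhdsWithin
    have hlt : ∀ x : ℝ, 0 < x → ∀ᶠ η in 𝓝[>] (0 : ℝ), η < x := fun x hx =>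
      mem_of_superset (Ioo_mem_nhdsGT hx) fun y hy => hy.2
    have := hpos.and ((hlt δ hδ).and ((hlt (d / 2) (by positivity)).and ((hlt (s₀ - α)
      (by linarith)).and ((hlt (β - s₀) (by linarith)).and (hlt (1 / (2 * (B * (β - α) + 1)))
      (by have : 0 ≤ B * (β - α) := mul_nonneg hB0 (by linarith)
          positivity))))))
    obtain ⟨η, a, b, c, d, e, f⟩ := this.exists
    refine ⟨η, a, b, c, d, e, ?_⟩
    have h0 : 0 ≤ B * (β - α) := mul_nonneg hB0 (by linarith)
    rw [lt_div_iff₀ (by positivity)] at f ⊢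
    nlinarith
  have hW : ∀ t ∈ Icc α β, u t ^ 2 + (η : ℂ) ^ 2 ≠ 0 ∧ -B ≤ (v t / (u t ^ 2 + (η : ℂ) ^ 2)).re ∧
      (|t - s₀| ≤ η → 1 / (4 * η ^ 2) ≤ (v t / (u t ^ 2 + (η : ℂ) ^ 2)).re) := by
    intro t ht
    rcases lt_or_ge |t - s₀| δ with hlt | hge
    · obtain ⟨a, b⟩ := hδn t (by simpa [Real.dist_eq] using hlt)
      set x : ℝ := t - s₀ with hx
      have hA : 0 < x ^ 2 + η ^ 2 := by positivity
      have hWb : ‖u t ^ 2 + (η : ℂ) ^ 2 - ((x ^ 2 + η ^ 2 : ℝ) : ℂ)‖ ≤ 3 / 16 * (x ^ 2 + η ^ 2) := by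
        have e1 : u t ^ 2 + (η : ℂ) ^ 2 - ((x ^ 2 + η ^ 2 : ℝ) : ℂ) =
            (u t - x) * ((u t - x) + 2 * x) := by push_cast; ring
        rw [e1, norm_mul]
        have e2 : ‖(u t - x) + 2 * x‖ ≤ 1 / 16 * |x| + 2 * |x| := by
          refine (norm_add_le _ _).trans (add_le_add b ?_)
          simp
        calc ‖u t - x‖ * ‖(u t - x) + 2 * x‖ ≤ (1 / 16 * |x|) * (1 / 16 * |x| + 2 * |x|) := by gcongr
          _ = (33 / 256) * |x| ^ 2 := by ring
          _ = (33 / 256) * x ^ 2 := by rw [sq_abs]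
          _ ≤ _ := by nlinarith [sq_nonneg x, sq_nonneg η]
      obtain ⟨c1, c2⟩ := re_div_lower hA a hWb
      refine ⟨c2, le_trans ?_ c1, fun hxη => le_trans ?_ c1⟩
      · have : 0 ≤ 1 / (2 * (x ^ 2 + η ^ 2)) := by positivity
        linarith
      · refine one_div_le_one_div_of_le (by positivity) ?_
        have : x ^ 2 ≤ η ^ 2 := sq_le_sq' (abs_le.1 hxη).1 (abs_le.1 hxη).2
        linarith
    · have hdu' := hdu t ht hge
      have hn : d ^ 2 / 2 ≤ ‖u t ^ 2 + (η : ℂ) ^ 2‖ := by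
        have e1 : ‖u t ^ 2‖ - ‖(η : ℂ) ^ 2‖ ≤ ‖u t ^ 2 + (η : ℂ) ^ 2‖ := by
          have := norm_sub_norm_le (u t ^ 2) (-(η : ℂ) ^ 2)
          rwa [norm_neg, sub_neg_eq_add] at this
        rw [norm_pow, norm_pow, Complex.norm_real, Real.norm_eq_abs, sq_abs] at e1
        have : d ^ 2 ≤ ‖u t‖ ^ 2 := pow_le_pow_left₀ hd.le hdu' 2
        nlinarith
      refine ⟨fun h => ?_, ?_, fun h => absurd hge (not_le.2 (h.trans_lt hη1))⟩
      · rw [h, norm_zero] at hn; nlinarith [sq_pos_of_pos hd]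
      · have e1 : ‖v t / (u t ^ 2 + (η : ℂ) ^ 2)‖ ≤ B := by
          rw [norm_div, hB]
          calc ‖v t‖ / ‖u t ^ 2 + (η : ℂ) ^ 2‖ ≤ V / (d ^ 2 / 2) :=
                div_le_div₀ hV0 (hV t ht) (by positivity) hn
            _ = _ := by field_simp
        exact (abs_le.1 ((Complex.abs_re_le_norm _).trans e1)).1
  have hηC : (η : ℂ) ≠ 0 := by exact_mod_cast hη.ne'
  have hfac : ∀ t, u t ^ 2 + (η : ℂ) ^ 2 = (u t - Complex.I * η) * (u t + Complex.I * η) := by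
    intro t; ring_nf; rw [Complex.I_sq]; ring
  have hne1 : ∀ t ∈ Icc α β, u t - Complex.I * η ≠ 0 := fun t ht h =>
    (hW t ht).1 (by rw [hfac, h, zero_mul])
  have hne2 : ∀ t ∈ Icc α β, u t + Complex.I * η ≠ 0 := fun t ht h =>
    (hW t ht).1 (by rw [hfac, h, mul_zero])
  have hCu : ∀ t, C t = C s₀ + u t * T := fun t => by simp only [hu]; field_simp; ring
  have hw1 : ∀ t ∈ Icc α β, C t ≠ C s₀ + Complex.I * η * T := fun t ht h => by
    rw [hCu t] at h
    exact hne1 t ht (sub_eq_zero.2 (mul_right_cancel₀ hT (add_left_cancel h)))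
  have hw2 : ∀ t ∈ Icc α β, C t ≠ C s₀ - Complex.I * η * T := fun t ht h => by
    rw [hCu t, sub_eq_add_neg, ← neg_mul] at h
    exact hne2 t ht (by rw [mul_right_cancel₀ hT (add_left_cancel h)]; ring)
  by_contra hcon
  push Not at hcon
  have z1 := hcon _ hw1
  have z2 := hcon _ hw2
  have ic : ∀ w, (∀ t ∈ Icc α β, C t ≠ w) →
      IntervalIntegrable (fun t => deriv C t / (C t - w)) MeasureTheory.volume α β := fun w hw => by
    refine ContinuousOn.intervalIntegrable ?_
    rw [uIcc_of_le hαβ]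
    exact (hC.continuous_deriv le_rfl).continuousOn.div
      (hC.continuous.sub continuous_const).continuousOn fun t ht => sub_ne_zero.2 (hw t ht)
  have hsub : ∫ t in α..β, v t / (u t ^ 2 + (η : ℂ) ^ 2) * (2 * Complex.I * η) = 0 := by
    have : windInt C α β (C s₀ + Complex.I * η * T) - windInt C α β (C s₀ - Complex.I * η * T) = 0 := by
      rw [z1, z2, sub_zero]
    rw [windInt, windInt, ← intervalIntegral.integral_sub (ic _ hw1) (ic _ hw2)] at this
    rw [← this]
    refine intervalIntegral.integral_congr fun t ht => ?_
    rw [uIcc_of_le hαβ] at ht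
    have a1 := hne1 t ht
    have a2 := hne2 t ht
    have b1 : C t - (C s₀ + Complex.I * η * T) = (u t - Complex.I * η) * T := by rw [hCu t]; ring
    have b2 : C t - (C s₀ - Complex.I * η * T) = (u t + Complex.I * η) * T := by rw [hCu t]; ring
    have b3 : deriv C t = v t * T := by simp only [hv]; field_simp
    simp only [b1, b2, b3, hfac]
    field_simp
    ring
  rw [intervalIntegral.integral_mul_const] at hsub
  have hsub0 := (mul_eq_zero.1 hsub).resolve_right (by simp [hηC])
  set h : ℝ → ℂ := fun t => v t / (u t ^ 2 + (η : ℂ) ^ 2) with hh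
  have hcont : ContinuousOn h (Icc α β) :=
    hvc.continuousOn.div ((huc.pow 2).add continuous_const).continuousOn fun t ht => (hW t ht).1
  have hre : ContinuousOn (fun t => (h t).re) (Icc α β) := Complex.continuous_re.comp_continuousOn hcont
  have hii : ∀ a b, a ∈ Icc α β → b ∈ Icc α β →
      IntervalIntegrable (fun t => (h t).re) MeasureTheory.volume a b := fun a b ha hb =>
    (hre.mono (uIcc_subset_Icc ha hb)).intervalIntegrable
  have m0 : α ∈ Icc α β := ⟨le_rfl, hαβ⟩
  have m1 : s₀ - η ∈ Icc α β := ⟨by linarith, by linarith⟩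
  have m2 : s₀ + η ∈ Icc α β := ⟨by linarith, by linarith⟩
  have m3 : β ∈ Icc α β := ⟨hαβ, le_rfl⟩
  have hre0 : ∫ t in α..β, (h t).re = 0 := by
    have hI : IntervalIntegrable h MeasureTheory.volume α β := by
      refine ContinuousOn.intervalIntegrable ?_
      rwa [uIcc_of_le hαβ]
    have := Complex.reCLM.intervalIntegral_comp_comm hI
    simp only [Complex.reCLM_apply] at this
    rw [this, hsub0, Complex.zero_re]
  have hlow : ∀ a b k : ℝ, a ∈ Icc α β → b ∈ Icc α β → a ≤ b → (∀ t ∈ Icc a b, k ≤ (h t).re) →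
      (b - a) * k ≤ ∫ t in a..b, (h t).re := by
    intro a b k ha hb hab hk
    have := intervalIntegral.integral_mono_on hab intervalIntegrable_const (hii a b ha hb) hk
    simpa using this
  have i1 := hlow α (s₀ - η) (-B) m0 m1 (by linarith) fun t ht =>
    (hW t ⟨ht.1, by linarith [ht.2]⟩).2.1
  have i2 := hlow (s₀ - η) (s₀ + η) (1 / (4 * η ^ 2)) m1 m2 (by linarith) fun t ht =>
    (hW t ⟨by linarith [ht.1], by linarith [ht.2]⟩).2.2 (abs_le.2 ⟨by linarith [ht.1], by linarith [ht.2]⟩)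
  have i3 := hlow (s₀ + η) β (-B) m2 m3 (by linarith) fun t ht =>
    (hW t ⟨by linarith [ht.1], ht.2⟩).2.1
  have s1 := intervalIntegral.integral_add_adjacent_intervals (hii _ _ m0 m1) (hii _ _ m1 m2)
  have s2 := intervalIntegral.integral_add_adjacent_intervals (hii _ _ m0 m2) (hii _ _ m2 m3)
  have e : (s₀ + η - (s₀ - η)) * (1 / (4 * η ^ 2)) = 1 / (2 * η) := by field_simp; ring
  rw [e] at i2
  nlinarith

lemma windInt_norm {C : ℝ → ℂ} (hC : ContDiff ℝ 1 C) {α β : ℝ} (hαβ : α ≤ β)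
    (hcl : C α = C β) : ∃ R, ∀ w, R < ‖w‖ → windInt C α β w = 0 := by
  obtain ⟨V, hV⟩ := isCompact_Icc.exists_bound_of_continuousOn (s := Icc α β)
    (hC.continuous_deriv le_rfl).continuousOn
  obtain ⟨B, hB⟩ := isCompact_Icc.exists_bound_of_continuousOn (s := Icc α β)
    hC.continuous.continuousOn
  have hV0 : 0 ≤ V := (norm_nonneg _).trans (hV α ⟨le_rfl, hαβ⟩)
  have hP : 0 ≤ V * (β - α) := mul_nonneg hV0 (by linarith)
  refine ⟨B + V * (β - α) + 1, fun w hw => ?_⟩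
  have hd : ∀ t ∈ Icc α β, V * (β - α) + 1 ≤ ‖C t - w‖ := fun t ht => by
    have := norm_sub_norm_le w (C t)
    rw [norm_sub_rev] at this
    linarith [hB t ht]
  obtain ⟨n, hn⟩ := windInt_eq_int hC hαβ hcl (w := w) fun t ht h => by
    have := hd t ht
    rw [h, sub_self, norm_zero] at this; linarith
  have hle : ‖windInt C α β w‖ ≤ V / (V * (β - α) + 1) * |β - α| := by
    refine intervalIntegral.norm_integral_le_of_norm_le_const fun t ht => ?_
    rw [uIoc_of_le hαβ] at ht
    rw [norm_div]
    exact div_le_div₀ hV0 (hV t (Ioc_subset_Icc_self ht)) (by linarith) (hd t (Ioc_subset_Icc_self ht))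
  rw [abs_of_nonneg (by linarith : (0 : ℝ) ≤ β - α), div_mul_eq_mul_div] at hle
  have hlt : ‖windInt C α β w‖ < 1 := hle.trans_lt (by rw [div_lt_one (by linarith)]; linarith)
  have hn0 : n = 0 := by
    by_contra h
    have h1 : (1 : ℝ) ≤ |(n : ℝ)| := by exact_mod_cast Int.one_le_abs h
    rw [hn, norm_mul, norm_mul, norm_mul, Complex.norm_intCast, Complex.norm_I,
      Complex.norm_real, Complex.norm_two, Real.norm_eq_abs, abs_of_pos Real.pi_pos, mul_one] at hlt
    nlinarith [Real.pi_gt_three]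
  rw [hn, hn0]; simp

namespace TorusMetric

variable {M : TorusMetric} {c : ℝ → ℝ × ℝ}

/-- A closed arc of a geodesic contains a simple closed arc. -/
lemma LocIso.exists_simple_loop (h : M.LocIso c) (hcc : Continuous c) {t₁ t₂ : ℝ} (h12 : t₁ < t₂)
    (e : c t₁ = c t₂) : ∃ α β, α < β ∧ t₁ ≤ α ∧ β ≤ t₂ ∧ c α = c β ∧
      ∀ s t, α ≤ s → s < t → t ≤ β → c s = c t → s = α ∧ t = β := by
  choose ε hε hiso using h
  set P : Set (ℝ × ℝ) := (Icc t₁ t₂ ×ˢ Icc t₁ t₂) ∩ {x | x.1 ≤ x.2 ∧ c x.1 = c x.2} with hP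
  set E := P \ ⋃ t, Metric.ball t (ε t) ×ˢ Metric.ball t (ε t) with hE
  have hPc : IsCompact P := (isCompact_Icc.prod isCompact_Icc).inter_right
    ((isClosed_le continuous_fst continuous_snd).inter
      (isClosed_eq (hcc.comp continuous_fst) (hcc.comp continuous_snd)))
  have hEc : IsCompact E := hPc.diff (isOpen_iUnion fun t => Metric.isOpen_ball.prod Metric.isOpen_ball)
  have hEm : ∀ s t, t₁ ≤ s → s < t → t ≤ t₂ → c s = c t → (s, t) ∈ E := by
    intro s t h1 h2 h3 h4
    refine ⟨⟨⟨⟨h1, by linarith⟩, ⟨by linarith, h3⟩⟩, h2.le, h4⟩, fun hm => ?_⟩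
    obtain ⟨r, hr1, hr2⟩ := mem_iUnion.1 hm
    simp only [Metric.mem_ball, Real.dist_eq, abs_lt] at hr1 hr2
    have := hiso r s t (by linarith) h2.le (by linarith)
    rw [h4, dist_self] at this; linarith
  obtain ⟨⟨α, β⟩, hmE, hmin⟩ := hEc.exists_isMinOn ⟨_, hEm t₁ t₂ le_rfl h12 le_rfl e⟩
    (f := fun x : ℝ × ℝ => x.2 - x.1) (by fun_prop)
  obtain ⟨⟨⟨⟨a1, a2⟩, a3, a4⟩, a5, a6⟩, a7⟩ := hmE
  simp only at a1 a2 a3 a4 a5 a6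
  have hlt : α < β := lt_of_le_of_ne a5 fun hab => a7 (mem_iUnion.2 ⟨α,
    ⟨Metric.mem_ball_self (hε α), by simpa [← hab] using hε α⟩⟩)
  refine ⟨α, β, hlt, a1, a4, a6, fun s t h1 h2 h3 h4 => ?_⟩
  have := hmin (hEm s t (a1.trans h1) h2 (h3.trans a4) h4)
  simp only [mem_ofPred_eq] at this
  constructor <;> linarith

/-- A geodesic loop encloses a ball which is disjoint from the geodesic. -/
lemma IsGeodesic.exists_enclosed (hc : M.IsGeodesic c) {t₁ t₂ : ℝ} (h12 : t₁ < t₂)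
    (e : c t₁ = c t₂) : ∃ q R, q ∉ range c ∧ ∃ ρ > 0, ∀ q' ∈ Metric.ball q ρ,
      ∀ σ : ℝ → ℝ × ℝ, Continuous σ → (∀ s, σ s ∉ c '' Icc t₁ t₂) → σ 0 = q' → ∀ s, ‖σ s‖ ≤ R := by
  obtain ⟨α, β, hαβ, ha, hb, hcl, hinj⟩ := hc.locIso.exists_simple_loop hc.1.continuous h12 e
  set E := Complex.equivRealProdCLM.symm with hE
  set C : ℝ → ℂ := fun t => E (c t) with hC
  have hCd : ContDiff ℝ 1 C := E.contDiff.comp (hc.1.of_le (by exact_mod_cast le_top))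
  have hCcl : C α = C β := by simp only [hC, hcl]
  set s₀ := (α + β) / 2 with hs₀
  have hder : deriv C s₀ = E (deriv c s₀) :=
    (E.hasFDerivAt.comp_hasDerivAt s₀ (hc.1.differentiable (by simp) s₀).hasDerivAt).deriv
  have hT : deriv C s₀ ≠ 0 := by
    rw [hder]; exact fun h => hc.deriv_ne_zero s₀ (E.injective (h.trans (map_zero E).symm))
  obtain ⟨w, hw, hw0⟩ := exists_windInt_ne_zero hCd (show α < s₀ by rw [hs₀]; linarith)
    (show s₀ < β by rw [hs₀]; linarith) hT fun t ht htc => by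
      have htc : c t = c s₀ := E.injective htc
      rcases lt_trichotomy t s₀ with h | h | h
      · have := (hinj t s₀ ht.1 h (by rw [hs₀]; linarith) htc).2
        rw [hs₀] at this; linarith
      · exact h
      · have := (hinj s₀ t (by rw [hs₀]; linarith) h ht.2 htc.symm).1
        rw [hs₀] at this; linarith
  obtain ⟨R, hR⟩ := windInt_norm hCd hαβ.le hCcl
  set Γ := c '' Icc α β with hΓ
  have hΓc : IsClosed Γ := (isCompact_Icc.image hc.1.continuous).isClosed
  have hoff : ∀ z, z ∉ Γ → ∀ t ∈ Icc α β, C t ≠ E z := fun z hz t ht h =>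
    hz ⟨t, ht, E.injective h⟩
  have hconst : ∀ σ : ℝ → ℝ × ℝ, Continuous σ → (∀ s, σ s ∉ Γ) → ∀ x y,
      windInt C α β (E (σ x)) = windInt C α β (E (σ y)) := fun σ hσ hs x y =>
    windInt_const hCd hαβ.le hCcl (E.continuous.comp hσ) (fun s t ht => hoff _ (hs s) t ht) x y
  have hball : ∀ z r, Metric.ball z r ⊆ Γᶜ → ∀ z' ∈ Metric.ball z r,
      windInt C α β (E z') = windInt C α β (E z) := by
    intro z r hsub z' hz'
    have hr : 0 < r := Metric.pos_of_mem_ball hz'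
    set σ : ℝ → ℝ × ℝ := fun s => z + (projIcc (0 : ℝ) 1 zero_le_one s : ℝ) • (z' - z) with hσ
    have hσc : Continuous σ := continuous_const.add
      ((continuous_subtype_val.comp continuous_projIcc).smul continuous_const)
    have := hconst σ hσc (fun s => hsub ?_) 1 0
    · simpa [hσ] using this
    · have h1 := (projIcc (0 : ℝ) 1 zero_le_one s).2
      have := (convex_ball z r).add_smul_sub_mem (Metric.mem_ball_self hr) hz' h1
      exact this
  set z₀ := E.symm w with hz₀
  have hEz₀ : E z₀ = w := E.apply_symm_apply w
  have hz₀Γ : z₀ ∉ Γ := by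
    rintro ⟨t, ht, h⟩
    exact hw t ht (by rw [← hEz₀, ← h])
  obtain ⟨r, hr, hrs⟩ := Metric.isOpen_iff.1 hΓc.isOpen_compl z₀ hz₀Γ
  have hdense : Dense (range c)ᶜ := by
    refine ContDiff.dense_compl_range_of_finrank_lt_finrank
      (hc.1.of_le (by exact_mod_cast le_top)) ?_
    simp
  obtain ⟨q, hqr, hqc⟩ := hdense.inter_open_nonempty _ Metric.isOpen_ball
    ⟨z₀, Metric.mem_ball_self hr⟩
  have hq0 : windInt C α β (E q) ≠ 0 := by rw [hball z₀ r hrs q hqr, hEz₀]; exact hw0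
  obtain ⟨ρ, hρ, hρs⟩ := Metric.isOpen_iff.1 hΓc.isOpen_compl q (hrs hqr)
  refine ⟨q, R, hqc, ρ, hρ, fun q' hq' σ hσ hs h0 s => ?_⟩
  by_contra hcon
  push Not at hcon
  have hsΓ : ∀ s, σ s ∉ Γ := fun s hm => hs s (image_mono (Icc_subset_Icc ha hb) hm)
  have h1 := hconst σ hσ hsΓ 0 s
  rw [h0, hball q ρ hρs q' hq', hR (E (σ s))] at h1
  · exact hq0 h1
  · refine hcon.trans_le ?_
    rw [norm_prod_eq]
    have e1 : (σ s).1 = (E (σ s)).re := by simp [hE]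
    have e2 : (σ s).2 = (E (σ s)).im := by simp [hE]
    rw [e1, e2]
    exact max_le (Complex.abs_re_le_norm _) (Complex.abs_im_le_norm _)

end TorusMetric

/-- The complex coordinate of a point of the plane. -/
def toC (v : ℝ × ℝ) : ℂ := ⟨v.1, v.2⟩

lemma continuous_toC : Continuous toC := by
  have : toC = Complex.equivRealProdCLM.symm := by
    funext v; apply Complex.ext <;> simp [toC]
  rw [this]; exact ContinuousLinearEquiv.continuous _

lemma toC_sub (v w : ℝ × ℝ) : toC (v - w) = toC v - toC w := by apply Complex.ext <;> simp [toC]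

lemma norm_le_toC (v : ℝ × ℝ) : ‖v‖ ≤ ‖toC v‖ := by
  rw [norm_prod_eq]
  exact max_le (Complex.abs_re_le_norm (toC v)) (Complex.abs_im_le_norm (toC v))

lemma toC_norm_le (v : ℝ × ℝ) : ‖toC v‖ ≤ 2 * ‖v‖ := by
  have h := Complex.norm_le_abs_re_add_abs_im (toC v)
  have h1 := abs_fst_le v
  have h2 := abs_snd_le v
  have h3 : |(toC v).re| = |v.1| := rfl
  have h4 : |(toC v).im| = |v.2| := rfl
  linarith

/-- The curve `γ`, going from left to right, passes above (`s = 1`) or below (`s = -1`) the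
point `q`, up to homotopy in the complement of `q`. -/
def HasSide (γ : ℝ → ℝ × ℝ) (q : ℝ × ℝ) (s : ℝ) : Prop :=
  ∃ θ : ℝ → ℂ, Continuous θ ∧ (∀ t, Complex.exp (θ t) = toC (γ t - q)) ∧
    Tendsto (fun t => (θ t).im) atTop (𝓝 0) ∧ Tendsto (fun t => (θ t).im) atBot (𝓝 (s * Real.pi))

lemma HasSide.unique {γ : ℝ → ℝ × ℝ} {q : ℝ × ℝ} {s s' : ℝ} (h : HasSide γ q s)
    (h' : HasSide γ q s') : s = s' := by
  obtain ⟨θ, hc, he, ht, hb⟩ := h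
  obtain ⟨θ', hc', he', ht', hb'⟩ := h'
  have hn : ∀ t, ∃ n : ℤ, θ t = θ' t + n * (2 * Real.pi * Complex.I) := fun t =>
    Complex.exp_eq_exp_iff_exists_int.1 ((he t).trans (he' t).symm)
  choose n hn using hn
  have hpi := Real.pi_pos
  have him : ∀ t, (n t : ℝ) = ((θ t).im - (θ' t).im) / (2 * Real.pi) := fun t => by
    rw [hn t]; simp
  have hni : Continuous n := by
    rw [Int.isClosedEmbedding_coe_real.isInducing.continuous_iff]
    have : ((fun k : ℤ => (k : ℝ)) ∘ n) = fun t => ((θ t).im - (θ' t).im) / (2 * Real.pi) :=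
      funext him
    rw [this]
    exact ((Complex.continuous_im.comp hc).sub (Complex.continuous_im.comp hc')).div_const _
  have hconst : ∀ t, ((θ t).im - (θ' t).im) = ((θ 0).im - (θ' 0).im) := fun t => by
    have h1 := him t
    rw [PreconnectedSpace.constant inferInstance hni (x := t) (y := 0), him 0] at h1
    exact ((div_left_inj' (by positivity)).1 h1).symm
  have l1 : Tendsto (fun t => (θ t).im - (θ' t).im) atTop (𝓝 (0 - 0)) := ht.sub ht'
  have l2 : Tendsto (fun t => (θ t).im - (θ' t).im) atBot (𝓝 (s * Real.pi - s' * Real.pi)) :=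
    hb.sub hb'
  simp only [hconst] at l1 l2
  have e1 := tendsto_nhds_unique l1 tendsto_const_nhds
  have e2 := tendsto_nhds_unique l2 tendsto_const_nhds
  have : (s - s') * Real.pi = 0 := by linarith
  rcases mul_eq_zero.1 this with h | h
  · linarith
  · exact absurd h hpi.ne'

lemma HasSide.comp {γ : ℝ → ℝ × ℝ} {q : ℝ × ℝ} {s : ℝ} (h : HasSide γ q s) {φ : ℝ → ℝ}
    (hφ : Continuous φ) (ht : Tendsto φ atTop atTop) (hb : Tendsto φ atBot atBot) :
    HasSide (γ ∘ φ) q s := by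
  obtain ⟨θ, h1, h2, h3, h4⟩ := h
  exact ⟨θ ∘ φ, h1.comp hφ, fun t => h2 (φ t), h3.comp ht, h4.comp hb⟩

lemma HasSide.stable {γ γ' : ℝ → ℝ × ℝ} {q : ℝ × ℝ} {s ε : ℝ} (h : HasSide γ q s)
    (hγ : Continuous γ) (hγ' : Continuous γ') (hε : ∀ t, ‖γ' t - γ t‖ ≤ ε)
    (hq : ∀ t, 2 * ε < ‖γ t - q‖) (ht : Tendsto (fun t => ‖γ t‖) atTop atTop)
    (hb : Tendsto (fun t => ‖γ t‖) atBot atTop) : HasSide γ' q s := by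
  obtain ⟨θ, h1, h2, h3, h4⟩ := h
  have hε0 : 0 ≤ ε := (norm_nonneg _).trans (hε 0)
  have hne : ∀ t, toC (γ t - q) ≠ 0 := fun t => by rw [← h2]; exact Complex.exp_ne_zero _
  set ω : ℝ → ℂ := fun t => toC (γ' t - q) / toC (γ t - q) with hω
  have hω1 : ∀ t, ‖ω t - 1‖ ≤ 2 * ε / ‖γ t - q‖ := fun t => by
    have e : ω t - 1 = toC (γ' t - γ t) / toC (γ t - q) := by
      simp only [hω]
      rw [div_sub_one (hne t), ← toC_sub]; congr 2; abel
    rw [e, norm_div]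
    have h5 : 0 < ‖γ t - q‖ := by linarith [hq t]
    exact div_le_div₀ (by positivity) ((toC_norm_le _).trans (by linarith [hε t])) h5
      (norm_le_toC _)
  have hωlt : ∀ t, ‖ω t - 1‖ < 1 := fun t => (hω1 t).trans_lt
    ((div_lt_one (by linarith [hq t])).2 (hq t))
  have hslit : ∀ t, ω t ∈ Complex.slitPlane := fun t => by
    left
    have := (abs_lt.1 ((Complex.abs_re_le_norm _).trans_lt (hωlt t))).1
    simp at this; linarith
  have hωc : Continuous ω := (continuous_toC.comp (hγ'.sub continuous_const)).div
    (continuous_toC.comp (hγ.sub continuous_const)) hne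
  have hlim : ∀ l : Filter ℝ, Tendsto (fun t => ‖γ t‖) l atTop →
      Tendsto (fun t => (Complex.log (ω t)).im) l (𝓝 0) := by
    intro l hl
    have e1 : Tendsto (fun t => ‖γ t - q‖) l atTop :=
      tendsto_atTop_mono (fun t => norm_sub_norm_le (γ t) q)
        (tendsto_atTop_add_const_right l (-‖q‖) hl)
    have e2 : Tendsto (fun t => ω t - 1) l (𝓝 0) :=
      squeeze_zero_norm hω1 (e1.const_div_atTop _)
    have e3 : Tendsto ω l (𝓝 1) := by simpa using e2.add_const 1
    have e4 : ContinuousAt Complex.log 1 := continuousAt_clog Complex.one_mem_slitPlane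
    have := (Complex.continuous_im.tendsto _).comp (e4.tendsto.comp e3)
    rw [Complex.log_one, Complex.zero_im] at this; exact this
  refine ⟨fun t => θ t + Complex.log (ω t), h1.add ?_, fun t => ?_, ?_, ?_⟩
  · exact continuous_iff_continuousAt.2 fun t => (hωc.continuousAt).clog (hslit t)
  · have : ω t ≠ 0 := Complex.slitPlane_ne_zero (hslit t)
    rw [Complex.exp_add, h2, Complex.exp_log this]
    simp only [hω]; rw [mul_div_cancel₀ _ (hne t)]
  · simpa using h3.add (hlim _ ht)
  · simpa using h4.add (hlim _ hb)

lemma hasSide_of_forall {γ : ℝ → ℝ × ℝ} {q : ℝ × ℝ} {s : ℝ} (hs : s = 1 ∨ s = -1)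
    (hγ : Continuous γ) (ht : Tendsto (fun t => (γ t).1) atTop atTop)
    (hb : Tendsto (fun t => (γ t).1) atBot atBot) {B : ℝ} (hB : ∀ t, |(γ t).2| ≤ B)
    (h : ∀ t, (γ t).1 = q.1 → 0 < s * ((γ t).2 - q.2)) : HasSide γ q s := by
  set y : ℝ → ℂ := fun t => ⟨s * ((γ t).2 - q.2), -(s * ((γ t).1 - q.1))⟩ with hy
  have hss : s * s = 1 := by rcases hs with rfl | rfl <;> norm_num
  have hs0 : s ≠ 0 := by rintro rfl; simp at hss
  have hyz : ∀ t, y t = -(s * Complex.I) * toC (γ t - q) := fun t => by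
    apply Complex.ext <;> simp [hy, toC]
  have hyc : Continuous y := by
    have : y = fun t => -(s * Complex.I) * toC (γ t - q) := funext hyz
    rw [this]; exact continuous_const.mul (continuous_toC.comp (hγ.sub continuous_const))
  have hslit : ∀ t, y t ∈ Complex.slitPlane := fun t => by
    by_cases h0 : (γ t).1 = q.1
    · left; exact h t h0
    · right; simp only [hy, ne_eq, neg_eq_zero, mul_eq_zero, not_or]
      exact ⟨hs0, sub_ne_zero.2 h0⟩
  have hexp : Complex.exp (s * (Real.pi / 2) * Complex.I) = s * Complex.I := by
    rcases hs with rfl | rfl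
    · simp [Complex.exp_pi_div_two_mul_I]
    · rw [show (((-1 : ℝ) : ℂ) * (Real.pi / 2) * Complex.I) = -(Real.pi : ℂ) / 2 * Complex.I by
        push_cast; ring, Complex.exp_neg_pi_div_two_mul_I]
      simp
  have hargI : ∀ r : ℝ, (r = 1 ∨ r = -1) → Complex.arg (r * Complex.I) = r * (Real.pi / 2) := by
    rintro r (rfl | rfl)
    · simp
    · simp
  have hlim : ∀ (l : Filter ℝ) (r : ℝ), (r = 1 ∨ r = -1) →
      Tendsto (fun t => r * (γ t).1) l atTop →
      Tendsto (fun t => (Complex.log (y t)).im) l (𝓝 (-(s * r) * (Real.pi / 2))) := by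
    intro l r hr hl
    have hrr : r * r = 1 := by rcases hr with rfl | rfl <;> norm_num
    have hx : Tendsto (fun t => r * ((γ t).1 - q.1)) l atTop := by
      have := tendsto_atTop_add_const_right l (-(r * q.1)) hl
      refine this.congr fun t => by ring
    have e1 : Tendsto (fun t => s * ((γ t).2 - q.2) / (r * ((γ t).1 - q.1))) l (𝓝 0) := by
      have hb1 : ∀ t, |s * ((γ t).2 - q.2)| ≤ B + |q.2| := fun t => by
        have : |s| = 1 := by rcases hs with rfl | rfl <;> simp
        rw [abs_mul, this, one_mul]
        exact (abs_sub _ _).trans (by linarith [hB t])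
      have h2 : Tendsto (fun t => (B + |q.2|) / (r * ((γ t).1 - q.1))) l (𝓝 0) :=
        hx.const_div_atTop _
      refine squeeze_zero_norm' ?_ h2
      filter_upwards [hx.eventually_gt_atTop 0] with t ht0
      rw [Real.norm_eq_abs, abs_div, abs_of_pos ht0]
      exact div_le_div_of_nonneg_right (hb1 t) ht0.le
    set ζ : ℝ → ℂ := fun t => ⟨s * ((γ t).2 - q.2) / (r * ((γ t).1 - q.1)), -(s * r)⟩ with hζ
    have hrs : -(s * r) = 1 ∨ -(s * r) = -1 := by
      rcases hs with rfl | rfl <;> rcases hr with rfl | rfl <;> norm_num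
    have e2 : Tendsto ζ l (𝓝 (((-(s * r) : ℝ) : ℂ) * Complex.I)) := by
      have h3 : ζ = fun t => ((s * ((γ t).2 - q.2) / (r * ((γ t).1 - q.1)) : ℝ) : ℂ) +
          ((-(s * r) : ℝ) : ℂ) * Complex.I := by
        funext t
        apply Complex.ext <;>
          simp only [hζ, Complex.add_re, Complex.add_im, Complex.ofReal_re, Complex.ofReal_im,
            Complex.mul_re, Complex.mul_im, Complex.I_re, Complex.I_im] <;> ring
      rw [h3]
      have := ((Complex.continuous_ofReal.tendsto _).comp e1).add_const
        (((-(s * r) : ℝ) : ℂ) * Complex.I)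
      simpa using this
    have e3 : ContinuousAt Complex.arg (((-(s * r) : ℝ) : ℂ) * Complex.I) := by
      refine Complex.continuousAt_arg (Or.inr ?_)
      rcases hrs with h | h <;> rw [h] <;> simp
    have e4 := e3.tendsto.comp e2
    rw [hargI _ hrs] at e4
    refine e4.congr' ?_
    filter_upwards [hx.eventually_gt_atTop 0] with t ht0
    have : y t = ((r * ((γ t).1 - q.1) : ℝ) : ℂ) * ζ t := by
      apply Complex.ext
      · simp only [hy, hζ, Complex.re_ofReal_mul]; rw [mul_div_cancel₀ _ ht0.ne']
      · simp only [hy, hζ, Complex.im_ofReal_mul]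
        linear_combination (-(s * ((γ t).1 - q.1))) * hrr.symm
    simp only [Function.comp, Complex.log_im]
    rw [this, Complex.arg_real_mul _ ht0]
  refine ⟨fun t => Complex.log (y t) + s * (Real.pi / 2) * Complex.I, ?_, fun t => ?_, ?_, ?_⟩
  · exact (continuous_iff_continuousAt.2 fun t => (hyc.continuousAt).clog (hslit t)).add
      continuous_const
  · rw [Complex.exp_add, Complex.exp_log (Complex.slitPlane_ne_zero (hslit t)), hexp, hyz]
    have : (s : ℂ) * s = 1 := by exact_mod_cast hss
    linear_combination (-(toC (γ t - q)) * (s * s)) * Complex.I_mul_I + toC (γ t - q) * this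
  · have e := (hlim atTop 1 (Or.inl rfl) (by simpa using ht)).add_const (s * (Real.pi / 2))
    have e5 : -(s * 1) * (Real.pi / 2) + s * (Real.pi / 2) = 0 := by ring
    rw [e5] at e
    refine e.congr fun t => ?_
    rw [Complex.add_im]; congr 1
    simp
  · have e := (hlim atBot (-1) (Or.inr rfl) ((tendsto_neg_atBot_atTop.comp hb).congr fun t => by
      simp)).add_const (s * (Real.pi / 2))
    have e5 : -(s * -1) * (Real.pi / 2) + s * (Real.pi / 2) = s * Real.pi := by ring
    rw [e5] at e
    refine e.congr fun t => ?_
    rw [Complex.add_im]; congr 1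
    simp

/-- The curve `γ` is invariant under the translation by `v`, up to a unit time shift. -/
def QuasiPeriodic (v : ℝ × ℝ) (γ : ℝ → ℝ × ℝ) : Prop := ∀ t, γ (t + 1) = γ t + v

namespace QuasiPeriodic

variable {v : ℝ × ℝ} {γ γ' : ℝ → ℝ × ℝ}

lemma add_nat (h : QuasiPeriodic v γ) (n : ℕ) (t : ℝ) : γ (t + n) = γ t + (n : ℝ) • v := by
  induction n with
  | zero => simp
  | succ n ih => push_cast; rw [← add_assoc, h, ih, add_smul, one_smul, add_assoc]

lemma add_int (h : QuasiPeriodic v γ) (n : ℤ) (t : ℝ) : γ (t + n) = γ t + (n : ℝ) • v := by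
  obtain ⟨m, rfl | rfl⟩ := n.eq_nat_or_neg
  · simpa using h.add_nat m t
  · have := h.add_nat m (t + ((-(m : ℤ) : ℤ) : ℝ))
    rw [show t + ((-(m : ℤ) : ℤ) : ℝ) + (m : ℝ) = t by push_cast; ring] at this
    rw [this]; push_cast; rw [neg_smul]; abel

lemma eq_fract (h : QuasiPeriodic v γ) (t : ℝ) :
    γ t = γ (Int.fract t) + ((⌊t⌋ : ℤ) : ℝ) • v := by
  conv_lhs => rw [← Int.fract_add_floor t]
  rw [h.add_int]

lemma shift (h : QuasiPeriodic v γ) (a : ℝ) : QuasiPeriodic v fun t => γ (t + a) := fun t => by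
  show γ (t + 1 + a) = γ (t + a) + v
  rw [← h]; congr 1; ring

lemma exists_bound (h : QuasiPeriodic v γ) (hγ : Continuous γ) :
    ∃ B, ∀ t, ‖γ t - t • v‖ ≤ B := by
  have hc : Continuous fun t : ℝ => γ t - t • v := by fun_prop
  obtain ⟨B, hB⟩ := (isCompact_Icc (a := (0 : ℝ)) (b := 1)).exists_bound_of_continuousOn
    hc.continuousOn
  refine ⟨B, fun t => ?_⟩
  have := hB (Int.fract t) ⟨Int.fract_nonneg t, (Int.fract_lt_one t).le⟩
  have e : γ t - t • v = γ (Int.fract t) - Int.fract t • v := by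
    rw [h.eq_fract t]
    conv_lhs => rw [← Int.fract_add_floor t]
    simp only [Int.fract_add_intCast, Int.floor_add_intCast, Int.floor_fract, Int.fract_fract, zero_add, add_smul]
    abel
  rwa [e]

lemma norm_sub_le (h : QuasiPeriodic v γ) (h' : QuasiPeriodic v γ') {ε : ℝ}
    (hε : ∀ t ∈ Icc (0 : ℝ) 1, ‖γ' t - γ t‖ ≤ ε) (t : ℝ) : ‖γ' t - γ t‖ ≤ ε := by
  rw [h.eq_fract t, h'.eq_fract t, add_sub_add_right_eq_sub]
  exact hε _ ⟨Int.fract_nonneg t, (Int.fract_lt_one t).le⟩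

lemma abs_snd_bounded {a : ℝ} (h : QuasiPeriodic (a, 0) γ) (hγ : Continuous γ) :
    ∃ B, ∀ t, |(γ t).2| ≤ B := by
  obtain ⟨B, hB⟩ := h.exists_bound hγ
  refine ⟨B, fun t => ?_⟩
  have := (abs_snd_le _).trans (hB t)
  simpa using this

lemma tendsto_fst {a : ℝ} (ha : 0 < a) (h : QuasiPeriodic (a, 0) γ) (hγ : Continuous γ) :
    Tendsto (fun t => (γ t).1) atTop atTop ∧ Tendsto (fun t => (γ t).1) atBot atBot := by
  obtain ⟨B, hB⟩ := h.exists_bound hγ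
  have hB' : ∀ t, |(γ t).1 - t * a| ≤ B := fun t => by
    have := (abs_fst_le _).trans (hB t)
    simpa using this
  constructor
  · refine tendsto_atTop_mono (f := fun t => t * a + -B) (fun t => ?_)
      (tendsto_atTop_add_const_right _ _ (tendsto_id.atTop_mul_const ha))
    linarith [(abs_le.1 (hB' t)).1]
  · refine tendsto_atBot_mono (f := fun t => t * a + B) (fun t => ?_)
      (tendsto_atBot_add_const_right _ _ (tendsto_id.atBot_mul_const ha))
    linarith [(abs_le.1 (hB' t)).2]

lemma tendsto_norm {a : ℝ} (ha : 0 < a) (h : QuasiPeriodic (a, 0) γ) (hγ : Continuous γ) :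
    Tendsto (fun t => ‖γ t‖) atTop atTop ∧ Tendsto (fun t => ‖γ t‖) atBot atTop := by
  obtain ⟨h1, h2⟩ := h.tendsto_fst ha hγ
  constructor
  · exact tendsto_atTop_mono (fun t => (le_abs_self _).trans (abs_fst_le (γ t))) h1
  · exact tendsto_atTop_mono (fun t => (neg_le_abs _).trans (abs_fst_le (γ t)))
      (tendsto_neg_atBot_atTop.comp h2)

end QuasiPeriodic

/-- The quasi-periodic extension of a curve defined on the unit interval. -/
def quasiExt (v : ℝ × ℝ) (f : ℝ → ℝ × ℝ) (t : ℝ) : ℝ × ℝ :=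
  f (Int.fract t) + ((⌊t⌋ : ℤ) : ℝ) • v

lemma quasiPeriodic_quasiExt (v : ℝ × ℝ) (f : ℝ → ℝ × ℝ) : QuasiPeriodic v (quasiExt v f) := by
  intro t
  simp only [quasiExt, Int.fract_add_one, Int.floor_add_one]
  push_cast
  rw [add_smul, one_smul, add_assoc]

lemma quasiExt_of_mem {v : ℝ × ℝ} {f : ℝ → ℝ × ℝ} (h : f 1 = f 0 + v) {t : ℝ}
    (ht : t ∈ Icc (0 : ℝ) 1) : quasiExt v f t = f t := by
  rcases ht.2.eq_or_lt with rfl | h1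
  · simp [quasiExt, h]
  · have : ⌊t⌋ = 0 := Int.floor_eq_zero_iff.2 ⟨ht.1, h1⟩
    rw [quasiExt, Int.fract, this]; simp

namespace TorusMetric

variable {M : TorusMetric}

lemma dist_quasi {k : ℤ × ℤ} {γ : ℝ → ℝ × ℝ} (h : QuasiPeriodic (lat k) γ) (n : ℤ) (s t : ℝ) :
    M.dist (γ (s + n)) (γ (t + n)) = M.dist (γ s) (γ t) := by
  have : (n : ℝ) • lat k = lat (n * k.1, n * k.2) := by ext <;> simp [lat]
  rw [h.add_int, h.add_int, this, dist_add_lat]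

lemma LipOn.of_quasi {k : ℤ × ℤ} {γ : ℝ → ℝ × ℝ} {L : ℝ} (hγ : QuasiPeriodic (lat k) γ)
    (h : M.LipOn L γ (Icc 0 1)) : M.LipOn L γ univ := by
  have h1 : ∀ n : ℤ, M.LipOn L γ (Icc (n : ℝ) (n + 1)) := by
    intro n s hs t ht
    have := h (s - n) ⟨by linarith [hs.1], by linarith [hs.2]⟩ (t - n)
      ⟨by linarith [ht.1], by linarith [ht.2]⟩
    rw [← dist_quasi hγ n] at this
    simpa using this
  have h2 : ∀ (n : ℤ) (m : ℕ), M.LipOn L γ (Icc (n : ℝ) (n + (m + 1 : ℕ))) := by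
    intro n m
    induction m with
    | zero => simpa using h1 n
    | succ m ih =>
      refine ih.union ?_
      have := h1 (n + (m + 1 : ℕ))
      push_cast at this ⊢
      simpa only [add_assoc] using this
  refine lipOn_of_le fun s _ t _ hst => ?_
  obtain ⟨m, hm⟩ := exists_nat_gt (t - ⌊s⌋)
  have := h2 ⌊s⌋ m s ⟨Int.floor_le s, by push_cast; linarith⟩ t
    ⟨(Int.floor_le s).trans hst, by push_cast; linarith⟩
  rwa [abs_sub_comm, abs_of_nonneg (sub_nonneg.2 hst)] at this

lemma LipOn.continuous {L : ℝ} {γ : ℝ → ℝ × ℝ} (h : M.LipOn L γ univ) : Continuous γ :=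
  continuousOn_univ.1 h.continuousOn

end TorusMetric

/-- A periodic row of obstacles in the plane, whose complement is locally convex in the sense
that nearby points which can be joined locally in the complement can be joined there by almost
minimizing curves. -/
structure Obstacle (M : TorusMetric) where
  X : Set (ℝ × ℝ)
  size : ℕ
  q : ℝ × ℝ
  ρ : ℝ
  size_pos : 0 < size
  ρ_pos : 0 < ρ
  norm_q : ‖q‖ < size
  near : ∀ z ∈ X, ∃ i : ℤ, ‖z - lat (4 * size * i, 0)‖ < size
  inv : ∀ z ∈ X, ∀ i : ℤ, z + lat (4 * size * i, 0) ∈ X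
  convex : ∀ p, ∀ R > 0, ∃ r > 0, ∀ C ⊆ Metric.ball p r \ X, IsPreconnected C → ∀ A ∈ C, ∀ B ∈ C,
    ∀ δ > 0, ∃ η : ℝ → ℝ × ℝ, M.LipOn (M.dist A B + δ) η (Icc 0 1) ∧ η 0 = A ∧ η 1 = B ∧
      ∀ t ∈ Icc (0 : ℝ) 1, η t ∈ Metric.ball p R ∧ η t ∉ X
  far : ∀ γ : ℝ → ℝ × ℝ, Continuous γ → (∀ t, γ t ∉ X) → Tendsto (fun t => ‖γ t‖) atTop atTop →
    ∀ (j : ℤ) (t : ℝ), ρ ≤ ‖γ t - (q + lat (4 * size * j, 0))‖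

namespace TorusMetric

variable {M : TorusMetric} {c : ℝ → ℝ × ℝ}

lemma LipOn.add_lat {L : ℝ} {η : ℝ → ℝ × ℝ} {S : Set ℝ} (h : M.LipOn L η S) (k : ℤ × ℤ) :
    M.LipOn L (fun t => η t + lat k) S := fun s hs t ht => by
  rw [dist_add_lat]; exact h s hs t ht

lemma IsGeodesic.exists_obstacle (hc : M.IsGeodesic c) {t₁ t₂ t₃ t₄ : ℝ} (h12 : t₁ < t₂)
    (h23 : t₂ < t₃) (h34 : t₃ < t₄) (e1 : c t₁ = c t₂) (e2 : c t₃ = c t₄) :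
    Nonempty (Obstacle M) := by
  obtain ⟨a, b, hab, hstar⟩ := hc.exists_stars h12 h23 h34 e1 e2
  obtain ⟨q, R, -, ρ, hρ, hq⟩ := hc.exists_enclosed h12 e1
  set K := c '' Icc a b with hK
  have hKc : IsCompact K := isCompact_Icc.image hc.1.continuous
  obtain ⟨B, hB⟩ := hKc.isBounded.exists_norm_le
  obtain ⟨n, hn⟩ := exists_nat_gt (max (max B ‖q‖) 0)
  have hnB : B < n := ((le_max_left _ _).trans (le_max_left _ _)).trans_lt hn
  have hnq : ‖q‖ < n := ((le_max_right _ _).trans (le_max_left _ _)).trans_lt hn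
  have hn0 : (0 : ℝ) < n := (le_max_right _ _).trans_lt hn
  set X : Set (ℝ × ℝ) := {z | ∃ i : ℤ, z - lat (4 * n * i, 0) ∈ K} with hX
  have hlat : ∀ i : ℤ, (lat (4 * n * i, 0)).1 = 4 * n * i := fun i => by simp [lat]
  have huniq : ∀ p z : ℝ × ℝ, z ∈ Metric.ball p n → z ∈ X →
      z - lat (4 * n * round (p.1 / (4 * n)), 0) ∈ K := by
    rintro p z hz ⟨i, hi⟩
    have h1 : |z.1 - 4 * n * i| < n := by
      have := (abs_fst_le _).trans_lt ((hB _ hi).trans_lt hnB)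
      rwa [Prod.fst_sub, hlat] at this
    have h2 : |z.1 - p.1| < n := by
      have := Metric.mem_ball.1 hz
      rw [dist_eq_norm] at this
      exact (abs_fst_le _).trans_lt this
    have h3 : |p.1 - 4 * n * round (p.1 / (4 * n))| ≤ 2 * n := by
      have := abs_sub_round (p.1 / (4 * n))
      have e : p.1 - 4 * n * round (p.1 / (4 * n)) =
        (4 * n) * (p.1 / (4 * n) - round (p.1 / (4 * n))) := by field_simp
      rw [e, abs_mul, abs_of_pos (by positivity)]
      nlinarith
    have h4 : |((round (p.1 / (4 * n)) - i : ℤ) : ℝ)| < 1 := by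
      rw [abs_lt] at h1 h2 ⊢
      rw [abs_le] at h3
      push_cast
      constructor <;> nlinarith
    have h5 : round (p.1 / (4 * n)) - i = 0 := by
      rw [← Int.abs_lt_one_iff]; exact_mod_cast h4
    rwa [sub_eq_zero.1 h5]
  refine ⟨⟨X, n, q, ρ, by exact_mod_cast hn0, hρ, hnq, ?_, ?_, ?_, ?_⟩⟩
  · rintro z ⟨i, hi⟩
    exact ⟨i, (hB _ hi).trans_lt hnB⟩
  · rintro z ⟨i, hi⟩ j
    refine ⟨i + j, ?_⟩
    convert hi using 1
    ext <;> simp [lat]; ring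
  · intro p R₀ hR₀
    set k : ℤ × ℤ := (4 * n * round (p.1 / (4 * n)), 0) with hk
    obtain ⟨S, I, St⟩ := hstar (p - lat k)
    obtain ⟨r₀, hr₀, H⟩ := St.exists_path hc
    set R₁ := min R₀ n with hR₁
    have hR₁0 : 0 < R₁ := lt_min hR₀ hn0
    have hlo := M.lo_pos
    have hhi := M.hi_pos
    set r₁ := R₁ / (1 + (2 * M.hi + 1) / M.lo) with hr₁
    have hr₁0 : 0 < r₁ := by positivity
    refine ⟨min r₀ r₁, lt_min hr₀ hr₁0, fun C hC hCp A hA B hB' δ hδ => ?_⟩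
    have hr : min r₀ r₁ + (2 * min r₀ r₁ * M.hi + min r₀ r₁) / M.lo ≤ R₁ := by
      have e : min r₀ r₁ + (2 * min r₀ r₁ * M.hi + min r₀ r₁) / M.lo =
        min r₀ r₁ * (1 + (2 * M.hi + 1) / M.lo) := by ring
      rw [e, ← le_div_iff₀ (by positivity)]
      exact min_le_right _ _
    have hball : ∀ z ∈ C, z - lat k ∈ Metric.ball (p - lat k) r₀ := fun z hz => by
      have := Metric.mem_ball.1 (hC hz).1
      rw [Metric.mem_ball, dist_sub_right]
      exact this.trans_le (min_le_left _ _)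
    obtain ⟨η, h1, h2, h3, h4⟩ := H ((fun z => z - lat k) '' C) (by
        rintro _ ⟨z, hz, rfl⟩
        exact ⟨hball z hz, fun hz' => (hC hz).2 ⟨_, hz'⟩⟩)
      (hCp.image _ (by fun_prop)) _ (mem_image_of_mem _ hA) _ (mem_image_of_mem _ hB')
      (min δ (min r₀ r₁)) (lt_min hδ (lt_min hr₀ hr₁0))
    have hAB : M.dist (A - lat k) (B - lat k) = M.dist A B := by
      rw [← dist_add_lat M _ _ k]; simp
    have h1' : M.LipOn (M.dist A B + min δ (min r₀ r₁)) (fun t => η t + lat k) (Icc 0 1) := by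
      rw [← hAB]; exact h1.add_lat k
    have hm := LipOn.mem_ball (p := p) hr (hC hA).1 (hC hB').1 (min_le_right _ _) (by simp [h2]) h1'
    refine ⟨fun t => η t + lat k, h1'.of_le (by linarith [min_le_left δ (min r₀ r₁)]), by simp [h2],
      by simp [h3], fun t ht => ⟨Metric.ball_subset_ball (min_le_left _ _) (hm t ht), fun hx => ?_⟩⟩
    have := huniq p _ (Metric.ball_subset_ball (min_le_right _ _) (hm t ht)) hx
    rw [← hk] at this
    exact h4 t ht (by simpa using this)
  · intro γ hγ hav hlim j t
    by_contra! hlt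
    have hlt' : ‖γ t - (q + lat (4 * n * j, 0))‖ < ρ := hlt
    have hbd := hq (γ t - lat (4 * n * j, 0)) (by
      rw [Metric.mem_ball, dist_eq_norm]
      rwa [sub_sub, add_comm]) (fun s => γ (t + s) - lat (4 * n * j, 0)) (by fun_prop)
      (fun s hs => hav (t + s) ⟨j, hab hs⟩) (by simp)
    obtain ⟨s, hs⟩ := (hlim.eventually_gt_atTop (R + ‖lat (4 * n * j, 0)‖)).exists
    have := hbd (s - t)
    simp only [add_sub_cancel] at this
    linarith [norm_sub_norm_le (γ s) (lat (4 * n * j, 0))]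

end TorusMetric

/-- A bi-infinite periodic word in the letters `1` and `-1` in which both letters occur. -/
structure IsWord (P : ℕ) (s : ℤ → ℝ) : Prop where
  sign : ∀ j, s j = 1 ∨ s j = -1
  per : ∀ j, s (j + P) = s j
  up : ∃ j, 0 ≤ j ∧ j < (P : ℤ) ∧ s j = 1
  down : ∃ j, 0 ≤ j ∧ j < (P : ℤ) ∧ s j = -1

lemma IsWord.pos {P : ℕ} {s : ℤ → ℝ} (h : IsWord P s) : 0 < P := by
  obtain ⟨j, h1, h2, -⟩ := h.up
  omega

namespace Obstacle

variable {M : TorusMetric} (O : Obstacle M)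

/-- The marked points enclosed by the obstacles. -/
def pt (j : ℤ) : ℝ × ℝ := O.q + lat (4 * O.size * j, 0)

/-- The lattice vector spanning `P` obstacles. -/
def period (P : ℕ) : ℤ × ℤ := (4 * O.size * P, 0)

/-- A curve avoiding the obstacles, whose way through the obstacles is described by `s`. -/
structure Adm (P : ℕ) (s : ℤ → ℝ) (γ : ℝ → ℝ × ℝ) : Prop where
  quasi : QuasiPeriodic (lat (O.period P)) γ
  avoid : ∀ t, γ t ∉ O.X
  side : ∀ j : ℤ, 0 ≤ j → j < P → HasSide γ (O.pt j) (s j)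

variable {O}

lemma lat_period (P : ℕ) : lat (O.period P) = (4 * (O.size : ℝ) * P, 0) := by
  simp [lat, period]

lemma size_pos' : (0 : ℝ) < O.size := by exact_mod_cast O.size_pos

lemma width_pos {P : ℕ} (hP : 0 < P) : 0 < 4 * (O.size : ℝ) * P := by
  have := O.size_pos'
  have : (0 : ℝ) < P := by exact_mod_cast hP
  positivity

lemma pt_fst (j : ℤ) : (O.pt j).1 = O.q.1 + 4 * O.size * j := by simp [pt, lat]

lemma pt_snd (j : ℤ) : (O.pt j).2 = O.q.2 := by simp [pt, lat]

lemma exists_adm {P : ℕ} {s : ℤ → ℝ} (hs : IsWord P s) :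
    ∃ γ, O.Adm P s γ ∧ M.LipOn (M.hi * (4 * O.size * P)) γ univ := by
  have hn := O.size_pos'
  set n : ℝ := (O.size : ℝ) with hn'
  set W : ℝ := 4 * n * P with hW
  have hW0 : 0 < W := width_pos hs.pos
  set A : Set ℝ := {x | ∃ i : ℤ, s i = -1 ∧ x = 4 * n * i} with hA
  have hAne : A.Nonempty := by
    obtain ⟨j, -, -, h⟩ := hs.down
    exact ⟨_, j, h, rfl⟩
  set f : ℝ → ℝ := fun x => max (-n) (min n (Metric.infDist x A - 2 * n)) with hf
  have hfb : ∀ x, |f x| ≤ n := fun x => by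
    rw [abs_le]
    exact ⟨le_max_left _ _, max_le (by linarith) (min_le_left _ _)⟩
  have hfl : ∀ x y, |f x - f y| ≤ |x - y| := fun x y => by
    have h0 : LipschitzWith 1 fun x => Metric.infDist x A - 2 * n :=
      LipschitzWith.of_dist_le_mul fun x y => by
        rw [dist_sub_right]; exact (Metric.lipschitz_infDist_pt A).dist_le_mul x y
    have h1 : LipschitzWith 1 f := (h0.const_min n).const_max (-n)
    simpa [Real.dist_eq] using h1.dist_le_mul x y
  have hfd : ∀ (i : ℤ) (x : ℝ), |x - 4 * n * i| < n → f x = s i * n := by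
    intro i x hx
    rcases hs.sign i with h | h
    · have h1 : 3 * n ≤ Metric.infDist x A := by
        rw [Metric.le_infDist hAne]
        rintro _ ⟨k, hk, rfl⟩
        have hik : i - k ≠ 0 := fun e => by
          rw [sub_eq_zero.1 e, hk] at h; norm_num at h
        have h2 : (1 : ℝ) ≤ |((i - k : ℤ) : ℝ)| := by exact_mod_cast Int.one_le_abs hik
        rw [Real.dist_eq]
        have h3 : |4 * n * i - 4 * n * k| = 4 * n * |((i - k : ℤ) : ℝ)| := by
          rw [← mul_sub, abs_mul, abs_of_pos (by positivity)]; push_cast; rfl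
        have h4 := abs_sub_le (4 * n * i) x (4 * n * k)
        rw [abs_sub_comm (4 * n * i) x] at h4
        nlinarith
      simp only [hf]
      rw [min_eq_left (by linarith), max_eq_right (by linarith), h, one_mul]
    · have h1 : Metric.infDist x A ≤ |x - 4 * n * i| :=
        Metric.infDist_le_dist_of_mem ⟨i, h, rfl⟩
      simp only [hf]
      rw [max_eq_left, h]
      · ring
      · exact (min_le_right _ _).trans (by linarith)
  have hAp : ∀ x, x ∈ A → x + W ∈ A := by
    rintro _ ⟨i, hi, rfl⟩
    refine ⟨i + P, by rw [hs.per, hi], ?_⟩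
    simp only [hW]; push_cast; ring
  have hAm : ∀ x, x ∈ A → x - W ∈ A := by
    rintro _ ⟨i, hi, rfl⟩
    refine ⟨i - P, by rw [← hs.per, sub_add_cancel, hi], ?_⟩
    simp only [hW]; push_cast; ring
  have hfp : ∀ x, f (x + W) = f x := by
    intro x
    have : Metric.infDist (x + W) A = Metric.infDist x A := by
      apply le_antisymm
      · rw [Metric.le_infDist hAne]
        intro y hy
        have := Metric.infDist_le_dist_of_mem (x := x + W) (hAp y hy)
        rwa [dist_add_right] at this
      · rw [Metric.le_infDist hAne]
        intro y hy
        have := Metric.infDist_le_dist_of_mem (x := x) (hAm y hy)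
        rw [← dist_add_right _ _ W, sub_add_cancel] at this
        exact this
    simp only [hf, this]
  have hfc : Continuous f := by
    have : LipschitzWith 1 f := LipschitzWith.of_dist_le_mul fun x y => by
      simpa [Real.dist_eq] using hfl x y
    exact this.continuous
  set γ : ℝ → ℝ × ℝ := fun t => (W * t, f (W * t)) with hγ
  have hγc : Continuous γ := by fun_prop
  have hq : QuasiPeriodic (lat (O.period P)) γ := fun t => by
    rw [lat_period]
    simp only [hγ, mul_add, mul_one, hfp]
    ext <;> simp [hW, hn']
  have hq' : QuasiPeriodic (W, 0) γ := by rw [lat_period] at hq; exact hq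
  have hlim := hq'.tendsto_fst hW0 hγc
  refine ⟨γ, ⟨hq, fun t ht => ?_, fun j _ _ => ?_⟩, ?_⟩
  · obtain ⟨i, hi⟩ := O.near _ ht
    have h1 := (abs_fst_le _).trans_lt hi
    have h2 := (abs_snd_le _).trans_lt hi
    simp only [hγ, lat, Prod.fst_sub, Prod.snd_sub] at h1 h2
    push_cast at h1 h2
    rw [hfd i _ h1, sub_zero] at h2
    rcases hs.sign i with h | h <;> rw [h] at h2 <;> simp [hn'] at h2
  · refine hasSide_of_forall (hs.sign j) hγc hlim.1 hlim.2 (fun t => hfb (W * t)) fun t ht => ?_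
    have h1 := (abs_fst_le _).trans_lt O.norm_q
    have h2 := (abs_snd_le _).trans_lt O.norm_q
    have h3 : f (W * t) = s j * n := by
      apply hfd
      have : W * t = (O.pt j).1 := ht
      rw [this, pt_fst, add_sub_cancel_right]; exact h1
    show 0 < s j * (f (W * t) - _)
    rw [h3, pt_snd]
    rw [abs_lt] at h2
    rcases hs.sign j with h | h <;> rw [h] <;> linarith
  · intro x _ y _
    refine (M.dist_le _ _).trans ?_
    rw [mul_assoc]
    refine mul_le_mul_of_nonneg_left ?_ M.hi_pos.le
    have e : |W * x - W * y| = W * |x - y| := by rw [← mul_sub, abs_mul, abs_of_pos hW0]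
    rw [norm_prod_eq]
    exact max_le e.le ((hfl _ _).trans e.le)

lemma Adm.shift {P : ℕ} {s : ℤ → ℝ} {γ : ℝ → ℝ × ℝ} (h : O.Adm P s γ) (a : ℝ) :
    O.Adm P s fun t => γ (t + a) :=
  ⟨h.quasi.shift a, fun t => h.avoid _, fun j h0 h1 => (h.side j h0 h1).comp
    (φ := fun t => t + a) (by fun_prop) (tendsto_atTop_add_const_right _ _ tendsto_id)
    (tendsto_atBot_add_const_right _ _ tendsto_id)⟩

lemma Adm.exists_base {P : ℕ} {s : ℤ → ℝ} {γ : ℝ → ℝ × ℝ} (hs : IsWord P s) (h : O.Adm P s γ)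
    (hγ : Continuous γ) :
    ∃ a, 0 ≤ (γ a).1 ∧ (γ a).1 ≤ 4 * O.size * P ∧ |(γ a).2| ≤ O.size := by
  have hW0 : 0 < 4 * (O.size : ℝ) * P := width_pos hs.pos
  have hq : QuasiPeriodic (4 * (O.size : ℝ) * P, 0) γ := by rw [← lat_period]; exact h.quasi
  have hlim := hq.tendsto_fst hW0 hγ
  obtain ⟨B, hB⟩ := hq.abs_snd_bounded hγ
  have hn := O.size_pos'
  have hqn := abs_lt.1 ((abs_snd_le _).trans_lt O.norm_q)
  have hex : ∃ t, |(γ t).2| ≤ O.size := by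
    by_contra! hno
    have hcont : Continuous fun t => (γ t).2 := by fun_prop
    have hdich : (∀ t, (O.size : ℝ) < (γ t).2) ∨ ∀ t, (γ t).2 < -(O.size : ℝ) := by
      by_contra! hcon
      obtain ⟨⟨t, ht⟩, t', ht'⟩ := hcon
      have h1 : (γ t).2 ≤ 0 := by
        rcases lt_abs.1 (hno t) with h | h <;> linarith
      have h2 : 0 ≤ (γ t').2 := by
        rcases lt_abs.1 (hno t') with h | h <;> linarith
      obtain ⟨u, hu⟩ := mem_range_of_exists_le_of_exists_ge hcont ⟨t, h1⟩ ⟨t', h2⟩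
      have := hno u
      simp only at hu
      rw [hu, abs_zero] at this; linarith
    rcases hdich with hd | hd
    · obtain ⟨j, h0, h1, hj⟩ := hs.down
      have e := (h.side j h0 h1).unique (hasSide_of_forall (Or.inl rfl) hγ hlim.1 hlim.2 hB
        fun t _ => by rw [pt_snd]; linarith [hd t])
      rw [hj] at e; norm_num at e
    · obtain ⟨j, h0, h1, hj⟩ := hs.up
      have e := (h.side j h0 h1).unique (hasSide_of_forall (Or.inr rfl) hγ hlim.1 hlim.2 hB
        fun t _ => by rw [pt_snd]; linarith [hd t])
      rw [hj] at e; norm_num at e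
  obtain ⟨t, ht⟩ := hex
  set W := 4 * (O.size : ℝ) * P with hW
  refine ⟨t + (-⌊(γ t).1 / W⌋ : ℤ), ?_, ?_, ?_⟩ <;> rw [hq.add_int]
  · have := Int.floor_le ((γ t).1 / W)
    rw [le_div_iff₀ hW0] at this
    simp; linarith
  · have := (Int.lt_floor_add_one ((γ t).1 / W)).le
    rw [div_le_iff₀ hW0] at this
    simp; linarith
  · simpa using ht

end Obstacle

lemma continuous_quasiExt {v : ℝ × ℝ} {f : ℝ → ℝ × ℝ} (hf : ContinuousOn f (Icc 0 1))
    (h : f 1 = f 0 + v) : Continuous (quasiExt v f) := by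
  have h1 : Continuous ((fun x : ℝ => f x - x • v) ∘ Int.fract) := by
    refine ContinuousOn.comp_fract'' (hf.sub (by fun_prop)) ?_
    simp [h]
  have h2 : quasiExt v f = fun t => ((fun x : ℝ => f x - x • v) ∘ Int.fract) t + t • v := by
    funext t
    simp only [quasiExt, Function.comp]
    conv_rhs => rw [show t • v = (Int.fract t + ((⌊t⌋ : ℤ) : ℝ)) • v by rw [Int.fract_add_floor]]
    rw [add_smul]; abel
  rw [h2]
  exact h1.add (by fun_prop)

namespace Obstacle

variable {M : TorusMetric} {O : Obstacle M} {P : ℕ} {s : ℤ → ℝ} {γ : ℝ → ℝ × ℝ}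

lemma quasi' (h : QuasiPeriodic (lat (O.period P)) γ) :
    QuasiPeriodic (4 * (O.size : ℝ) * P, 0) γ := by rwa [← lat_period]

lemma Adm.rho_le (h : O.Adm P s γ) (hP : 0 < P) (hγ : Continuous γ) (j : ℤ) (t : ℝ) :
    O.ρ ≤ ‖γ t - O.pt j‖ :=
  O.far γ hγ h.avoid ((quasi' h.quasi).tendsto_norm (width_pos hP) hγ).1 j t

/-- An admissible curve can be modified along an arc. -/
lemma Adm.modify (hP : 0 < P) (h : O.Adm P s γ) {L : ℝ} (hL : 0 < L) (hγ : M.LipOn L γ univ)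
    {u ℓ ε : ℝ} (hu : 0 < u) (hu1 : u < 1) (hℓ : 0 < ℓ) {η : ℝ → ℝ × ℝ}
    (hη : M.LipOn ℓ η (Icc 0 1)) (h0 : η 0 = γ 0) (h1 : η 1 = γ u)
    (hav : ∀ t ∈ Icc (0 : ℝ) 1, η t ∉ O.X) (hε : 2 * ε < O.ρ)
    (hcl : ∀ t ∈ Icc (0 : ℝ) u, ‖η (t / u) - γ t‖ ≤ ε) :
    ∃ β, O.Adm P s β ∧ M.LipOn (ℓ + L * (1 - u)) β univ := by
  set v := lat (O.period P) with hv
  set Λ := ℓ + L * (1 - u) with hΛ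
  have hLu : 0 < L * (1 - u) := mul_pos hL (by linarith)
  have hΛ0 : 0 < Λ := by linarith
  set σ := ℓ / Λ with hσ
  have hσ0 : 0 < σ := by positivity
  have hσ1 : σ < 1 := (div_lt_one hΛ0).2 (by linarith)
  have hσΛ : σ * Λ = ℓ := by rw [hσ]; field_simp
  have hend : u + (1 - σ) * (Λ / L) = 1 := by
    field_simp
    rw [sub_mul, hσΛ, hΛ]; ring
  have hγc := hγ.continuous
  set β₀ : ℝ → ℝ × ℝ := fun t => if t ≤ σ then η (t / σ) else γ (u + (t - σ) * (Λ / L)) with hβ₀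
  set ψ : ℝ → ℝ := fun t => u * (min t σ / σ) + (max t σ - σ) * (Λ / L) with hψ
  have hβσ : ∀ t, σ ≤ t → β₀ t = γ (u + (t - σ) * (Λ / L)) := fun t ht => by
    rcases ht.eq_or_lt with rfl | ht
    · simp only [hβ₀, le_refl, if_true, div_self hσ0.ne', h1, sub_self, zero_mul, add_zero]
    · simp only [hβ₀, not_le.2 ht, if_false]
  have hβs : ∀ t, t ≤ σ → β₀ t = η (t / σ) := fun t ht => by simp only [hβ₀, ht, if_true]
  have hdm : ∀ t, 0 ≤ t → t ≤ σ → t / σ ∈ Icc (0 : ℝ) 1 := fun t ht ht' =>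
    ⟨by positivity, (div_le_one hσ0).2 ht'⟩
  have hβ0 : β₀ 0 = γ 0 := by rw [hβs 0 hσ0.le, zero_div, h0]
  have hβ1 : β₀ 1 = β₀ 0 + v := by
    rw [hβσ 1 hσ1.le, hend, hβ0, ← h.quasi]; simp
  have hψ0 : ψ 0 = 0 := by simp [hψ, min_eq_left hσ0.le, max_eq_right hσ0.le]
  have hψ1 : ψ 1 = 1 := by
    simp only [hψ]
    rw [min_eq_right hσ1.le, max_eq_left hσ1.le, div_self hσ0.ne', mul_one, hend]
  have hψc : Continuous ψ := by fun_prop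
  have hclose : ∀ t ∈ Icc (0 : ℝ) 1, ‖β₀ t - γ (ψ t)‖ ≤ ε := by
    intro t ht
    rcases le_total t σ with htσ | htσ
    · rw [hβs t htσ]
      have e : ψ t = u * (t / σ) := by
        simp only [hψ]; rw [min_eq_left htσ, max_eq_right htσ]; ring
      have hm := hdm t ht.1 htσ
      have := hcl (u * (t / σ)) ⟨mul_nonneg hu.le hm.1, by nlinarith [hm.2]⟩
      rwa [e, mul_div_cancel_left₀ _ hu.ne'] at *
    · rw [hβσ t htσ]
      have e : ψ t = u + (t - σ) * (Λ / L) := by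
        simp only [hψ]; rw [min_eq_right htσ, max_eq_left htσ, div_self hσ0.ne', mul_one]
      rw [e, sub_self, norm_zero]
      exact (norm_nonneg _).trans (hcl 0 ⟨le_rfl, hu.le⟩)
  have hlip : M.LipOn Λ β₀ (Icc 0 1) := by
    refine TorusMetric.LipOn.union (b := σ) (TorusMetric.lipOn_of_le fun a ha b hb hab => ?_)
      (TorusMetric.lipOn_of_le fun a ha b hb hab => ?_)
    · rw [hβs a ha.2, hβs b hb.2]
      have := hη _ (hdm a ha.1 ha.2) _ (hdm b hb.1 hb.2)
      rw [← sub_div, abs_div, abs_of_pos hσ0, abs_sub_comm, abs_of_nonneg (sub_nonneg.2 hab)] at this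
      refine this.trans (le_of_eq ?_)
      rw [← hσΛ]; field_simp
    · rw [hβσ a ha.1, hβσ b hb.1]
      have := hγ (u + (a - σ) * (Λ / L)) (mem_univ _) (u + (b - σ) * (Λ / L)) (mem_univ _)
      have e : u + (a - σ) * (Λ / L) - (u + (b - σ) * (Λ / L)) = (a - b) * (Λ / L) := by ring
      rw [e, abs_mul, abs_of_pos (div_pos hΛ0 hL), abs_sub_comm,
        abs_of_nonneg (sub_nonneg.2 hab)] at this
      refine this.trans (le_of_eq ?_)
      field_simp
  set β := quasiExt v β₀ with hβ
  have hβq : QuasiPeriodic v β := quasiPeriodic_quasiExt _ _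
  have hβl : M.LipOn Λ β univ := TorusMetric.LipOn.of_quasi hβq
    (hlip.congr fun t ht => quasiExt_of_mem hβ1 ht)
  set φ : ℝ → ℝ := fun t => (quasiExt (1, 0) (fun t => (ψ t, 0)) t).1 with hφ
  have hφc : Continuous φ := continuous_fst.comp
    (continuous_quasiExt (by fun_prop) (by simp [hψ0, hψ1]))
  have hφe : ∀ t, φ t = ψ (Int.fract t) + (⌊t⌋ : ℤ) := fun t => by simp [hφ, quasiExt]
  have hψb : ∀ t ∈ Icc (0 : ℝ) 1, 0 ≤ ψ t ∧ ψ t ≤ 1 := by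
    intro t ht
    have h2 : 0 ≤ Λ / L := by positivity
    have h3 : min t σ / σ ≤ 1 := (div_le_one hσ0).2 (min_le_right _ _)
    have h4 : max t σ ≤ 1 := max_le ht.2 hσ1.le
    have h5 : 0 ≤ min t σ / σ := div_nonneg (le_min ht.1 hσ0.le) hσ0.le
    have h6 : 0 ≤ max t σ - σ := sub_nonneg.2 (le_max_right _ _)
    refine ⟨add_nonneg (mul_nonneg hu.le h5) (mul_nonneg h6 h2), ?_⟩
    rw [← hend]
    simp only [hψ]
    have h7 : u * (min t σ / σ) ≤ u := by nlinarith
    have h8 : (max t σ - σ) * (Λ / L) ≤ (1 - σ) * (Λ / L) :=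
      mul_le_mul_of_nonneg_right (by linarith) h2
    linarith
  have hfr : ∀ t : ℝ, Int.fract t ∈ Icc (0 : ℝ) 1 := fun t =>
    ⟨Int.fract_nonneg t, (Int.fract_lt_one t).le⟩
  have hφt : Tendsto φ atTop atTop := by
    refine tendsto_atTop_mono (f := fun t : ℝ => t + -1) (fun t => ?_)
      (tendsto_atTop_add_const_right _ _ tendsto_id)
    rw [hφe]
    linarith [(hψb _ (hfr t)).1, Int.lt_floor_add_one t]
  have hφb : Tendsto φ atBot atBot := by
    refine tendsto_atBot_mono (f := fun t : ℝ => t + 1) (fun t => ?_)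
      (tendsto_atBot_add_const_right _ _ tendsto_id)
    rw [hφe]
    linarith [(hψb _ (hfr t)).2, Int.floor_le t]
  have hβγ : ∀ t, ‖β t - (γ ∘ φ) t‖ ≤ ε := fun t => by
    simp only [Function.comp]
    rw [hφe, h.quasi.add_int, hβ, quasiExt, add_sub_add_right_eq_sub]
    exact hclose _ (hfr t)
  have hlim := (quasi' h.quasi).tendsto_norm (width_pos hP) hγc
  refine ⟨β, ⟨hβq, fun t => ?_, fun j hj hj' => ?_⟩, hβl⟩
  · intro hX
    have hX' : β₀ (Int.fract t) ∈ O.X := by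
      have := O.inv _ hX (-(⌊t⌋ * P))
      convert this using 1
      simp only [hβ, quasiExt, hv, lat_period]
      ext <;> simp [lat]
      ring
    have hf := hfr t
    rcases le_total (Int.fract t) σ with h2 | h2
    · rw [hβs _ h2] at hX'; exact hav _ (hdm _ hf.1 h2) hX'
    · rw [hβσ _ h2] at hX'; exact h.avoid _ hX'
  · exact ((h.side j hj hj').comp hφc hφt hφb).stable (hγc.comp hφc) hβl.continuous hβγ
      (fun t => hε.trans_le (h.rho_le hP hγc j _)) (hlim.1.comp hφt) (hlim.2.comp hφb)

end Obstacle

namespace TorusMetric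

lemma dist_le_add (M : TorusMetric) (x y x' y' : ℝ × ℝ) :
    M.dist x y ≤ M.dist x' y' + M.hi * (‖x - x'‖ + ‖y - y'‖) := by
  have h1 := M.dist_triangle x x' y
  have h2 := M.dist_triangle x' y' y
  have h3 := M.dist_le x x'
  have h4 := M.dist_le y' y
  rw [norm_sub_rev y' y] at h4
  linarith

lemma tendsto_dist (M : TorusMetric) {ι : Type*} {l : Filter ι} {f g : ι → ℝ × ℝ} {x y : ℝ × ℝ}
    (hf : Tendsto f l (𝓝 x)) (hg : Tendsto g l (𝓝 y)) :
    Tendsto (fun i => M.dist (f i) (g i)) l (𝓝 (M.dist x y)) := by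
  have h0 : Tendsto (fun i => M.hi * (‖f i - x‖ + ‖g i - y‖)) l (𝓝 0) := by
    have h1 : Tendsto (fun i => ‖f i - x‖) l (𝓝 0) := tendsto_iff_norm_sub_tendsto_zero.1 hf
    have h2 : Tendsto (fun i => ‖g i - y‖) l (𝓝 0) := tendsto_iff_norm_sub_tendsto_zero.1 hg
    simpa using (h1.add h2).const_mul M.hi
  rw [tendsto_iff_norm_sub_tendsto_zero]
  refine squeeze_zero (fun _ => norm_nonneg _) (fun i => ?_) h0
  have h1 := M.dist_le_add (f i) (g i) x y
  have h2 := M.dist_le_add x y (f i) (g i)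
  rw [norm_sub_rev x, norm_sub_rev y] at h2
  rw [Real.norm_eq_abs, abs_le]
  constructor <;> linarith

lemma LipOn.norm_sub_le {M : TorusMetric} {L : ℝ} {γ : ℝ → ℝ × ℝ} {S : Set ℝ} (h : M.LipOn L γ S) {s t : ℝ}
    (hs : s ∈ S) (ht : t ∈ S) : ‖γ s - γ t‖ ≤ L / M.lo * |s - t| := by
  refine (M.norm_le_dist _ _).trans ?_
  rw [div_mul_eq_mul_div]
  exact div_le_div_of_nonneg_right (h s hs t ht) M.lo_pos.le

/-- Pointwise convergence of uniformly Lipschitz quasi-periodic curves is uniform. -/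
lemma eventually_close {M : TorusMetric} {ι : Type*} {l : Filter ι} {v : ℝ × ℝ} {f : ι → ℝ → ℝ × ℝ}
    {g : ℝ → ℝ × ℝ} {L : ℝ} (hf : ∀ i, M.LipOn L (f i) univ) (hg : M.LipOn L g univ)
    (hfq : ∀ i, QuasiPeriodic v (f i)) (hgq : QuasiPeriodic v g)
    (hlim : ∀ t, Tendsto (fun i => f i t) l (𝓝 (g t))) {ε : ℝ} (hε : 0 < ε) :
    ∀ᶠ i in l, ∀ t, ‖f i t - g t‖ ≤ ε := by
  obtain ⟨m, hm⟩ := exists_nat_gt (max (4 * (L / M.lo) / ε) 0)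
  have hm0 : (0 : ℝ) < m := (le_max_right _ _).trans_lt hm
  have hm1 : L / M.lo * (1 / m) ≤ ε / 4 := by
    have := (le_max_left _ _).trans_lt hm
    rw [div_lt_iff₀ hε] at this
    rw [mul_one_div, div_le_iff₀ hm0]; linarith
  have hL : 0 ≤ L := by
    have := (M.dist_nonneg _ _).trans (hg 0 (mem_univ _) 1 (mem_univ _))
    simpa using this
  have hfin : ∀ᶠ i in l, ∀ k ∈ Finset.range (m + 1), ‖f i (k / m) - g (k / m)‖ < ε / 2 := by
    rw [eventually_all_finset]
    intro k _
    exact (tendsto_iff_norm_sub_tendsto_zero.1 (hlim _)).eventually_lt_const (half_pos hε)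
  filter_upwards [hfin] with i hi
  refine fun t => hgq.norm_sub_le (hfq i) (fun t ht => ?_) t
  have hk : ⌊t * m⌋₊ ≤ m := Nat.floor_le_of_le (by nlinarith [ht.2])
  have hk' := hi _ (Finset.mem_range.2 (Nat.lt_succ_of_le hk))
  set a : ℝ := (⌊t * m⌋₊ : ℝ) / m with ha
  have hta : |t - a| ≤ 1 / m := by
    have h1 := Nat.floor_le (mul_nonneg ht.1 hm0.le)
    have h2 := (Nat.lt_floor_add_one (t * m)).le
    have e : t - a = (t * m - ⌊t * m⌋₊) / m := by rw [ha]; field_simp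
    rw [e, abs_div, abs_of_pos hm0]
    refine div_le_div_of_nonneg_right ?_ hm0.le
    rw [abs_le]; constructor <;> linarith
  have h3 : ∀ h : ℝ → ℝ × ℝ, M.LipOn L h univ → ‖h t - h a‖ ≤ ε / 4 := fun h hh =>
    ((hh.norm_sub_le (mem_univ _) (mem_univ _)).trans
      (mul_le_mul_of_nonneg_left hta (div_nonneg hL M.lo_pos.le))).trans hm1
  have h4 := h3 _ (hf i)
  have h5 := h3 _ hg
  have e : f i t - g t = (f i t - f i a) + (f i a - g a) - (g t - g a) := by abel
  rw [e]
  have h6 := norm_sub_le ((f i t - f i a) + (f i a - g a)) (g t - g a)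
  have h7 := norm_add_le (f i t - f i a) (f i a - g a)
  linarith

end TorusMetric

namespace Obstacle

open TorusMetric

variable {M : TorusMetric} (O : Obstacle M) {P : ℕ} {s : ℤ → ℝ} {γ : ℝ → ℝ × ℝ}

/-- The Lipschitz constants of normalized admissible curves. -/
def lengths (P : ℕ) (s : ℤ → ℝ) : Set ℝ :=
  {L | ∃ γ, O.Adm P s γ ∧ M.LipOn L γ univ ∧ 0 ≤ (γ 0).1 ∧ (γ 0).1 ≤ 4 * O.size * P ∧
    |(γ 0).2| ≤ O.size}

variable {O}

lemma Adm.mem_lengths (hs : IsWord P s) (h : O.Adm P s γ) {L : ℝ} (hL : M.LipOn L γ univ) :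
    L ∈ O.lengths P s := by
  obtain ⟨a, h1, h2, h3⟩ := h.exists_base hs hL.continuous
  refine ⟨_, h.shift a, fun x _ y _ => ?_, by simpa using h1, by simpa using h2, by simpa using h3⟩
  simpa using hL (x + a) (mem_univ _) (y + a) (mem_univ _)

lemma le_of_quasi (h : QuasiPeriodic (lat (O.period P)) γ) {L : ℝ} (hL : M.LipOn L γ univ) :
    M.lo * (4 * O.size * P) ≤ L := by
  have h1 := M.lo_le_dist (γ 1) (γ 0)
  have h2 := hL 1 (mem_univ _) 0 (mem_univ _)
  have h3 : γ 1 - γ 0 = lat (O.period P) := by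
    rw [sub_eq_iff_eq_add', ← h 0]; simp
  rw [h3, lat_period] at h1
  have h4 := abs_fst_le ((4 * (O.size : ℝ) * P, 0) : ℝ × ℝ)
  have h5 := le_abs_self (4 * (O.size : ℝ) * P)
  have h6 := mul_le_mul_of_nonneg_left (h5.trans h4) M.lo_pos.le
  simp only [sub_zero, abs_one, mul_one] at h2
  linarith

/-- A curve which is minimal among the limits of admissible curves. -/
structure Minimizer (O : Obstacle M) (P : ℕ) (s : ℤ → ℝ) (L : ℝ) (γ : ℝ → ℝ × ℝ) : Prop where
  pos : 0 < L
  le : L ≤ M.hi * (4 * O.size * P)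
  quasi : QuasiPeriodic (lat (O.period P)) γ
  lip : M.LipOn L γ univ
  base : 0 ≤ (γ 0).1 ∧ (γ 0).1 ≤ 4 * O.size * P ∧ |(γ 0).2| ≤ O.size
  far : ∀ (j : ℤ) (t : ℝ), O.ρ ≤ ‖γ t - O.pt j‖
  side : ∀ j : ℤ, 0 ≤ j → j < P → HasSide γ (O.pt j) (s j)
  exact : ∀ t, ∃ ε > 0, ∀ s₁ s₂, t - ε ≤ s₁ → s₁ ≤ s₂ → s₂ ≤ t + ε →
    M.dist (γ s₁) (γ s₂) = L * (s₂ - s₁)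

lemma exists_minimizer (O : Obstacle M) (hs : IsWord P s) : ∃ L γ, O.Minimizer P s L γ := by
  have hP := hs.pos
  have hlo := M.lo_pos
  have hhi := M.hi_pos
  have hW0 : 0 < 4 * (O.size : ℝ) * P := width_pos hP
  obtain ⟨γ₀, hγ₀, hL₀⟩ := O.exists_adm hs
  have hmem₀ := hγ₀.mem_lengths hs hL₀
  have hbelow : ∀ L ∈ O.lengths P s, M.lo * (4 * O.size * P) ≤ L := by
    rintro L ⟨γ, h1, h2, -⟩
    exact le_of_quasi h1.quasi h2
  have hbdd : BddBelow (O.lengths P s) := ⟨_, hbelow⟩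
  set L := sInf (O.lengths P s) with hL
  have hLpos : 0 < L := (mul_pos hlo hW0).trans_le (le_csInf ⟨_, hmem₀⟩ hbelow)
  have hseq : ∀ n : ℕ, ∃ l ∈ O.lengths P s, l < L + 1 / (n + 1 : ℝ) := fun n =>
    exists_lt_of_csInf_lt ⟨_, hmem₀⟩ (by
      have : (0 : ℝ) < 1 / (n + 1 : ℝ) := by positivity
      linarith)
  choose l hl hlt using hseq
  choose f hfA hfl hf1 hf2 hf3 using hl
  have hl1 : ∀ n, l n ≤ L + 1 := fun n => by
    have : 1 / (n + 1 : ℝ) ≤ 1 := by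
      rw [div_le_one (by positivity)]
      linarith [(Nat.cast_nonneg n : (0 : ℝ) ≤ n)]
    linarith [hlt n]
  have hfl1 : ∀ n, M.LipOn (L + 1) (f n) univ := fun n => (hfl n).of_le (hl1 n)
  set 𝒰 : Ultrafilter ℕ := hyperfilter ℕ with h𝒰
  have h𝒰top : (𝒰 : Filter ℕ) ≤ atTop := by
    rw [← Nat.cofinite_eq_atTop]; exact hyperfilter_le_cofinite
  have hllim : Tendsto l 𝒰 (𝓝 L) := by
    refine Tendsto.mono_left ?_ h𝒰top
    refine tendsto_of_tendsto_of_tendsto_of_le_of_le tendsto_const_nhds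
      (h := fun n : ℕ => L + 1 / (n + 1 : ℝ)) ?_
      (fun n => csInf_le hbdd ⟨_, hfA n, hfl n, hf1 n, hf2 n, hf3 n⟩) (fun n => (hlt n).le)
    simpa using (tendsto_one_div_add_atTop_nhds_zero_nat (𝕜 := ℝ)).const_add L
  have hlim : ∀ t, ∃ x, Tendsto (fun n => f n t) 𝒰 (𝓝 x) := by
    intro t
    have hb : ∀ n, f n t ∈ Metric.closedBall (0 : ℝ × ℝ)
        (4 * O.size * P + O.size + (L + 1) / M.lo * |t - 0|) := fun n => by
      rw [mem_closedBall_zero_iff]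
      have h1 := (hfl1 n).norm_sub_le (mem_univ t) (mem_univ 0)
      have h2 : ‖f n 0‖ ≤ 4 * O.size * P + O.size := by
        have := O.size_pos'
        rw [norm_prod_eq]
        exact max_le (by rw [abs_of_nonneg (hf1 n)]; linarith [hf2 n]) (by linarith [hf3 n])
      linarith [norm_sub_norm_le (f n t) (f n 0)]
    obtain ⟨x, -, hx⟩ := (isCompact_closedBall (0 : ℝ × ℝ) _).ultrafilter_le_nhds'
      (𝒰.map fun n => f n t) (Ultrafilter.mem_map.2 (univ_mem' hb))
    exact ⟨x, hx⟩
  choose γ hγ using hlim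
  have hγq : QuasiPeriodic (lat (O.period P)) γ := fun t =>
    tendsto_nhds_unique (hγ (t + 1)) (((hγ t).add_const _).congr fun n => ((hfA n).quasi t).symm)
  have hγl : M.LipOn L γ univ := fun x _ y _ =>
    le_of_tendsto_of_tendsto' (M.tendsto_dist (hγ x) (hγ y)) (hllim.mul_const _)
      fun n => hfl n x (mem_univ _) y (mem_univ _)
  have hfar : ∀ (j : ℤ) (t : ℝ), O.ρ ≤ ‖γ t - O.pt j‖ := fun j t =>
    ge_of_tendsto' ((hγ t).sub_const _).norm fun n => (hfA n).rho_le hP (hfl n).continuous j t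
  have hclose : ∀ ε > 0, ∀ᶠ n in (𝒰 : Filter ℕ), ∀ t, ‖f n t - γ t‖ ≤ ε := fun ε hε =>
    eventually_close hfl1 (hγl.of_le (by linarith)) (fun n => (hfA n).quasi) hγq hγ hε
  have hρ := O.ρ_pos
  refine ⟨L, γ, hLpos, csInf_le hbdd hmem₀, hγq, hγl, ⟨?_, ?_, ?_⟩, hfar, fun j h0 h1 => ?_,
    fun t => ?_⟩
  · exact ge_of_tendsto' (continuous_fst.tendsto _ |>.comp (hγ 0)) hf1
  · exact le_of_tendsto' (continuous_fst.tendsto _ |>.comp (hγ 0)) hf2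
  · exact le_of_tendsto' ((continuous_abs.comp continuous_snd).tendsto _ |>.comp (hγ 0)) hf3
  · obtain ⟨n, hn⟩ := (hclose (O.ρ / 4) (by linarith)).exists
    have hlim := (quasi' (hfA n).quasi).tendsto_norm hW0 (hfl n).continuous
    exact ((hfA n).side j h0 h1).stable (hfl n).continuous hγl.continuous
      (fun t => by rw [norm_sub_rev]; exact hn t)
      (fun t => by linarith [(hfA n).rho_le hP (hfl n).continuous j t]) hlim.1 hlim.2
  · obtain ⟨r, hr, H⟩ := O.convex (γ t) (O.ρ / 16) (by linarith)
    set r' := min r (O.ρ / 16) with hr'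
    have hr'0 : 0 < r' := lt_min hr (by linarith)
    set τ := min (1 / 4) (r' / (4 * (L / M.lo))) with hτ
    have hLlo : 0 < L / M.lo := by positivity
    have hτ0 : 0 < τ := lt_min (by norm_num) (by positivity)
    have hτr : L / M.lo * τ ≤ r' / 4 := by
      have := min_le_right (1 / 4) (r' / (4 * (L / M.lo)))
      rw [le_div_iff₀ (by positivity)] at this
      linarith
    refine ⟨τ, hτ0, fun s₁ s₂ hs1 hs12 hs2 => ?_⟩
    have hle := hγl s₁ (mem_univ _) s₂ (mem_univ _)
    rw [abs_sub_comm, abs_of_nonneg (sub_nonneg.2 hs12)] at hle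
    by_contra hne
    have hltd := lt_of_le_of_ne hle hne
    have hs12' : s₁ < s₂ := by
      refine lt_of_le_of_ne hs12 fun e => ?_
      subst e
      rw [sub_self, mul_zero] at hltd
      exact absurd (M.dist_nonneg _ _) (not_le.2 hltd)
    set κ := (L * (s₂ - s₁) - M.dist (γ s₁) (γ s₂)) / 4 with hκ
    have hκ0 : 0 < κ := by rw [hκ]; linarith
    obtain ⟨n, hn1, hn2⟩ := ((hclose (min (r' / 4) (κ / (2 * M.hi)))
      (lt_min (by linarith) (by positivity))).and (hllim.eventually_lt_const
        (show L < L + κ by linarith))).exists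
    have hnr : ∀ x, ‖f n x - γ x‖ ≤ r' / 4 := fun x => (hn1 x).trans (min_le_left _ _)
    have hnκ : ∀ x, M.hi * ‖f n x - γ x‖ ≤ κ / 2 := fun x => by
      have := (hn1 x).trans (min_le_right _ _)
      rw [le_div_iff₀ (by positivity)] at this
      linarith
    have hball : ∀ x ∈ Icc s₁ s₂, f n x ∈ Metric.ball (γ t) r' := fun x hx => by
      rw [Metric.mem_ball, dist_eq_norm]
      have h1 := hγl.norm_sub_le (mem_univ x) (mem_univ t)
      have h2 : |x - t| ≤ τ := by rw [abs_le]; constructor <;> linarith [hx.1, hx.2]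
      have h3 := mul_le_mul_of_nonneg_left h2 hLlo.le
      have h4 := hnr x
      have e : f n x - γ t = (f n x - γ x) + (γ x - γ t) := by abel
      rw [e]
      linarith [norm_add_le (f n x - γ x) (γ x - γ t)]
    have hfc := (hfl n).continuous
    obtain ⟨η, hη1, hη2, hη3, hη4⟩ := H (f n '' Icc s₁ s₂) (by
        rintro _ ⟨x, hx, rfl⟩
        exact ⟨Metric.ball_subset_ball (min_le_left _ _) (hball x hx), (hfA n).avoid x⟩)
      (isPreconnected_Icc.image _ hfc.continuousOn) _ (mem_image_of_mem _ (left_mem_Icc.2 hs12))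
      _ (mem_image_of_mem _ (right_mem_Icc.2 hs12)) κ hκ0
    have hu1 : s₂ - s₁ < 1 := by
      have : τ ≤ 1 / 4 := min_le_left _ _
      linarith
    have hln : 0 < l n := hLpos.trans_le (csInf_le hbdd ⟨_, hfA n, hfl n, hf1 n, hf2 n, hf3 n⟩)
    have hflip : M.LipOn (l n) (fun x => f n (x + s₁)) univ := fun x _ y _ => by
      simpa using hfl n (x + s₁) (mem_univ _) (y + s₁) (mem_univ _)
    obtain ⟨β, hβ1, hβ2⟩ := ((hfA n).shift s₁).modify hP hln hflip
      (u := s₂ - s₁) (ε := O.ρ / 8) (sub_pos.2 hs12') hu1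
      (add_pos_of_nonneg_of_pos (M.dist_nonneg _ _) hκ0) hη1
      (by simp [hη2]) (by simp [hη3]) (fun x hx => (hη4 x hx).2) (by linarith) (fun x hx => by
        have h1 := (hη4 (x / (s₂ - s₁)) ⟨div_nonneg hx.1 (sub_pos.2 hs12').le,
          (div_le_one (sub_pos.2 hs12')).2 hx.2⟩).1
        have h2 := hball (x + s₁) ⟨by linarith [hx.1], by linarith [hx.2]⟩
        have h3 : r' ≤ O.ρ / 16 := min_le_right _ _
        rw [Metric.mem_ball] at h1 h2
        rw [← dist_eq_norm]
        linarith [dist_triangle_right (η (x / (s₂ - s₁))) (f n (x + s₁)) (γ t)])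
    have h1 : L ≤ _ := csInf_le hbdd (hβ1.mem_lengths hs hβ2)
    have h2 := M.dist_le_add (f n s₁) (f n s₂) (γ s₁) (γ s₂)
    have h3 := hnκ s₁
    have h4 := hnκ s₂
    have h5 : l n * (1 - (s₂ - s₁)) ≤ (L + κ) * (1 - (s₂ - s₁)) :=
      mul_le_mul_of_nonneg_right hn2.le (by linarith)
    nlinarith

end Obstacle

lemma norm_le_norm2 (v : ℝ × ℝ) : ‖v‖ ≤ norm2 v := by
  rw [norm_prod_eq]
  exact max_le (Real.abs_le_sqrt (by nlinarith [sq_nonneg v.2]))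
    (Real.abs_le_sqrt (by nlinarith [sq_nonneg v.1]))

lemma exists_lat_of_phaseDist_lt {p q : (ℝ × ℝ) × (ℝ × ℝ)} {δ : ℝ} (h : phaseDist p q < δ) :
    ∃ k, ‖p.1 - q.1 - lat k‖ < δ := by
  unfold phaseDist at h
  obtain ⟨_, ⟨k, rfl⟩, hk⟩ := exists_lt_of_csInf_lt (by exact ⟨_, 0, rfl⟩) h
  refine ⟨k, ?_⟩
  have h1 := norm_le_norm2 (p.1 - (q.1 + lat k))
  have h2 : 0 ≤ norm2 (p.2 - q.2) := Real.sqrt_nonneg _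
  rw [sub_sub]; linarith

lemma phaseDist_self_le (p : (ℝ × ℝ) × (ℝ × ℝ)) : phaseDist p p ≤ 0 := by
  refine csInf_le ⟨0, ?_⟩ ⟨0, by simp [lat, norm2]⟩
  rintro _ ⟨k, rfl⟩
  exact add_nonneg (Real.sqrt_nonneg _) (Real.sqrt_nonneg _)

lemma norm_lat (k : ℤ × ℤ) : ‖lat k‖ = ((max |k.1| |k.2| : ℤ) : ℝ) := by
  rw [norm_prod_eq]; simp [lat]

/-- A path in the plane which stays close to the lattice and starts close to the origin stays
close to the origin. -/
lemma norm_lt_of_close_lat {D : ℝ → ℝ × ℝ} (hD : Continuous D) {T δ : ℝ} (hδ : δ ≤ 1 / 4)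
    (h0 : ‖D 0‖ < 1 / 2) (h : ∀ t ∈ Icc (0 : ℝ) T, ∃ k, ‖D t - lat k‖ < δ) :
    ∀ t ∈ Icc (0 : ℝ) T, ‖D t‖ < δ := by
  have hIn : ∀ t k, ‖D t - lat k‖ < δ → |‖D t‖ - ‖lat k‖| < 1 / 4 := fun t k hk =>
    ((abs_norm_sub_norm_le _ _).trans_lt hk).trans_le hδ
  have hhalf : ∀ t ∈ Icc (0 : ℝ) T, ‖D t‖ < 1 / 2 := by
    intro t ht
    by_contra! hle
    obtain ⟨u, hu, hu'⟩ := intermediate_value_Icc ht.1 hD.norm.continuousOn ⟨h0.le, hle⟩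
    obtain ⟨k, hk⟩ := h u ⟨hu.1, hu.2.trans ht.2⟩
    have h1 := abs_lt.1 (hIn u k hk)
    simp only at hu'
    rw [hu', norm_lat] at h1
    have h2 : (0 : ℝ) < ((max |k.1| |k.2| : ℤ) : ℝ) := by linarith
    have h3 : ((max |k.1| |k.2| : ℤ) : ℝ) < 1 := by linarith
    have h4 : 0 < max |k.1| |k.2| := by exact_mod_cast h2
    have h5 : max |k.1| |k.2| < 1 := by exact_mod_cast h3
    omega
  intro t ht
  obtain ⟨k, hk⟩ := h t ht
  have h1 := abs_lt.1 (hIn t k hk)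
  have h2 := hhalf t ht
  rw [norm_lat] at h1
  have h3 : ((max |k.1| |k.2| : ℤ) : ℝ) < 1 := by linarith
  have h5 : max |k.1| |k.2| < 1 := by exact_mod_cast h3
  have h6 := max_lt_iff.1 h5
  have h7 := Int.abs_lt_one_iff.1 h6.1
  have h8 := Int.abs_lt_one_iff.1 h6.2
  have : lat k = 0 := by ext <;> simp [lat, h7, h8]
  rwa [this, sub_zero] at hk

namespace Obstacle

variable {M : TorusMetric} {O : Obstacle M} {P : ℕ} {s s' : ℤ → ℝ} {γ γ' : ℝ → ℝ × ℝ} {L L' : ℝ}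

lemma Minimizer.norm_sub_le (h : O.Minimizer P s L γ) (x y : ℝ) :
    ‖γ (x / L) - γ (y / L)‖ ≤ M.lo⁻¹ * |x - y| := by
  have h0 := h.pos
  refine (h.lip.norm_sub_le (mem_univ _) (mem_univ _)).trans (le_of_eq ?_)
  rw [← sub_div, abs_div, abs_of_pos h0]
  have := M.lo_pos
  field_simp

lemma Minimizer.isGeodesic (h : O.Minimizer P s L γ) : M.IsGeodesic fun t => γ (t / L) := by
  have h0 := h.pos
  have hlip : LipschitzWith (M.lo⁻¹).toNNReal fun t => γ (t / L) :=
    LipschitzWith.of_dist_le_mul fun x y => by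
      rw [dist_eq_norm, Real.dist_eq, Real.coe_toNNReal _ (inv_nonneg.2 M.lo_pos.le)]
      exact h.norm_sub_le x y
  refine TorusMetric.LocIso.isGeodesic (fun t => ?_) hlip
  obtain ⟨ε, hε, H⟩ := h.exact (t / L)
  refine ⟨L * ε, by positivity, fun s₁ s₂ h1 h2 h3 => ?_⟩
  rw [H (s₁ / L) (s₂ / L)]
  · field_simp
  · rw [le_div_iff₀ h0, sub_mul, div_mul_cancel₀ _ h0.ne']; linarith
  · exact div_le_div_of_nonneg_right h2 h0.le
  · rw [div_le_iff₀ h0, add_mul, div_mul_cancel₀ _ h0.ne']; linarith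

/-- Minimizers whose orbits stay close belong to the same word. -/
lemma Minimizer.side_eq (hP : 0 < P) (h : O.Minimizer P s L γ) (h' : O.Minimizer P s' L' γ')
    {ε T : ℝ} (hε0 : 0 < ε) (hε : ε ≤ 1 / 8) (hερ : 2 * (2 * ε + M.lo⁻¹ * ε) < O.ρ) (hL : |L - L'| ≤ ε)
    (h0 : ‖γ 0 - γ' 0‖ < 1 / 2) (hT : L ≤ T)
    (hd : ∀ t ∈ Icc (0 : ℝ) T, phaseDist (γ (t / L), deriv (fun t => γ (t / L)) t)
      (γ' (t / L'), deriv (fun t => γ' (t / L')) t) ≤ ε) :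
    ∀ j : ℤ, 0 ≤ j → j < P → s j = s' j := by
  have hc := h.lip.continuous
  have hc' := h'.lip.continuous
  have hL0 := h.pos
  have hL0' := h'.pos
  have hnear := norm_lt_of_close_lat (D := fun t => γ (t / L) - γ' (t / L')) (T := T) (δ := 2 * ε)
    (by fun_prop) (by linarith) (by simpa using h0)
    (fun t ht => exists_lat_of_phaseDist_lt ((hd t ht).trans_lt (by linarith)))
  have hunif : ∀ x ∈ Icc (0 : ℝ) 1, ‖γ' x - γ x‖ ≤ 2 * ε + M.lo⁻¹ * ε := by
    intro x hx
    have h1 := hnear (L * x) ⟨mul_nonneg hL0.le hx.1, by nlinarith [hx.2]⟩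
    have h2 := h'.norm_sub_le (L * x) (L' * x)
    simp only [mul_div_cancel_left₀ _ hL0.ne'] at h1
    rw [mul_div_cancel_left₀ _ hL0'.ne', ← sub_mul, abs_mul, abs_of_nonneg hx.1] at h2
    have h3 : |L - L'| * x ≤ ε := by nlinarith [hx.2, hx.1, abs_nonneg (L - L')]
    have h4 := mul_le_mul_of_nonneg_left h3 (inv_nonneg.2 M.lo_pos.le)
    have e : γ' x - γ x = -(γ x - γ' (L * x / L')) - (γ' (L * x / L') - γ' x) := by abel
    rw [e]
    have h5 := _root_.norm_sub_le (-(γ x - γ' (L * x / L'))) (γ' (L * x / L') - γ' x)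
    rw [norm_neg] at h5
    linarith
  have hunif' := h.quasi.norm_sub_le h'.quasi hunif
  have hlim := (quasi' h.quasi).tendsto_norm (width_pos hP) hc
  intro j hj hj'
  exact ((h.side j hj hj').stable hc hc' hunif' (fun t => hερ.trans_le (h.far j t))
    hlim.1 hlim.2).unique (h'.side j hj hj')

end Obstacle

/-- The periodic word determined by a block of letters. -/
def wordOf {m : ℕ} (w : Fin m → Bool) (j : ℤ) : ℝ :=
  if h : (j % (m + 2 : ℕ)).toNat < m then (if w ⟨_, h⟩ then 1 else -1)
  else if (j % (m + 2 : ℕ)).toNat = m then 1 else -1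

lemma isWord_wordOf {m : ℕ} (w : Fin m → Bool) : IsWord (m + 2) (wordOf w) := by
  refine ⟨fun j => ?_, fun j => ?_, ⟨m, by omega, by push_cast; omega, ?_⟩,
    ⟨m + 1, by omega, by push_cast; omega, ?_⟩⟩
  · unfold wordOf; split_ifs <;> simp
  · simp only [wordOf, Int.add_emod_right]
  · have : ((m : ℤ) % (m + 2 : ℕ)).toNat = m := by
      rw [Int.emod_eq_of_lt (by omega) (by push_cast; omega)]; simp
    rw [wordOf, dif_neg (by rw [this]; omega), if_pos this]
  · have : ((m + 1 : ℤ) % (m + 2 : ℕ)).toNat = m + 1 := by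
      rw [Int.emod_eq_of_lt (by omega) (by push_cast; omega)]; omega
    rw [wordOf, dif_neg (by rw [this]; omega), if_neg (by rw [this]; omega)]

lemma wordOf_injective {m : ℕ} {w w' : Fin m → Bool}
    (h : ∀ j : ℤ, 0 ≤ j → j < (m + 2 : ℕ) → wordOf w j = wordOf w' j) : w = w' := by
  funext i
  have hi := h i (by omega) (by have := i.2; push_cast; omega)
  have e : ((i : ℤ) % (m + 2 : ℕ)).toNat = i := by
    rw [Int.emod_eq_of_lt (by omega) (by have := i.2; push_cast; omega)]; simp
  have h1 : ∀ u : Fin m → Bool, wordOf u i = if u i then 1 else -1 := fun u => by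
    have hlt : ((i : ℤ) % (m + 2 : ℕ)).toNat < m := by rw [e]; exact i.2
    rw [wordOf, dif_pos hlt]
    have : (⟨_, hlt⟩ : Fin m) = i := Fin.ext e
    rw [this]
  rw [h1, h1] at hi
  cases hw : w i <;> cases hw' : w' i <;> simp [hw, hw'] at hi ⊢ <;> norm_num at hi

lemma abs_sub_lt_of_floor_eq {x y ε : ℝ} (hε : 0 < ε) (hx : 0 ≤ x) (hy : 0 ≤ y)
    (h : ⌊x / ε⌋₊ = ⌊y / ε⌋₊) : |x - y| < ε := by
  have h1 := Nat.floor_le (div_nonneg hx hε.le)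
  have h2 := Nat.lt_floor_add_one (x / ε)
  have h3 := Nat.floor_le (div_nonneg hy hε.le)
  have h4 := Nat.lt_floor_add_one (y / ε)
  rw [h] at h1 h2
  have h5 : |(x - y) / ε| < 1 := by
    rw [sub_div, abs_lt]; constructor <;> linarith
  rwa [abs_div, abs_of_pos hε, div_lt_one hε] at h5

lemma floor_mem_range {x X ε : ℝ} (hε : 0 < ε) (h : x ≤ X) :
    ⌊x / ε⌋₊ ∈ Finset.range (⌊X / ε⌋₊ + 1) :=
  Finset.mem_range.2 (Nat.lt_succ_of_le (Nat.floor_le_floor (div_le_div_of_nonneg_right h hε.le)))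

lemma floor_card_le {X ε : ℝ} (hε : 0 < ε) (h : 0 ≤ X) :
    ((Finset.range (⌊X / ε⌋₊ + 1)).card : ℝ) ≤ X / ε + 1 := by
  rw [Finset.card_range]; push_cast
  linarith [Nat.floor_le (div_nonneg h hε.le)]

namespace Obstacle

variable {M : TorusMetric}

/-- The geodesic flow has exponentially large separated sets. -/
lemma exists_separated (O : Obstacle M) : ∃ C₀ > 0, ∃ ε > 0, ∃ C > 0, ∀ m : ℕ,
    ∃ F, IsSeparated M ε (C₀ * (m + 2 : ℕ)) F ∧ (2 : ℝ) ^ m ≤ F.card * (C * (m + 2 : ℕ) ^ 2) := by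
  classical
  have hlo := M.lo_pos
  have hhi := M.hi_pos
  have hn := O.size_pos'
  have hρ := O.ρ_pos
  set C₀ : ℝ := M.hi * (4 * O.size) with hC₀
  have hC₀0 : 0 < C₀ := by positivity
  set ε : ℝ := min (1 / 8) (O.ρ / (4 * (2 + M.lo⁻¹))) with hε
  have hi0 : 0 < M.lo⁻¹ := inv_pos.2 hlo
  have hε0 : 0 < ε := lt_min (by norm_num) (by positivity)
  have hε8 : ε ≤ 1 / 8 := min_le_left _ _
  have hερ : 2 * (2 * ε + M.lo⁻¹ * ε) < O.ρ := by
    have := min_le_right (1 / 8) (O.ρ / (4 * (2 + M.lo⁻¹)))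
    rw [← hε, le_div_iff₀ (by positivity)] at this
    linarith
  refine ⟨C₀, hC₀0, ε, hε0, (C₀ / ε + 1) * (4 * O.size / (1 / 8) + 1) * (2 * O.size / (1 / 8) + 1),
    by positivity, fun m => ?_⟩
  set P := m + 2 with hP
  have hP0 : 0 < P := by omega
  have hP1 : (1 : ℝ) ≤ (P : ℕ) := by exact_mod_cast hP0
  have hmin : ∀ w : Fin m → Bool, ∃ L γ, O.Minimizer P (wordOf w) L γ := fun w =>
    O.exists_minimizer (isWord_wordOf w)
  choose L γ h using hmin
  set Γ : (Fin m → Bool) → ℝ → ℝ × ℝ := fun w t => γ w (t / L w) with hΓ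
  set b : (Fin m → Bool) → ℕ × ℕ × ℕ := fun w => (⌊L w / ε⌋₊, ⌊(γ w 0).1 / (1 / 8)⌋₊,
    ⌊((γ w 0).2 + O.size) / (1 / 8)⌋₊) with hb
  set W : Finset (ℕ × ℕ × ℕ) := Finset.range (⌊C₀ * P / ε⌋₊ + 1) ×ˢ
    Finset.range (⌊4 * O.size * P / (1 / 8 : ℝ)⌋₊ + 1) ×ˢ
    Finset.range (⌊2 * O.size / (1 / 8 : ℝ)⌋₊ + 1) with hW
  have hmaps : ∀ w ∈ (Finset.univ : Finset (Fin m → Bool)), b w ∈ W := by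
    intro w _
    have hw := h w
    have h1 := hw.le
    have h2 := abs_le.1 hw.base.2.2
    simp only [hW, hb, Finset.mem_product]
    exact ⟨floor_mem_range hε0 (by rw [hC₀]; linarith), floor_mem_range (by norm_num) hw.base.2.1,
      floor_mem_range (by norm_num) (by linarith)⟩
  have hWne : W.Nonempty := ⟨b (fun _ => true), hmaps _ (Finset.mem_univ _)⟩
  have hWcard : (W.card : ℝ) ≤ (C₀ / ε + 1) * (4 * O.size / (1 / 8) + 1) *
      (2 * O.size / (1 / 8) + 1) * (P : ℕ) ^ 2 := by
    rw [hW, Finset.card_product, Finset.card_product]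
    push_cast
    have h1 := floor_card_le (X := C₀ * P) hε0 (by positivity)
    have h2 := floor_card_le (X := 4 * O.size * P) (ε := 1 / 8) (by norm_num) (by positivity)
    have h3 := floor_card_le (X := 2 * (O.size : ℝ)) (ε := 1 / 8) (by norm_num) (by positivity)
    have h4 : C₀ * P / ε + 1 ≤ (C₀ / ε + 1) * P := by rw [add_mul, mul_div_right_comm]; linarith
    have h5 : 4 * O.size * P / (1 / 8 : ℝ) + 1 ≤ (4 * O.size / (1 / 8) + 1) * P := by
      rw [add_mul, mul_div_right_comm]; linarith
    calc _ ≤ ((C₀ / ε + 1) * P) * (((4 * O.size / (1 / 8) + 1) * P) * (2 * O.size / (1 / 8) + 1)) := by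
          refine mul_le_mul (h1.trans h4) (mul_le_mul (h2.trans h5) h3 (by positivity)
            (by positivity)) (by positivity) (by positivity)
      _ = _ := by ring
  have hWpos : (0 : ℝ) < W.card := by exact_mod_cast hWne.card_pos
  obtain ⟨y, -, hy⟩ := Finset.exists_le_card_fiber_of_nsmul_le_card_of_maps_to
    (b := (2 : ℝ) ^ m / W.card) hmaps hWne (by
      rw [nsmul_eq_mul, mul_div_cancel₀ _ hWpos.ne']
      simp)
  set S := Finset.univ.filter fun w => b w = y with hS
  have hsep : ∀ w ∈ S, ∀ w' ∈ S, w ≠ w' → ∃ t ∈ Icc (0 : ℝ) (C₀ * P),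
      ε < phaseDist (Γ w t, deriv (Γ w) t) (Γ w' t, deriv (Γ w') t) := by
    intro w hw w' hw' hne
    by_contra! hcon
    have hbb : b w = b w' := by
      rw [(Finset.mem_filter.1 hw).2, (Finset.mem_filter.1 hw').2]
    simp only [hb, Prod.mk.injEq] at hbb
    have a1 := (h w).base
    have a2 := (h w').base
    have a3 := abs_le.1 a1.2.2
    have a4 := abs_le.1 a2.2.2
    have d1 := abs_sub_lt_of_floor_eq hε0 (h w).pos.le (h w').pos.le hbb.1
    have d2 := abs_sub_lt_of_floor_eq (by norm_num) a1.1 a2.1 hbb.2.1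
    have d3 := abs_sub_lt_of_floor_eq (by norm_num) (by linarith) (by linarith) hbb.2.2
    rw [add_sub_add_right_eq_sub] at d3
    refine hne (wordOf_injective ((h w).side_eq hP0 (h w') hε0 hε8 hερ d1.le ?_
      (T := C₀ * P) ?_ hcon))
    · rw [norm_prod_eq]
      exact max_lt (d2.trans (by norm_num)) (d3.trans (by norm_num))
    · have := (h w).le; rw [hC₀]; linarith
  have hinj : Set.InjOn Γ S := by
    intro w hw w' hw' he
    by_contra hne
    obtain ⟨t, -, ht⟩ := hsep w hw w' hw' hne
    rw [he] at ht
    linarith [phaseDist_self_le (Γ w' t, deriv (Γ w') t)]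
  refine ⟨S.image Γ, ⟨?_, ?_⟩, ?_⟩
  · intro c hc
    obtain ⟨w, -, rfl⟩ := Finset.mem_image.1 hc
    exact (h w).isGeodesic
  · intro c hc c' hc' hne
    obtain ⟨w, hw, rfl⟩ := Finset.mem_image.1 hc
    obtain ⟨w', hw', rfl⟩ := Finset.mem_image.1 hc'
    exact hsep w hw w' hw' fun e => hne (by rw [e])
  · rw [Finset.card_image_of_injOn hinj]
    rw [div_le_iff₀ hWpos] at hy
    exact hy.trans (mul_le_mul_of_nonneg_left hWcard (Nat.cast_nonneg _))

end Obstacle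

lemma log_le_elog {n : ℕ} {x : ℝ≥0∞} (hn : 0 < n) (h : (n : ℝ≥0∞) ≤ x) :
    ((Real.log n : ℝ) : EReal) ≤ elog x := by
  have h0 : x ≠ 0 := fun e => by
    rw [e] at h
    simp at h; omega
  rw [elog, if_neg h0]
  split_ifs with ht
  · exact le_top
  · refine EReal.coe_le_coe_iff.2 (Real.log_le_log (by exact_mod_cast hn) ?_)
    have := ENNReal.toReal_mono ht h
    simpa using this

/-- An exponential lower bound for the size of separated sets gives positive entropy. -/
lemma topEnt_pos_of_separated {M : TorusMetric} {C₀ ε C : ℝ} (hC₀ : 0 < C₀) (hε : 0 < ε) (hC : 0 < C)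
    (h : ∀ m : ℕ, ∃ F, IsSeparated M ε (C₀ * (m + 2 : ℕ)) F ∧
      (2 : ℝ) ^ m ≤ F.card * (C * (m + 2 : ℕ) ^ 2)) : 0 < topEnt M := by
  set a : ℝ := Real.log 2 / (4 * C₀) with ha
  have hl2 : 0 < Real.log 2 := Real.log_pos (by norm_num)
  have ha0 : 0 < a := by positivity
  have hkey : ∀ᶠ m : ℕ in atTop, ((a : ℝ) : EReal) ≤
      (((C₀ * (m + 2 : ℕ))⁻¹ : ℝ) : EReal) * elog (sepCount M ε (C₀ * (m + 2 : ℕ))) := by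
    have hgrow : ∀ᶠ m : ℕ in atTop, C * ((m + 2 : ℕ) : ℝ) ^ 2 ≤ Real.exp (m * (Real.log 2 / 2)) := by
      have h1 : Tendsto (fun m : ℕ => (Real.log 2 / 2) * (m + 2 : ℕ)) atTop atTop :=
        (tendsto_natCast_atTop_atTop.comp (tendsto_add_atTop_nat 2)).const_mul_atTop (by positivity)
      have h2 := (Real.tendsto_exp_div_pow_atTop 2).comp h1
      filter_upwards [h2.eventually_ge_atTop (C * Real.exp (Real.log 2) / (Real.log 2 / 2) ^ 2)]
        with m hm
      have hm2 : (0 : ℝ) < ((m + 2 : ℕ) : ℝ) := by positivity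
      simp only [Function.comp] at hm
      rw [le_div_iff₀ (by positivity)] at hm
      have e1 : C * Real.exp (Real.log 2) / (Real.log 2 / 2) ^ 2 *
          (Real.log 2 / 2 * ((m + 2 : ℕ) : ℝ)) ^ 2 =
          (C * ((m + 2 : ℕ) : ℝ) ^ 2) * Real.exp (Real.log 2) := by field_simp
      have e2 : Real.exp (Real.log 2 / 2 * ((m + 2 : ℕ) : ℝ)) =
          Real.exp (m * (Real.log 2 / 2)) * Real.exp (Real.log 2) := by
        rw [← Real.exp_add]; congr 1; push_cast; ring
      rw [e1, e2] at hm
      exact le_of_mul_le_mul_right hm (Real.exp_pos _)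
    filter_upwards [hgrow, eventually_ge_atTop 2] with m hm hm2
    obtain ⟨F, hF, hcard⟩ := h m
    have hF0 : 0 < F.card := by
      rcases Nat.eq_zero_or_pos F.card with h0 | h0
      · rw [h0, Nat.cast_zero, zero_mul] at hcard
        exact absurd hcard (not_le.2 (by positivity))
      · exact h0
    have hFr : (0 : ℝ) < F.card := by exact_mod_cast hF0
    have hlog : m * (Real.log 2 / 2) ≤ Real.log F.card := by
      rw [Real.le_log_iff_exp_le hFr]
      have e1 : (2 : ℝ) ^ m = Real.exp (m * (Real.log 2 / 2)) * Real.exp (m * (Real.log 2 / 2)) := by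
        rw [← Real.exp_add, ← mul_add, add_halves, Real.exp_nat_mul, Real.exp_log (by norm_num)]
      rw [e1] at hcard
      exact le_of_mul_le_mul_right
        (hcard.trans (mul_le_mul_of_nonneg_left hm hFr.le)) (Real.exp_pos _)
    have hsc : ((Real.log F.card : ℝ) : EReal) ≤ elog (sepCount M ε (C₀ * (m + 2 : ℕ))) :=
      log_le_elog hF0 (le_iSup₂_of_le F hF le_rfl)
    have hm2' : (2 : ℝ) ≤ m := by exact_mod_cast hm2
    have hreal : a ≤ (C₀ * (m + 2 : ℕ))⁻¹ * Real.log F.card := by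
      rw [ha, inv_mul_eq_div, div_le_div_iff₀ (by positivity) (by positivity)]
      push_cast
      have h3 : Real.log 2 * (m + 2) ≤ 4 * Real.log F.card := by nlinarith
      nlinarith
    calc ((a : ℝ) : EReal) ≤ (((C₀ * (m + 2 : ℕ))⁻¹ * Real.log F.card : ℝ) : EReal) :=
          EReal.coe_le_coe_iff.2 hreal
      _ = (((C₀ * (m + 2 : ℕ))⁻¹ : ℝ) : EReal) * ((Real.log F.card : ℝ) : EReal) := EReal.coe_mul _ _
      _ ≤ _ := mul_le_mul_of_nonneg_left hsc (EReal.coe_nonneg.2 (by positivity))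
  have hT : Tendsto (fun m : ℕ => C₀ * ((m + 2 : ℕ) : ℝ)) atTop atTop :=
    (tendsto_natCast_atTop_atTop.comp (tendsto_add_atTop_nat 2)).const_mul_atTop hC₀
  have hfreq : ∃ᶠ T : ℝ in atTop, ((a : ℝ) : EReal) ≤
      ((T⁻¹ : ℝ) : EReal) * elog (sepCount M ε T) := hT.frequently hkey.frequently
  have hlim := Filter.le_limsup_of_frequently_le hfreq
  exact (EReal.coe_pos.2 ha0).trans_le (le_iSup₂_of_le ε hε hlim)

/-- **Lemma (two loops).** Let `g` be a Riemannian metric on `T²` and `c : ℝ → ℝ²` a lift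
of a geodesic with two self-intersections `c(t₁) = c(t₂)`, `c(t₃) = c(t₄)` where
`t₁ < t₂ < t₃ < t₄`.  Then the geodesic flow of `g` has positive topological entropy. -/
theorem stmt4 (M : TorusMetric) (c : ℝ → ℝ × ℝ) (hc : M.IsGeodesic c)
    (t₁ t₂ t₃ t₄ : ℝ) (h12 : t₁ < t₂) (h23 : t₂ < t₃) (h34 : t₃ < t₄)
    (e1 : c t₁ = c t₂) (e2 : c t₃ = c t₄) :
    0 < topEnt M := by
  obtain ⟨O⟩ := hc.exists_obstacle h12 h23 h34 e1 e2
  obtain ⟨C₀, hC₀, ε, hε, C, hC, h⟩ := O.exists_separated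
  exact topEnt_pos_of_separated hC₀ hε hC h
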